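/- Weighted coercivity for A: let d ≥ 11, p > p_JL with d/2 − γ ∉ ℕ. (i) Case p_w small: for every real p_w with 0 ≤ p_w < k0 + δ0 − 1 there exists c_{p_w} > 0 such that every radial u ∈ H¹_loc(ℝ^d) with ∫_{y≥1} u²/y^{2p_w+2} < ∞ satisfies ∫ |Au|²/(1+y^{2p_w}) ≥ c_{p_w}·[ ∫ |∂_y u|²/(1+y^{2p_w}) + ∫ u²/(y²(1+y^{2p_w})) ]. (ii) Case p_w large: for every real p_w > k0 + δ0 − 1 and M large enough (depending only on d and p_w) there exists c_{M,p_w} > 0 such that every radial u ∈ H¹_loc(ℝ^d) with ⟨u, Φ_M^{(1)}⟩ = 0 satisfies ∫ |Au|²/(1+y^{2p_w}) ≥ c_{M,p_w}·[ ∫ |∂_y u|²/(1+y^{2p_w}) + ∫ u²/(y²(1+y^{2p_w})) ] (quantities possibly infinite). -/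

import Mathlib

noncomputable section

open Real MeasureTheory Filter Asymptotics Set Topology ENNReal

namespace WaveBlowup

/-- The Joseph–Lundgren exponent `p_JL = 1 + 4/(d-4-2√(d-1))`. -/
def pJL (d : ℕ) : ℝ := 1 + 4 / ((d : ℝ) - 4 - 2 * Real.sqrt ((d : ℝ) - 1))

/-- The critical Sobolev exponent `s_c = d/2 - 2/(p-1)`. -/
def sCrit (d : ℕ) (p : ℝ) : ℝ := (d : ℝ) / 2 - 2 / (p - 1)

/-- `c_∞ = [(2/(p-1))(d-2-2/(p-1))]^{1/(p-1)}`. -/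
def cInfty (d : ℕ) (p : ℝ) : ℝ :=
  ((2 / (p - 1)) * ((d : ℝ) - 2 - 2 / (p - 1))) ^ ((1 : ℝ) / (p - 1))

/-- `△ = (d-2)² - 4 p c_∞^{p-1}`. -/
def discr (d : ℕ) (p : ℝ) : ℝ := ((d : ℝ) - 2) ^ 2 - 4 * p * cInfty d p ^ (p - 1)

/-- `γ = (d-2-√△)/2`. -/
def gam (d : ℕ) (p : ℝ) : ℝ := (((d : ℝ) - 2) - Real.sqrt (discr d p)) / 2

/-- `α = γ - 2/(p-1)`, the smaller root of `X² - (d-2-4/(p-1))X + 2(d-2-2/(p-1))`. -/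
def alph (d : ℕ) (p : ℝ) : ℝ := gam d p - 2 / (p - 1)

/-- `α₂`, the other root of the same quadratic (the sum of the roots is `d-2-4/(p-1)`). -/
def alph₂ (d : ℕ) (p : ℝ) : ℝ := ((d : ℝ) - 2 - 4 / (p - 1)) - alph d p

/-- `k₀ = ⌊d/2 - γ⌋`. -/
def kzero (d : ℕ) (p : ℝ) : ℕ := ⌊(d : ℝ) / 2 - gam d p⌋₊

/-- `δ₀ = d/2 - γ - k₀ ∈ (0,1)`. -/
def deltazero (d : ℕ) (p : ℝ) : ℝ := (d : ℝ) / 2 - gam d p - (kzero d p : ℝ)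

/-- `g = min(α, α₂ - α) - ε`. -/
def gconst (d : ℕ) (p ε : ℝ) : ℝ := min (alph d p) (alph₂ d p - alph d p) - ε

/-- `g' = min(g, 2, 1 + δ₀ - ε)`. -/
def gpconst (d : ℕ) (p ε : ℝ) : ℝ := min (gconst d p ε) (min 2 (1 + deltazero d p - ε))

/-- The ground state `Q` in radial representation: the unique smooth positive radially
symmetric solution of `ΔQ + Q^p = 0` on `ℝ^d` with `Q(0) = 1`. -/
structure IsGroundState (d : ℕ) (p : ℝ) (Q : ℝ → ℝ) : Prop where
  smooth : ContDiff ℝ (⊤ : ℕ∞) Q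
  pos : ∀ y : ℝ, 0 ≤ y → 0 < Q y
  ode : ∀ y : ℝ, 0 < y →
    deriv (deriv Q) y + ((d : ℝ) - 1) / y * deriv Q y + Q y ^ p = 0
  at0 : Q 0 = 1
  deriv0 : deriv Q 0 = 0

/-- `Λ⁽¹⁾Q = (2/(p-1) + y ∂_y) Q`. -/
def Lam1 (p : ℝ) (Q : ℝ → ℝ) : ℝ → ℝ := fun y => 2 / (p - 1) * Q y + y * deriv Q y

/-- The potential `W = ∂_y (log Λ⁽¹⁾Q)`. -/
def Wpot (p : ℝ) (Q : ℝ → ℝ) : ℝ → ℝ := fun y => deriv (fun z => Real.log (Lam1 p Q z)) y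

/-- `A u = -∂_y u + W u`. -/
def Aop (p : ℝ) (Q : ℝ → ℝ) (u : ℝ → ℝ) : ℝ → ℝ :=
  fun y => -deriv u y + Wpot p Q y * u y

/-- `A* u = y^{1-d} ∂_y (y^{d-1} u) + W u`. -/
def Astar (d : ℕ) (p : ℝ) (Q : ℝ → ℝ) (u : ℝ → ℝ) : ℝ → ℝ :=
  fun y => deriv (fun z => z ^ (d - 1) * u z) y / y ^ (d - 1) + Wpot p Q y * u y

/-- The linearized operator `L = -Δ - pQ^{p-1}` on radial functions. -/
def Lop (d : ℕ) (p : ℝ) (Q : ℝ → ℝ) (u : ℝ → ℝ) : ℝ → ℝ :=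
  fun y => -(deriv (deriv u) y + ((d : ℝ) - 1) / y * deriv u y) - p * Q y ^ (p - 1) * u y

/-- Adapted derivatives: `u_0 = u`, `u_{k+1} = A u_k` for `k` even, `u_{k+1} = A* u_k`
for `k` odd. -/
def adap (d : ℕ) (p : ℝ) (Q : ℝ → ℝ) : ℕ → (ℝ → ℝ) → (ℝ → ℝ)
  | 0, u => u
  | (k+1), u => if k % 2 = 0 then Aop p Q (adap d p Q k u) else Astar d p Q (adap d p Q k u)

/-- Pairs of radial functions (the two components of the wave formulation). -/
abbrev RPair : Type := (ℝ → ℝ) × (ℝ → ℝ)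

/-- `H (u₁,u₂) = (-u₂, L u₁)`, the linearized matrix operator. -/
def Hop (d : ℕ) (p : ℝ) (Q : ℝ → ℝ) (u : RPair) : RPair :=
  (fun y => -u.2 y, Lop d p Q u.1)

/-- `H* (u₁,u₂) = (L u₂, -u₁)`, the adjoint of `H`. -/
def Hstar (d : ℕ) (p : ℝ) (Q : ℝ → ℝ) (u : RPair) : RPair :=
  (Lop d p Q u.2, fun y => -u.1 y)

/-- The second element `Γ` of the kernel of `L`:
`Γ(y) = Λ⁽¹⁾Q(y) ∫_1^y dx/(x^{d-1}(Λ⁽¹⁾Q(x))²)`. -/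
def GammaFn (d : ℕ) (p : ℝ) (Q : ℝ → ℝ) : ℝ → ℝ := fun y =>
  Lam1 p Q y * ∫ x in (1:ℝ)..y, 1 / (x ^ (d - 1) * (Lam1 p Q x) ^ 2)

/-- The explicit inverse of `L`:
`L⁻¹f = -Γ(y)∫_0^y f Λ⁽¹⁾Q x^{d-1} dx + Λ⁽¹⁾Q(y)∫_0^y f Γ x^{d-1} dx`. -/
def Linv (d : ℕ) (p : ℝ) (Q : ℝ → ℝ) (f : ℝ → ℝ) : ℝ → ℝ := fun y =>
  -GammaFn d p Q y * (∫ x in (0:ℝ)..y, f x * Lam1 p Q x * x ^ (d - 1))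
    + Lam1 p Q y * (∫ x in (0:ℝ)..y, f x * GammaFn d p Q x * x ^ (d - 1))

/-- `H⁻¹ (u₁,u₂) = (L⁻¹u₂, -u₁)`. -/
def Hinv (d : ℕ) (p : ℝ) (Q : ℝ → ℝ) (u : RPair) : RPair :=
  (Linv d p Q u.2, fun y => -u.1 y)

/-- The scaling generator on pairs:
`Λ(u₁,u₂) = ((2/(p-1)+y∂_y)u₁, (2/(p-1)+1+y∂_y)u₂)`. -/
def LamPair (p : ℝ) (u : RPair) : RPair :=
  (fun y => 2 / (p - 1) * u.1 y + y * deriv u.1 y,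
   fun y => (2 / (p - 1) + 1) * u.2 y + y * deriv u.2 y)

/-- The profiles `T_0 = ΛQ = (Λ⁽¹⁾Q, 0)`, `T_{i+1} = -H⁻¹ T_i`. -/
def Tprof (d : ℕ) (p : ℝ) (Q : ℝ → ℝ) : ℕ → RPair
  | 0 => (Lam1 p Q, fun _ => 0)
  | (i+1) => -Hinv d p Q (Tprof d p Q i)

/-- The radial `L²(ℝ^d)` inner product `⟨u,v⟩ = ∫_0^∞ u v y^{d-1} dy`. -/
def rInner (d : ℕ) (u v : ℝ → ℝ) : ℝ := ∫ y in Set.Ioi (0:ℝ), u y * v y * y ^ (d - 1)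

/-- The inner product of pairs. -/
def pInner (d : ℕ) (u v : RPair) : ℝ := rInner d u.1 v.1 + rInner d u.2 v.2

/-- A generic smooth radial cutoff: `χ ≡ 1` on `|y| ≤ 1`, `χ ≡ 0` on `|y| ≥ 2`. -/
structure IsCutoff (χ : ℝ → ℝ) : Prop where
  smooth : ContDiff ℝ (⊤ : ℕ∞) χ
  eq_one : ∀ y : ℝ, |y| ≤ 1 → χ y = 1
  eq_zero : ∀ y : ℝ, 2 ≤ |y| → χ y = 0

/-- The rescaled cutoff `χ_M(y) = χ(y/M)`. -/
def scaleCut (χ : ℝ → ℝ) (M : ℝ) : ℝ → ℝ := fun y => χ (y / M)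

/-- The pair `χ_M ΛQ = (χ_M Λ⁽¹⁾Q, 0)`. -/
def basePair (p : ℝ) (Q χ : ℝ → ℝ) (M : ℝ) : RPair :=
  (fun y => scaleCut χ M y * Lam1 p Q y, fun _ => 0)

/-- Auxiliary vector of the coefficients `c_{0,M}, …, c_{n,M}`:
`c_{0,M} = 1` and
`c_{k,M} = (-1)^{k+1} (Σ_{q<k} c_{q,M} ⟨H*^q(χ_M ΛQ), T_k⟩)/⟨χ_M Λ⁽¹⁾Q, Λ⁽¹⁾Q⟩`. -/
def cVec (d : ℕ) (p : ℝ) (Q χ : ℝ → ℝ) (M : ℝ) : (n : ℕ) → Fin (n + 1) → ℝ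
  | 0 => fun _ => 1
  | (n+1) => fun i =>
      if h : (i : ℕ) < n + 1 then cVec d p Q χ M n ⟨(i : ℕ), h⟩
      else ((-1 : ℝ) ^ (n + 2) *
          (∑ q : Fin (n + 1), cVec d p Q χ M n q *
            pInner d ((Hstar d p Q)^[(q : ℕ)] (basePair p Q χ M)) (Tprof d p Q (n + 1)))) /
        rInner d (fun y => scaleCut χ M y * Lam1 p Q y) (Lam1 p Q)

/-- The coefficients `c_{k,M}`. -/
def cCoef (d : ℕ) (p : ℝ) (Q χ : ℝ → ℝ) (M : ℝ) (k : ℕ) : ℝ :=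
  cVec d p Q χ M k (Fin.last k)

/-- `Φ_M = Σ_{q=0}^{L} c_{q,M} H*^q (χ_M ΛQ)`. -/
def PhiM (d : ℕ) (p : ℝ) (Q χ : ℝ → ℝ) (M : ℝ) (L : ℕ) : RPair :=
  ∑ q ∈ Finset.range (L + 1), cCoef d p Q χ M q • (Hstar d p Q)^[q] (basePair p Q χ M)


/-- Parametric integrals of bounded holomorphic functions are holomorphic. -/
theorem paramHol {E : Type*} [NormedAddCommGroup E] [NormedSpace ℂ E] [CompleteSpace E]
    {U : Set ℂ} (hU : IsOpen U) (G : ℂ → ℝ → E) {a b : ℝ}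
    (hd : ∀ r ∈ Set.uIoc a b, DifferentiableOn ℂ (fun z => G z r) U)
    (hm : ∀ z ∈ U, AEStronglyMeasurable (G z) (volume.restrict (Set.uIoc a b)))
    (hb : ∀ z ∈ U, ∃ M ρ : ℝ, 0 < ρ ∧ ∀ w ∈ Metric.ball z ρ, w ∈ U → ∀ r ∈ Set.uIoc a b, ‖G w r‖ ≤ M) :
    DifferentiableOn ℂ (fun z => ∫ r in a..b, G z r) U := by
  intro z hz
  obtain ⟨M, ρ, hρ, hM⟩ := hb z hz
  obtain ⟨ρ', hρ', hsub⟩ := Metric.isOpen_iff.1 hU z hz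
  set e := min ρ ρ' with he
  have he0 : 0 < e := lt_min hρ hρ'
  have hball : ∀ w ∈ Metric.ball z e, w ∈ U := fun w hw =>
    hsub (Metric.ball_subset_ball (min_le_right _ _) hw)
  have hMe : ∀ w ∈ Metric.ball z e, ∀ r ∈ Set.uIoc a b, ‖G w r‖ ≤ M := fun w hw r hr =>
    hM w (Metric.ball_subset_ball (min_le_left _ _) hw) (hball w hw) r hr
  have hdiffAt : ∀ w ∈ Metric.ball z e, ∀ r ∈ Set.uIoc a b, DifferentiableAt ℂ (fun z => G z r) w :=
    fun w hw r hr => (hd r hr).differentiableAt (hU.mem_nhds (hball w hw))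
  have hzmem : ∀ᶠ x in 𝓝 z, x ∈ U := hU.mem_nhds hz
  have key := intervalIntegral.hasDerivAt_integral_of_dominated_loc_of_deriv_le
    (μ := volume) (a := a) (b := b) (F := G) (F' := fun w r => deriv (fun z => G z r) w)
    (x₀ := z) (s := Metric.ball z (e / 2)) (bound := fun _ => M / (e / 4))
    (Metric.ball_mem_nhds _ (by positivity))
    (hzmem.mono fun x hx => hm x hx) ?_ ?_ ?_ ?_ ?_
  · exact key.2.differentiableAt.differentiableWithinAt
  · refine (intervalIntegrable_const (c := M)).mono_fun' (hm z hz) ?_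
    refine (ae_restrict_iff' measurableSet_uIoc).2 (Eventually.of_forall fun r hr => ?_)
    exact hMe z (Metric.mem_ball_self he0) r hr
  · -- measurability of the derivative
    have hlim : ∀ r ∈ Set.uIoc a b, Tendsto (fun n : ℕ =>
        (((e / 2 / ((n : ℝ) + 1) : ℝ) : ℂ))⁻¹ • (G (z + ((e / 2 / ((n : ℝ) + 1) : ℝ) : ℂ)) r - G z r))
        atTop (𝓝 (deriv (fun z => G z r) z)) := by
      intro r hr
      have h1 := (hdiffAt z (Metric.mem_ball_self he0) r hr).hasDerivAt
      rw [hasDerivAt_iff_tendsto_slope_zero] at h1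
      refine h1.comp ?_
      refine tendsto_nhdsWithin_iff.2 ⟨?_, Eventually.of_forall fun n => ?_⟩
      · have : Tendsto (fun n : ℕ => (e / 2) / ((n : ℝ) + 1)) atTop (𝓝 0) := by
          have := (tendsto_one_div_add_atTop_nhds_zero_nat (𝕜 := ℝ)).const_mul (e / 2)
          simpa [div_eq_mul_inv] using this
        have h2 := (Complex.continuous_ofReal.tendsto 0).comp this
        simpa [Function.comp_def] using h2
      · have : (0 : ℝ) < e / 2 / ((n : ℝ) + 1) := by positivity
        simp only [mem_compl_iff, mem_singleton_iff]
        exact_mod_cast this.ne'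
    refine aestronglyMeasurable_of_tendsto_ae (u := atTop) (f := fun (n : ℕ) (r : ℝ) =>
      (((e / 2 / ((n : ℝ) + 1) : ℝ) : ℂ))⁻¹ • (G (z + ((e / 2 / ((n : ℝ) + 1) : ℝ) : ℂ)) r - G z r))
      (fun n => ?_) ((ae_restrict_iff' measurableSet_uIoc).2 (Eventually.of_forall hlim))
    refine ((hm _ (hball _ ?_)).sub (hm z hz)).const_smul _
    have h1 : (0 : ℝ) < e / 2 / ((n : ℝ) + 1) := by positivity
    have h2 : e / 2 / ((n : ℝ) + 1) ≤ e / 2 := div_le_self (by positivity) (by linarith [n.cast_nonneg (α := ℝ)])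
    rw [Metric.mem_ball, dist_eq_norm, add_sub_cancel_left, Complex.norm_real, Real.norm_of_nonneg h1.le]
    linarith
  · refine Eventually.of_forall fun r hr w hw => ?_
    refine Complex.norm_deriv_le_of_forall_mem_sphere_norm_le (by positivity) ?_ ?_
    · apply DifferentiableOn.diffContOnCl
      intro x hx
      apply (hdiffAt x _ r hr).differentiableWithinAt
      have := Metric.closure_ball_subset_closedBall hx
      rw [Metric.mem_closedBall] at this
      rw [Metric.mem_ball] at hw ⊢
      linarith [dist_triangle x w z]
    · intro x hx
      apply hMe x _ r hr
      rw [mem_sphere_iff_norm, ← dist_eq_norm] at hx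
      rw [Metric.mem_ball] at hw ⊢
      linarith [dist_triangle x w z]
  · exact intervalIntegrable_const
  · refine Eventually.of_forall fun r hr w hw => ?_
    exact (hdiffAt w (Metric.ball_subset_ball (by linarith) hw) r hr).hasDerivAt


/-- Quadratic nonlinearity on a Banach algebra. -/
def quadN {ι 𝔸 : Type*} [Fintype ι] [NormedCommRing 𝔸] [NormedAlgebra ℂ 𝔸]
    (B : ι → ι → ι → ℝ) (X : ι → 𝔸) : ι → 𝔸 :=
  fun i => ∑ j, ∑ k, ((B i j k : ℝ) : ℂ) • (X j * X k)

def quadC {ι : Type*} [Fintype ι] (B : ι → ι → ι → ℝ) : ℝ :=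
  ∑ i, ∑ j, ∑ k, |B i j k|

theorem quadC_nonneg {ι : Type*} [Fintype ι] (B : ι → ι → ι → ℝ) : 0 ≤ quadC B :=
  Finset.sum_nonneg fun _ _ => Finset.sum_nonneg fun _ _ => Finset.sum_nonneg fun _ _ => abs_nonneg _

theorem quadN_lip {ι 𝔸 : Type*} [Fintype ι] [NormedCommRing 𝔸] [NormedAlgebra ℂ 𝔸]
    (B : ι → ι → ι → ℝ) (X Y : ι → 𝔸) (i : ι) :
    ‖quadN B X i - quadN B Y i‖ ≤ quadC B * ((‖X‖ + ‖Y‖) * ‖X - Y‖) := by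
  have h1 : quadN B X i - quadN B Y i
      = ∑ j, ∑ k, ((B i j k : ℝ) : ℂ) • (X j * (X k - Y k) + (X j - Y j) * Y k) := by
    unfold quadN
    rw [← Finset.sum_sub_distrib]
    refine Finset.sum_congr rfl fun j _ => ?_
    rw [← Finset.sum_sub_distrib]
    refine Finset.sum_congr rfl fun k _ => ?_
    rw [← smul_sub]; congr 1; ring
  have hle : ∑ j, ∑ k, |B i j k| ≤ quadC B := by
    unfold quadC
    exact Finset.single_le_sum (f := fun i => ∑ j, ∑ k, |B i j k|)
      (fun _ _ => Finset.sum_nonneg fun _ _ => Finset.sum_nonneg fun _ _ => abs_nonneg _) (Finset.mem_univ i)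
  have h0 : 0 ≤ (‖X‖ + ‖Y‖) * ‖X - Y‖ := by positivity
  rw [h1]
  calc _ ≤ ∑ j, ∑ k, |B i j k| * ((‖X‖ + ‖Y‖) * ‖X - Y‖) := by
        refine (norm_sum_le _ _).trans (Finset.sum_le_sum fun j _ => ?_)
        refine (norm_sum_le _ _).trans (Finset.sum_le_sum fun k _ => ?_)
        rw [norm_smul, Complex.norm_real, Real.norm_eq_abs]
        refine mul_le_mul_of_nonneg_left ?_ (abs_nonneg _)
        refine (norm_add_le _ _).trans ?_
        have a1 : ‖X j * (X k - Y k)‖ ≤ ‖X‖ * ‖X - Y‖ :=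
          (norm_mul_le _ _).trans (mul_le_mul (norm_le_pi_norm X j) (norm_le_pi_norm (X - Y) k)
            (norm_nonneg _) (norm_nonneg _))
        have a2 : ‖(X j - Y j) * Y k‖ ≤ ‖X - Y‖ * ‖Y‖ :=
          (norm_mul_le _ _).trans (mul_le_mul (norm_le_pi_norm (X - Y) j) (norm_le_pi_norm Y k)
            (norm_nonneg _) (norm_nonneg _))
        linarith
    _ = (∑ j, ∑ k, |B i j k|) * ((‖X‖ + ‖Y‖) * ‖X - Y‖) := by
        rw [Finset.sum_mul]; exact Finset.sum_congr rfl fun j _ => (Finset.sum_mul _ _ _).symm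
    _ ≤ _ := mul_le_mul_of_nonneg_right hle h0

theorem quadN_zero {ι 𝔸 : Type*} [Fintype ι] [NormedCommRing 𝔸] [NormedAlgebra ℂ 𝔸]
    (B : ι → ι → ι → ℝ) : quadN B (0 : ι → 𝔸) = 0 := by
  funext i; simp [quadN]

/-- the change of time -/
def Hc (C : ℝ) (z : ℂ) : ℂ := z + C * Complex.log (1 + z)

def Hc' (C : ℝ) (z : ℂ) : ℂ := 1 + C / (1 + z)

def rhp : Set ℂ := {z : ℂ | 0 < z.re}

theorem isOpen_rhp : IsOpen rhp := isOpen_lt continuous_const Complex.continuous_re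

theorem rhp_slit {z : ℂ} (hz : 0 ≤ z.re) : 1 + z ∈ Complex.slitPlane := by
  left; simp; linarith

theorem Hc_hasDeriv (C : ℝ) {z : ℂ} (hz : 0 ≤ z.re) : HasDerivAt (Hc C) (Hc' C z) z := by
  have h1 : HasDerivAt (fun z : ℂ => 1 + z) 1 z := by simpa using (hasDerivAt_id z).const_add 1
  have h2 := (h1.clog (rhp_slit hz)).const_mul (C : ℂ)
  have h3 := (hasDerivAt_id z).add h2
  have e : (1 : ℂ) + (C : ℂ) * (1 / (1 + z)) = Hc' C z := by simp [Hc', div_eq_mul_inv]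
  rw [← e]
  exact h3

theorem Hc_re (C : ℝ) (z : ℂ) : (Hc C z).re = z.re + C * Real.log ‖1 + z‖ := by
  simp [Hc, Complex.log_re]

theorem norm_one_add_mono {z : ℂ} (hz : 0 ≤ z.re) {r : ℝ} (hr0 : 0 ≤ r) (hr1 : r ≤ 1) :
    ‖1 + (r : ℂ) * z‖ ≤ ‖1 + z‖ := by
  rw [Complex.norm_def, Complex.norm_def]
  apply Real.sqrt_le_sqrt
  simp only [Complex.normSq_apply, Complex.add_re, Complex.one_re, Complex.mul_re, Complex.ofReal_re,
    Complex.ofReal_im, zero_mul, sub_zero, Complex.add_im, Complex.one_im, Complex.mul_im, add_zero, zero_add]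
  have : r * r ≤ 1 := by nlinarith
  nlinarith [mul_nonneg hz (sub_nonneg.2 hr1), mul_self_nonneg z.re, mul_self_nonneg z.im,
    mul_nonneg (sub_nonneg.2 this) (mul_self_nonneg z.re), mul_nonneg (sub_nonneg.2 this) (mul_self_nonneg z.im)]

theorem norm_one_add_sq_ge {z : ℂ} (hz : 0 ≤ z.re) : 1 + ‖z‖ ^ 2 ≤ ‖1 + z‖ ^ 2 := by
  rw [Complex.sq_norm, Complex.sq_norm]
  simp only [Complex.normSq_apply, Complex.add_re, Complex.one_re, Complex.add_im, Complex.one_im]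
  nlinarith

theorem Hc_re_mono {C : ℝ} (hC : 0 ≤ C) {z : ℂ} (hz : 0 ≤ z.re) {r : ℝ} (hr0 : 0 ≤ r) (hr1 : r ≤ 1) :
    (Hc C (r * z)).re ≤ (Hc C z).re := by
  rw [Hc_re, Hc_re]
  have hrz : 0 ≤ ((r : ℂ) * z).re := by simp; positivity
  have h1 : 0 < ‖1 + (r : ℂ) * z‖ := by
    have := norm_one_add_sq_ge hrz
    by_contra h
    have h0 : ‖1 + (r : ℂ) * z‖ = 0 := le_antisymm (not_lt.1 h) (norm_nonneg _)
    rw [h0] at this; nlinarith [sq_nonneg ‖(r : ℂ) * z‖]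
  have h2 := Real.log_le_log h1 (norm_one_add_mono hz hr0 hr1)
  have h3 : ((r : ℂ) * z).re ≤ z.re := by simp; nlinarith
  nlinarith [mul_le_mul_of_nonneg_left h2 hC]

/-- the weight -/
def wgt (ε C : ℝ) (z : ℂ) : ℝ := Real.exp (-ε * (Hc C z).re)

theorem wgt_pos (ε C : ℝ) (z : ℂ) : 0 < wgt ε C z := Real.exp_pos _

theorem wgt_le {ε C : ℝ} (hε : 0 < ε) (hεC : ε * C = 2) {z : ℂ} (hz : 0 ≤ z.re) :
    wgt ε C z ≤ 1 / (1 + ‖z‖ ^ 2) := by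
  have h1 := norm_one_add_sq_ge hz
  have h2 : 0 < 1 + ‖z‖ ^ 2 := by positivity
  unfold wgt
  rw [Hc_re, ← Real.log_le_log_iff (Real.exp_pos _) (by positivity), Real.log_exp, one_div, Real.log_inv]
  have h3 := Real.log_le_log h2 h1
  rw [Real.log_pow] at h3
  push_cast at h3
  have h4 : ε * (C * Real.log ‖1 + z‖) = 2 * Real.log ‖1 + z‖ := by rw [← mul_assoc, hεC]
  nlinarith [mul_nonneg hε.le hz]

theorem Hc'_norm_le {C : ℝ} (hC : 0 ≤ C) {z : ℂ} (hz : 0 ≤ z.re) : ‖Hc' C z‖ ≤ 1 + C := by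
  have h1 := norm_one_add_sq_ge hz
  have h2 : 1 ≤ ‖1 + z‖ := by
    by_contra h
    push Not at h
    nlinarith [sq_nonneg ‖z‖, norm_nonneg (1 + z)]
  unfold Hc'
  refine (norm_add_le _ _).trans ?_
  rw [norm_one, norm_div, Complex.norm_real, Real.norm_of_nonneg hC]
  gcongr
  exact div_le_self hC h2

theorem arctan_bound (ρ : ℝ) (hρ : 0 ≤ ρ) :
    IntervalIntegrable (fun r : ℝ => ρ / (1 + r ^ 2 * ρ ^ 2)) volume 0 1 ∧
      ∫ r in (0:ℝ)..1, ρ / (1 + r ^ 2 * ρ ^ 2) ≤ 2 := by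
  have hd : ∀ r : ℝ, HasDerivAt (fun r => Real.arctan (ρ * r)) (ρ / (1 + r ^ 2 * ρ ^ 2)) r := by
    intro r
    have h := ((hasDerivAt_id r).const_mul ρ).arctan
    have e : ρ / (1 + r ^ 2 * ρ ^ 2) = 1 / (1 + (ρ * id r) ^ 2) * (ρ * 1) := by
      simp only [id, mul_pow]; ring
    rw [e]; exact h
  have hint : IntervalIntegrable (fun r : ℝ => ρ / (1 + r ^ 2 * ρ ^ 2)) volume 0 1 := by
    apply Continuous.intervalIntegrable
    refine continuous_const.div (by fun_prop) (fun r => by positivity)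
  refine ⟨hint, ?_⟩
  rw [intervalIntegral.integral_eq_sub_of_hasDerivAt (fun r _ => hd r) hint]
  have := (Real.arctan_lt_pi_div_two (ρ * 1)).le
  simp only [mul_zero, Real.arctan_zero, sub_zero]
  linarith [Real.pi_le_four]

section picard
variable {ι 𝔸 : Type*} [Fintype ι] [NormedCommRing 𝔸] [NormedAlgebra ℂ 𝔸]

/-- the kernel -/
def pker (lam : ι → ℝ) (B : ι → ι → ι → ℝ) (C : ℝ) (Y : ℂ → ι → 𝔸) (i : ι) (z : ℂ) (r : ℝ) : 𝔸 :=
  (Complex.exp (-(lam i) * (Hc C z - Hc C (r * z))) * (Hc' C (r * z) * z)) • quadN B (Y (r * z)) i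

def pstep (lam : ι → ℝ) (B : ι → ι → ι → ℝ) (C : ℝ) (x0 : ι → 𝔸) (Y : ℂ → ι → 𝔸) : ℂ → ι → 𝔸 :=
  fun z i => Complex.exp (-(lam i) * Hc C z) • x0 i + ∫ r in (0:ℝ)..1, pker lam B C Y i z r

theorem mem_rhp_mul {z : ℂ} (hz : z ∈ rhp) {r : ℝ} (hr : r ∈ Set.uIoc (0:ℝ) 1) : (r : ℂ) * z ∈ rhp := by
  rw [uIoc_of_le zero_le_one] at hr
  simp only [rhp, Set.mem_ofPred_eq, Complex.mul_re, Complex.ofReal_re, Complex.ofReal_im, zero_mul, sub_zero] at *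
  exact mul_pos hr.1 hz

theorem pker_coef_le {lam : ι → ℝ} {ε C : ℝ} (hε : 0 < ε) (hεC : ε * C = 2)
    (hlam : ∀ i, ε ≤ lam i) (i : ι) {z : ℂ} (hz : z ∈ rhp) {r : ℝ} (hr : r ∈ Set.uIoc (0:ℝ) 1) :
    ‖Complex.exp (-(lam i) * (Hc C z - Hc C (r * z))) * (Hc' C (r * z) * z)‖ * wgt ε C (r * z) ^ 2
      ≤ wgt ε C z * ((1 + C) * (‖z‖ / (1 + r ^ 2 * ‖z‖ ^ 2))) := by
  have hC : 0 ≤ C := by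
    by_contra h; push Not at h; nlinarith
  have hrz : 0 ≤ ((r : ℂ) * z).re := (mem_rhp_mul hz hr).le
  rw [uIoc_of_le zero_le_one] at hr
  have hm := Hc_re_mono hC (le_of_lt hz : 0 ≤ z.re) hr.1.le hr.2
  have e1 : ‖Complex.exp (-(lam i) * (Hc C z - Hc C (r * z)))‖ * wgt ε C (r * z) ≤ wgt ε C z := by
    rw [Complex.norm_exp]; unfold wgt
    rw [← Real.exp_add]
    apply Real.exp_le_exp.2
    have : (-(lam i : ℂ) * (Hc C z - Hc C (r * z))).re = -(lam i) * ((Hc C z).re - (Hc C (r * z)).re) := by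
      simp
    rw [this]
    nlinarith [mul_nonneg (sub_nonneg.2 (hlam i)) (sub_nonneg.2 hm)]
  have e2 := wgt_le hε hεC hrz
  have e3 := Hc'_norm_le hC hrz
  have e4 : ‖(r : ℂ) * z‖ ^ 2 = r ^ 2 * ‖z‖ ^ 2 := by
    rw [norm_mul, Complex.norm_real, Real.norm_of_nonneg hr.1.le, mul_pow]
  rw [e4] at e2
  have w0 := (wgt_pos ε C (r * z)).le
  calc _ = (‖Complex.exp (-(lam i) * (Hc C z - Hc C (r * z)))‖ * wgt ε C (r * z)) *
        (‖Hc' C (r * z)‖ * (‖z‖ * wgt ε C (r * z))) := by rw [norm_mul, norm_mul]; ring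
    _ ≤ wgt ε C z * ((1 + C) * (‖z‖ * (1 / (1 + r ^ 2 * ‖z‖ ^ 2)))) := by
        gcongr
        exact (wgt_pos ε C z).le
    _ = _ := by ring

theorem pker_diff_le {lam : ι → ℝ} {B : ι → ι → ι → ℝ} {ε C R D : ℝ} (hε : 0 < ε) (hεC : ε * C = 2)
    (hlam : ∀ i, ε ≤ lam i) (hD : 0 ≤ D) {Y Y' : ℂ → ι → 𝔸} (i : ι) {z : ℂ} (hz : z ∈ rhp)
    {r : ℝ} (hr : r ∈ Set.uIoc (0:ℝ) 1)
    (hY : ‖Y (r * z)‖ ≤ R * wgt ε C (r * z)) (hY' : ‖Y' (r * z)‖ ≤ R * wgt ε C (r * z))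
    (hYY : ‖Y (r * z) - Y' (r * z)‖ ≤ D * wgt ε C (r * z)) :
    ‖pker lam B C Y i z r - pker lam B C Y' i z r‖
      ≤ wgt ε C z * (quadC B * (2 * R) * D * (1 + C)) * (‖z‖ / (1 + r ^ 2 * ‖z‖ ^ 2)) := by
  unfold pker
  rw [← smul_sub, norm_smul]
  have h1 := quadN_lip B (Y (r * z)) (Y' (r * z)) i
  have h2 := pker_coef_le hε hεC hlam i hz hr
  have w0 := (wgt_pos ε C (r * z))
  have hq := quadC_nonneg B
  have hR : 0 ≤ R * wgt ε C (r * z) := (norm_nonneg _).trans hY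
  have hR : 0 ≤ R := nonneg_of_mul_nonneg_left hR w0
  have h3 : (‖Y (r * z)‖ + ‖Y' (r * z)‖) * ‖Y (r * z) - Y' (r * z)‖ ≤
      (2 * R * wgt ε C (r * z)) * (D * wgt ε C (r * z)) := by
    apply mul_le_mul (by linarith) hYY (norm_nonneg _) (by positivity)
  set K := ‖Complex.exp (-(lam i) * (Hc C z - Hc C (r * z))) * (Hc' C (r * z) * z)‖
  calc _ ≤ K * (quadC B * ((2 * R * wgt ε C (r * z)) * (D * wgt ε C (r * z)))) := by
        gcongr
        exact h1.trans (by gcongr)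
    _ = (quadC B * (2 * R) * D) * (K * wgt ε C (r * z) ^ 2) := by ring
    _ ≤ (quadC B * (2 * R) * D) * (wgt ε C z * ((1 + C) * (‖z‖ / (1 + r ^ 2 * ‖z‖ ^ 2)))) := by
        gcongr
    _ = _ := by ring

theorem pker_zero (lam : ι → ℝ) (B : ι → ι → ι → ℝ) (C : ℝ) (i : ι) (z : ℂ) (r : ℝ) :
    pker lam B C (fun _ => (0 : ι → 𝔸)) i z r = 0 := by
  simp [pker, quadN_zero]

theorem pint_diff_le {lam : ι → ℝ} {B : ι → ι → ι → ℝ} {ε C R D : ℝ} (hε : 0 < ε) (hεC : ε * C = 2)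
    (hlam : ∀ i, ε ≤ lam i) (hD : 0 ≤ D) {Y Y' : ℂ → ι → 𝔸} (i : ι) {z : ℂ} (hz : z ∈ rhp)
    (hsmall : 8 * (quadC B * R * (1 + C)) ≤ 1) (hR : 0 ≤ R)
    (hm : AEStronglyMeasurable (pker lam B C Y i z) (volume.restrict (Set.uIoc 0 1)))
    (hm' : AEStronglyMeasurable (pker lam B C Y' i z) (volume.restrict (Set.uIoc 0 1)))
    (hY : ∀ r ∈ Set.uIoc (0:ℝ) 1, ‖Y (r * z)‖ ≤ R * wgt ε C (r * z))
    (hY' : ∀ r ∈ Set.uIoc (0:ℝ) 1, ‖Y' (r * z)‖ ≤ R * wgt ε C (r * z))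
    (hYY : ∀ r ∈ Set.uIoc (0:ℝ) 1, ‖Y (r * z) - Y' (r * z)‖ ≤ D * wgt ε C (r * z)) :
    ‖(∫ r in (0:ℝ)..1, pker lam B C Y i z r) - ∫ r in (0:ℝ)..1, pker lam B C Y' i z r‖
      ≤ D / 2 * wgt ε C z := by
  obtain ⟨hi1, hi2⟩ := arctan_bound ‖z‖ (norm_nonneg z)
  have hint : ∀ {Z : ℂ → ι → 𝔸}, AEStronglyMeasurable (pker lam B C Z i z) (volume.restrict (Set.uIoc 0 1)) →
      (∀ r ∈ Set.uIoc (0:ℝ) 1, ‖Z (r * z)‖ ≤ R * wgt ε C (r * z)) →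
      IntervalIntegrable (pker lam B C Z i z) volume 0 1 := by
    intro Z hZm hZ
    refine (hi1.const_mul (wgt ε C z * (quadC B * (2 * R) * R * (1 + C)))).mono_fun' hZm ?_
    refine (ae_restrict_iff' measurableSet_uIoc).2 (Eventually.of_forall fun r hr => ?_)
    have := pker_diff_le (lam := lam) (B := B) (Y := Z) (Y' := fun _ => 0) hε hεC hlam hR i hz hr (hZ r hr)
      (by simpa using mul_nonneg hR (wgt_pos ε C (r * z)).le) (by simpa using hZ r hr)
    simpa [pker_zero] using this
  rw [← intervalIntegral.integral_sub (hint hm hY) (hint hm' hY')]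
  have hC : 0 ≤ C := by
    by_contra h; push Not at h; nlinarith
  have hq := quadC_nonneg B
  have w0 := (wgt_pos ε C z).le
  calc _ ≤ ∫ r in (0:ℝ)..1, wgt ε C z * (quadC B * (2 * R) * D * (1 + C)) * (‖z‖ / (1 + r ^ 2 * ‖z‖ ^ 2)) := by
        refine intervalIntegral.norm_integral_le_of_norm_le zero_le_one ?_ (hi1.const_mul _)
        refine Eventually.of_forall fun r hr => ?_
        rw [← uIoc_of_le zero_le_one] at hr
        exact pker_diff_le hε hεC hlam hD i hz hr (hY r hr) (hY' r hr) (hYY r hr)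
    _ = wgt ε C z * (quadC B * (2 * R) * D * (1 + C)) * ∫ r in (0:ℝ)..1, (‖z‖ / (1 + r ^ 2 * ‖z‖ ^ 2)) := by
        rw [intervalIntegral.integral_const_mul]
    _ ≤ wgt ε C z * (quadC B * (2 * R) * D * (1 + C)) * 2 := by gcongr
    _ = wgt ε C z * D / 2 * (8 * (quadC B * R * (1 + C))) := by ring
    _ ≤ wgt ε C z * D / 2 * 1 := by gcongr
    _ = _ := by ring

end picard

section picard2
variable {ι 𝔸 : Type*} [Fintype ι] [NormedCommRing 𝔸] [NormedAlgebra ℂ 𝔸]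

def pit (lam : ι → ℝ) (B : ι → ι → ι → ℝ) (C : ℝ) (x0 : ι → 𝔸) : ℕ → ℂ → ι → 𝔸
  | 0 => fun _ => 0
  | (n+1) => pstep lam B C x0 (pit lam B C x0 n)

theorem quadN_continuous (B : ι → ι → ι → ℝ) (i : ι) :
    Continuous (fun X : ι → 𝔸 => quadN B X i) := by
  unfold quadN
  refine continuous_finsetSum _ fun j _ => continuous_finsetSum _ fun k _ => ?_
  fun_prop

theorem quadN_differentiable (B : ι → ι → ι → ℝ) (i : ι) :
    Differentiable ℂ (fun X : ι → 𝔸 => quadN B X i) := by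
  unfold quadN
  refine Differentiable.fun_sum fun j _ => Differentiable.fun_sum fun k _ => ?_
  have h : Differentiable ℂ (fun X : ι → 𝔸 => X j * X k) := by fun_prop
  exact h.const_smul ((B i j k : ℝ) : ℂ)

theorem pker_meas (lam : ι → ℝ) (B : ι → ι → ι → ℝ) (C : ℝ) {Y : ℂ → ι → 𝔸} (hY : ContinuousOn Y rhp)
    (i : ι) {z : ℂ} (hz : z ∈ rhp) :
    AEStronglyMeasurable (pker lam B C Y i z) (volume.restrict (Set.uIoc 0 1)) := by
  apply ContinuousOn.aestronglyMeasurable _ measurableSet_uIoc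
  have hm : ContinuousOn (fun r : ℝ => (r : ℂ) * z) (Set.uIoc 0 1) := by fun_prop
  have hmap : MapsTo (fun r : ℝ => (r : ℂ) * z) (Set.uIoc 0 1) rhp := fun r hr => mem_rhp_mul hz hr
  have hH : ContinuousOn (Hc C) rhp := fun w hw =>
    (Hc_hasDeriv C (le_of_lt hw)).continuousAt.continuousWithinAt
  have hH' : ContinuousOn (Hc' C) rhp := by
    unfold Hc'
    refine continuousOn_const.add (continuousOn_const.div (by fun_prop) fun w hw => ?_)
    exact Complex.slitPlane_ne_zero (rhp_slit (le_of_lt hw))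
  unfold pker
  refine ContinuousOn.smul ?_ ?_
  · refine ContinuousOn.mul ?_ ((hH'.comp hm hmap).mul continuousOn_const)
    exact Complex.continuous_exp.comp_continuousOn
      (continuousOn_const.mul (continuousOn_const.sub (hH.comp hm hmap)))
  · exact (quadN_continuous B i).comp_continuousOn (hY.comp hm hmap)

theorem pker_hol (lam : ι → ℝ) (B : ι → ι → ι → ℝ) (C : ℝ) {Y : ℂ → ι → 𝔸} (hY : DifferentiableOn ℂ Y rhp)
    (i : ι) {r : ℝ} (hr : r ∈ Set.uIoc (0:ℝ) 1) :
    DifferentiableOn ℂ (fun z => pker lam B C Y i z r) rhp := by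
  have hm : DifferentiableOn ℂ (fun z : ℂ => (r : ℂ) * z) rhp := by fun_prop
  have hmap : MapsTo (fun z : ℂ => (r : ℂ) * z) rhp rhp := fun z hz => mem_rhp_mul hz hr
  have hH : DifferentiableOn ℂ (Hc C) rhp := fun w hw =>
    (Hc_hasDeriv C (le_of_lt hw)).differentiableAt.differentiableWithinAt
  have hH' : DifferentiableOn ℂ (Hc' C) rhp := by
    unfold Hc'
    refine (differentiableOn_const _).add ((differentiableOn_const _).div (by fun_prop) fun w hw => ?_)
    exact Complex.slitPlane_ne_zero (rhp_slit (le_of_lt hw))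
  have h1 : DifferentiableOn ℂ (fun z : ℂ => Complex.exp (-(lam i) * (Hc C z - Hc C (r * z))) *
      (Hc' C (r * z) * z)) rhp := by
    refine DifferentiableOn.mul ?_ ((hH'.comp hm hmap).mul differentiableOn_id)
    exact Complex.differentiable_exp.comp_differentiableOn
      ((differentiableOn_const _).mul (hH.sub (hH.comp hm hmap)))
  have h2 : DifferentiableOn ℂ (fun z : ℂ => quadN B (Y (r * z)) i) rhp := by
    have := (quadN_differentiable (𝔸 := 𝔸) B i).comp_differentiableOn (hY.comp hm hmap)
    exact this
  exact h1.smul h2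

theorem wgt_le_one {ε C : ℝ} (hε : 0 < ε) (hεC : ε * C = 2) {z : ℂ} (hz : 0 ≤ z.re) : wgt ε C z ≤ 1 := by
  refine (wgt_le hε hεC hz).trans ?_
  rw [div_le_one (by positivity)]
  nlinarith [sq_nonneg ‖z‖]

theorem lin_le {lam : ι → ℝ} {ε C : ℝ} (hε : 0 < ε) (hεC : ε * C = 2)
    (hlam : ∀ i, ε ≤ lam i) (x0 : ι → 𝔸) (i : ι) {z : ℂ} (hz : z ∈ rhp) :
    ‖Complex.exp (-(lam i) * Hc C z) • x0 i‖ ≤ ‖x0‖ * wgt ε C z := by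
  rw [norm_smul, mul_comm, Complex.norm_exp]
  refine mul_le_mul (norm_le_pi_norm x0 i) ?_ (Real.exp_pos _).le (norm_nonneg _)
  unfold wgt
  apply Real.exp_le_exp.2
  have h1 : (-(lam i : ℂ) * Hc C z).re = -(lam i) * (Hc C z).re := by simp
  rw [h1]
  have hC : 0 ≤ C := by
    by_contra h; push Not at h; nlinarith
  have := Hc_re_mono hC (le_of_lt hz : 0 ≤ z.re) le_rfl zero_le_one
  have h0 : (Hc C (((0:ℝ) : ℂ) * z)).re = 0 := by simp [Hc]
  rw [h0] at this
  nlinarith [hlam i]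

theorem pstep_inv [CompleteSpace 𝔸] {lam : ι → ℝ} {B : ι → ι → ι → ℝ} {ε C R : ℝ} (hε : 0 < ε) (hεC : ε * C = 2)
    (hlam : ∀ i, ε ≤ lam i) (hsmall : 8 * (quadC B * R * (1 + C)) ≤ 1) (hR : 0 ≤ R)
    {x0 : ι → 𝔸} (hx0 : 2 * ‖x0‖ ≤ R) {Y : ℂ → ι → 𝔸} (hY : DifferentiableOn ℂ Y rhp)
    (hYb : ∀ z ∈ rhp, ‖Y z‖ ≤ R * wgt ε C z) :
    DifferentiableOn ℂ (pstep lam B C x0 Y) rhp ∧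
      ∀ z ∈ rhp, ‖pstep lam B C x0 Y z‖ ≤ R * wgt ε C z := by
  have hH : DifferentiableOn ℂ (Hc C) rhp := fun w hw =>
    (Hc_hasDeriv C (le_of_lt hw)).differentiableAt.differentiableWithinAt
  have hC : 0 ≤ C := by
    by_contra h; push Not at h; nlinarith
  have hq := quadC_nonneg B
  constructor
  · rw [differentiableOn_pi]
    intro i
    unfold pstep
    refine DifferentiableOn.add ?_ ?_
    · refine DifferentiableOn.smul_const ?_ _
      exact Complex.differentiable_exp.comp_differentiableOn ((differentiableOn_const _).mul hH)
    · refine paramHol isOpen_rhp _ (fun r hr => pker_hol lam B C hY i hr)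
        (fun z hz => pker_meas lam B C hY.continuousOn i hz) ?_
      intro z hz
      refine ⟨(quadC B * (2 * R) * R * (1 + C)) * (‖z‖ + 1), 1, one_pos, fun w hw hwU r hr => ?_⟩
      have hw0 : ∀ z ∈ rhp, ‖(0 : ι → 𝔸)‖ ≤ R * wgt ε C z := fun z _ => by
        simpa using mul_nonneg hR (wgt_pos ε C z).le
      have := pker_diff_le (lam := lam) (B := B) (Y := Y) (Y' := fun _ => 0) hε hεC hlam hR i hwU hr
        (hYb _ (mem_rhp_mul hwU hr)) (hw0 _ (mem_rhp_mul hwU hr)) (by simpa using hYb _ (mem_rhp_mul hwU hr))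
      rw [pker_zero, sub_zero] at this
      refine this.trans ?_
      have h1 : ‖w‖ / (1 + r ^ 2 * ‖w‖ ^ 2) ≤ ‖z‖ + 1 := by
        refine (div_le_self (norm_nonneg _) (by nlinarith [mul_nonneg (sq_nonneg r) (sq_nonneg ‖w‖)])).trans ?_
        rw [Metric.mem_ball, dist_eq_norm] at hw
        have := norm_add_le (w - z) z
        rw [sub_add_cancel] at this
        linarith
      have h2 := wgt_le_one hε hεC (le_of_lt hwU : 0 ≤ w.re)
      calc _ ≤ 1 * (quadC B * (2 * R) * R * (1 + C)) * (‖z‖ + 1) := by gcongr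
        _ = _ := by ring
  · intro z hz
    refine (pi_norm_le_iff_of_nonneg (mul_nonneg hR (wgt_pos ε C z).le)).2 fun i => ?_
    have h1 := lin_le hε hεC hlam x0 i hz
    have h2 := pint_diff_le (lam := lam) (B := B) (Y := Y) (Y' := fun _ => 0) hε hεC hlam hR i hz hsmall hR
      (pker_meas lam B C hY.continuousOn i hz) (pker_meas lam B C continuousOn_const i hz)
      (fun r hr => hYb _ (mem_rhp_mul hz hr)) (fun r hr => by simpa using mul_nonneg hR (wgt_pos ε C _).le)
      (fun r hr => by simpa using hYb _ (mem_rhp_mul hz hr))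
    simp only [pker_zero, intervalIntegral.integral_zero, sub_zero] at h2
    unfold pstep
    refine (norm_add_le _ _).trans ?_
    nlinarith [wgt_pos ε C z]

theorem pstep_diff {lam : ι → ℝ} {B : ι → ι → ι → ℝ} {ε C R D : ℝ} (hε : 0 < ε) (hεC : ε * C = 2)
    (hlam : ∀ i, ε ≤ lam i) (hsmall : 8 * (quadC B * R * (1 + C)) ≤ 1) (hR : 0 ≤ R) (hD : 0 ≤ D)
    {x0 : ι → 𝔸} {Y Y' : ℂ → ι → 𝔸} (hY : ContinuousOn Y rhp) (hY' : ContinuousOn Y' rhp)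
    {z : ℂ} (hz : z ∈ rhp)
    (hYb : ∀ r ∈ Set.uIoc (0:ℝ) 1, ‖Y (r * z)‖ ≤ R * wgt ε C (r * z))
    (hYb' : ∀ r ∈ Set.uIoc (0:ℝ) 1, ‖Y' (r * z)‖ ≤ R * wgt ε C (r * z))
    (hYY : ∀ r ∈ Set.uIoc (0:ℝ) 1, ‖Y (r * z) - Y' (r * z)‖ ≤ D * wgt ε C (r * z)) :
    ‖pstep lam B C x0 Y z - pstep lam B C x0 Y' z‖ ≤ D / 2 * wgt ε C z := by
  refine (pi_norm_le_iff_of_nonneg (by have := (wgt_pos ε C z).le; positivity)).2 fun i => ?_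
  have := pint_diff_le (lam := lam) (B := B) hε hεC hlam hD i hz hsmall hR
      (pker_meas lam B C hY i hz) (pker_meas lam B C hY' i hz) hYb hYb' hYY
  simpa [pstep] using this

theorem picard_main [CompleteSpace 𝔸] {lam : ι → ℝ} {B : ι → ι → ι → ℝ} {ε C R : ℝ} (hε : 0 < ε) (hεC : ε * C = 2)
    (hlam : ∀ i, ε ≤ lam i) (hsmall : 8 * (quadC B * R * (1 + C)) ≤ 1) (hR : 0 ≤ R)
    {x0 : ι → 𝔸} (hx0 : 2 * ‖x0‖ ≤ R) (xh : ℝ → ι → 𝔸) (hxc : ContinuousOn xh (Ioi 0))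
    (hxb : ∀ s : ℝ, 0 < s → ‖xh s‖ ≤ R * wgt ε C s)
    (hxe : ∀ s : ℝ, 0 < s → xh s = pstep lam B C x0 (fun z => xh z.re) s) :
    ∃ X : ℂ → ι → 𝔸, DifferentiableOn ℂ X rhp ∧ (∀ z ∈ rhp, ‖X z‖ ≤ R) ∧
      ∀ s : ℝ, 0 < s → X s = xh s := by
  set P := pit lam B C x0 with hP
  have hinv : ∀ n, DifferentiableOn ℂ (P n) rhp ∧ ∀ z ∈ rhp, ‖P n z‖ ≤ R * wgt ε C z := by
    intro n
    induction n with
    | zero =>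
      refine ⟨differentiableOn_const _, fun z _ => ?_⟩
      simpa [hP, pit] using mul_nonneg hR (wgt_pos ε C z).le
    | succ n ih => exact pstep_inv hε hεC hlam hsmall hR hx0 ih.1 ih.2
  have hdiff : ∀ n, ∀ z ∈ rhp, ‖P (n+1) z - P n z‖ ≤ (R * (1 / 2) ^ n) * wgt ε C z := by
    intro n
    induction n with
    | zero =>
      intro z hz
      have := (hinv 1).2 z hz
      simpa [hP, pit] using this
    | succ n ih =>
      intro z hz
      have := pstep_diff (x0 := x0) hε hεC hlam hsmall hR (D := R * (1/2)^n) (by positivity)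
        (hinv (n+1)).1.continuousOn (hinv n).1.continuousOn hz
        (fun r hr => (hinv (n+1)).2 _ (mem_rhp_mul hz hr)) (fun r hr => (hinv n).2 _ (mem_rhp_mul hz hr))
        (fun r hr => ih _ (mem_rhp_mul hz hr))
      refine (show ‖P (n+1+1) z - P (n+1) z‖ ≤ _ from this).trans (le_of_eq ?_)
      rw [pow_succ]; ring
  have hle : ∀ n, ∀ z ∈ rhp, ‖P (n+1) z - P n z‖ ≤ R * (1 / 2) ^ n := fun n z hz => by
    refine (hdiff n z hz).trans ?_
    have := wgt_le_one hε hεC (le_of_lt hz : 0 ≤ z.re)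
    have h0 : 0 ≤ R * (1 / 2 : ℝ) ^ n := by positivity
    nlinarith
  have hsum : Summable (fun n : ℕ => R * (1 / 2 : ℝ) ^ n) :=
    (summable_geometric_of_lt_one (by norm_num) (by norm_num)).mul_left R
  have hlim : ∀ z ∈ rhp, Tendsto (fun n => P n z) atTop (𝓝 (∑' n, (P (n+1) z - P n z))) := by
    intro z hz
    have h1 : Summable fun n => P (n+1) z - P n z := Summable.of_norm_bounded hsum (fun n => hle n z hz)
    have h2 := h1.hasSum.tendsto_sum_nat
    have h3 : ∀ n, ∑ k ∈ Finset.range n, (P (k+1) z - P k z) = P n z := by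
      intro n
      rw [Finset.sum_range_sub (fun k => P k z)]
      simp [hP, pit]
    simpa [h3] using h2
  refine ⟨fun z => ∑' n, (P (n+1) z - P n z), ?_, ?_, ?_⟩
  · exact Complex.differentiableOn_tsum_of_summable_norm hsum
      (fun n => (hinv (n+1)).1.sub (hinv n).1) isOpen_rhp (fun n z hz => hle n z hz)
  · intro z hz
    refine le_of_tendsto (hlim z hz).norm (Eventually.of_forall fun n => ?_)
    refine ((hinv n).2 z hz).trans ?_
    have := wgt_le_one hε hεC (le_of_lt hz : 0 ≤ z.re)
    nlinarith
  · intro s hs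
    have hsr : ∀ {s : ℝ}, 0 < s → (s : ℂ) ∈ rhp := fun {s} h => by simpa [rhp] using h
    have hxc' : ContinuousOn (fun z : ℂ => xh z.re) rhp :=
      hxc.comp Complex.continuous_re.continuousOn (fun z hz => hz)
    have key : ∀ n, ∀ s : ℝ, 0 < s → ‖P n s - xh s‖ ≤ (R * (1 / 2) ^ n) * wgt ε C s := by
      intro n
      induction n with
      | zero =>
        intro s hs
        simpa [hP, pit] using hxb s hs
      | succ n ih =>
        intro s hs
        have hm : ∀ r ∈ Set.uIoc (0:ℝ) 1, 0 < r * s := fun r hr => by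
          rw [uIoc_of_le zero_le_one] at hr; exact mul_pos hr.1 hs
        have := pstep_diff (x0 := x0) hε hεC hlam hsmall hR (D := R * (1/2)^n) (by positivity)
          (hinv n).1.continuousOn hxc' (hsr hs)
          (fun r hr => (hinv n).2 _ (mem_rhp_mul (hsr hs) hr))
          (fun r hr => by simpa using hxb _ (hm r hr))
          (fun r hr => by simpa using ih _ (hm r hr))
        rw [← hxe s hs] at this
        refine (show ‖P (n+1) s - xh s‖ ≤ _ from this).trans (le_of_eq ?_)
        rw [pow_succ]; ring
    have h1 := hlim s (hsr hs)
    refine tendsto_nhds_unique h1 ?_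
    rw [tendsto_iff_norm_sub_tendsto_zero]
    refine squeeze_zero (fun _ => norm_nonneg _) (fun n => key n s hs) ?_
    have := ((tendsto_pow_atTop_nhds_zero_of_lt_one (r := (1/2:ℝ)) (by norm_num) (by norm_num)).const_mul R).mul_const
      (wgt ε C s)
    simpa using this

end picard2

/-- a quadratic system with damping -/
structure QSys {ι : Type*} [Fintype ι] (lam : ι → ℝ) (B : ι → ι → ι → ℝ) (α : ℝ) (x : ℝ → ι → ℝ) : Prop where
  hα : 0 < α
  hlam : ∀ i, α ≤ lam i
  ode : ∀ t i, HasDerivAt (fun t => x t i) (-lam i * x t i + ∑ j, ∑ k, B i j k * (x t j * x t k)) t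
  lim : Tendsto x atTop (𝓝 0)

section energy
variable {ι : Type*} [Fintype ι] {lam : ι → ℝ} {B : ι → ι → ι → ℝ} {α : ℝ} {x : ℝ → ι → ℝ}

theorem QSys.contx (h : QSys lam B α x) : Continuous x :=
  continuous_pi fun i => continuous_iff_continuousAt.2 fun t => (h.ode t i).continuousAt

theorem QSys.decay (h : QSys lam B α x) {η : ℝ} (hη : 0 < η) :
    ∃ (T E : ℝ), 0 ≤ E ∧ E ≤ η ∧ ∀ t, T ≤ t → ‖x t‖ ≤ E * Real.exp (-(α / 2) * (t - T)) := by
  have hq := quadC_nonneg B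
  set e : ℝ → ℝ := fun t => ∑ i, x t i ^ 2 with he
  have hxle : ∀ t, ‖x t‖ ^ 2 ≤ e t := by
    intro t
    have h0 : 0 ≤ e t := Finset.sum_nonneg fun i _ => sq_nonneg _
    have : ‖x t‖ ≤ Real.sqrt (e t) := by
      refine (pi_norm_le_iff_of_nonneg (Real.sqrt_nonneg _)).2 fun i => ?_
      rw [Real.norm_eq_abs]
      apply Real.abs_le_sqrt
      exact Finset.single_le_sum (f := fun i => x t i ^ 2) (fun _ _ => sq_nonneg _) (Finset.mem_univ i)
    calc ‖x t‖ ^ 2 ≤ Real.sqrt (e t) ^ 2 := by gcongr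
      _ = e t := Real.sq_sqrt h0
  have hed : ∀ t, HasDerivAt e (∑ i, 2 * x t i * (-lam i * x t i + ∑ j, ∑ k, B i j k * (x t j * x t k))) t := by
    intro t
    have := HasDerivAt.fun_sum (u := Finset.univ) (A := fun i t => x t i ^ 2) (fun i _ => (h.ode t i).fun_pow 2)
    refine this.congr_deriv ?_
    refine Finset.sum_congr rfl fun i _ => ?_
    norm_num
  have hebd : ∀ t, ∑ i, 2 * x t i * (-lam i * x t i + ∑ j, ∑ k, B i j k * (x t j * x t k))
      ≤ (-2 * α + 2 * quadC B * ‖x t‖) * e t := by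
    intro t
    have h1 : ∀ i, 2 * x t i * (-lam i * x t i + ∑ j, ∑ k, B i j k * (x t j * x t k)) ≤
        -2 * α * x t i ^ 2 + 2 * (‖x t‖ * ((∑ j, ∑ k, |B i j k|) * ‖x t‖ ^ 2)) := by
      intro i
      have a1 : |∑ j, ∑ k, B i j k * (x t j * x t k)| ≤ (∑ j, ∑ k, |B i j k|) * ‖x t‖ ^ 2 := by
        refine (Finset.abs_sum_le_sum_abs _ _).trans ?_
        rw [Finset.sum_mul]
        refine Finset.sum_le_sum fun j _ => ?_
        refine (Finset.abs_sum_le_sum_abs _ _).trans ?_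
        rw [Finset.sum_mul]
        refine Finset.sum_le_sum fun k _ => ?_
        rw [abs_mul, abs_mul, sq]
        gcongr
        · exact norm_le_pi_norm (x t) j
        · exact norm_le_pi_norm (x t) k
      have a2 : |x t i| ≤ ‖x t‖ := norm_le_pi_norm (x t) i
      have a3 : x t i * (∑ j, ∑ k, B i j k * (x t j * x t k)) ≤ ‖x t‖ * ((∑ j, ∑ k, |B i j k|) * ‖x t‖ ^ 2) := by
        refine (le_abs_self _).trans ?_
        rw [abs_mul]
        exact mul_le_mul a2 a1 (abs_nonneg _) (norm_nonneg _)
      nlinarith [mul_nonneg (sub_nonneg.2 (h.hlam i)) (sq_nonneg (x t i))]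
    refine (Finset.sum_le_sum fun i _ => h1 i).trans ?_
    rw [Finset.sum_add_distrib, ← Finset.mul_sum, ← Finset.mul_sum, ← Finset.mul_sum, ← Finset.sum_mul]
    have : (∑ i, ∑ j, ∑ k, |B i j k|) = quadC B := rfl
    rw [this]
    have : quadC B * ‖x t‖ * ‖x t‖ ^ 2 ≤ quadC B * ‖x t‖ * e t := by gcongr; exact hxle t
    have e2 : ∑ i, x t i ^ 2 = e t := rfl
    rw [e2]
    nlinarith
  have hx0 : Tendsto (fun t => ‖x t‖) atTop (𝓝 0) := by simpa using h.lim.norm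
  have he0 : Tendsto (fun t => Real.sqrt (e t)) atTop (𝓝 0) := by
    have h1 : Tendsto e atTop (𝓝 0) := by
      have : ∀ i, Tendsto (fun t => x t i ^ 2) atTop (𝓝 0) := fun i => by
        have := ((tendsto_pi_nhds.1 h.lim i).pow 2); simpa using this
      have := tendsto_finsetSum Finset.univ (fun i _ => this i)
      simpa using this
    have := (Real.continuous_sqrt.tendsto 0).comp h1
    rw [Real.sqrt_zero] at this
    exact this
  have ev1 : ∀ᶠ t in atTop, 2 * quadC B * ‖x t‖ < α := by
    have := (hx0.const_mul (2 * quadC B))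
    rw [mul_zero] at this
    exact this.eventually_lt_const h.hα
  have ev2 : ∀ᶠ t in atTop, Real.sqrt (e t) < η := he0.eventually_lt_const hη
  obtain ⟨T1, hT1⟩ := eventually_atTop.1 ev1
  obtain ⟨T2, hT2⟩ := eventually_atTop.1 ev2
  set T := max T1 T2
  refine ⟨T, Real.sqrt (e T), Real.sqrt_nonneg _, (hT2 T (le_max_right _ _)).le, fun t ht => ?_⟩
  have hanti : AntitoneOn (fun t => Real.exp (α * (t - T)) * e t) (Ici T) := by
    have hd : ∀ t, HasDerivAt (fun t => Real.exp (α * (t - T)) * e t)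
        (Real.exp (α * (t - T)) * (α * 1) * e t + Real.exp (α * (t - T)) *
          (∑ i, 2 * x t i * (-lam i * x t i + ∑ j, ∑ k, B i j k * (x t j * x t k)))) t := by
      intro t
      exact ((((hasDerivAt_id t).sub_const T).const_mul α).exp).mul (hed t)
    refine antitoneOn_of_deriv_nonpos (convex_Ici T) (fun t _ => (hd t).continuousAt.continuousWithinAt)
      (fun t _ => (hd t).differentiableAt.differentiableWithinAt) (fun t ht => ?_)
    rw [(hd t).deriv]
    rw [interior_Ici] at ht
    have h1 := hT1 t ((le_max_left _ _).trans (le_of_lt ht))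
    have h2 := hebd t
    have h0 : 0 ≤ e t := Finset.sum_nonneg fun i _ => sq_nonneg _
    have h3 : (α + (-2 * α + 2 * quadC B * ‖x t‖)) * e t ≤ 0 := by nlinarith
    have h4 := Real.exp_pos (α * (t - T))
    nlinarith
  have h1 := hanti (mem_Ici.2 le_rfl) (mem_Ici.2 ht) ht
  simp only [sub_self, mul_zero, Real.exp_zero, one_mul] at h1
  have h2 : ‖x t‖ ^ 2 ≤ (Real.sqrt (e T) * Real.exp (-(α / 2) * (t - T))) ^ 2 := by
    refine (hxle t).trans ?_
    rw [mul_pow, Real.sq_sqrt (Finset.sum_nonneg fun i _ => sq_nonneg _), ← Real.exp_nat_mul]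
    have h5 : ((2:ℕ):ℝ) * (-(α / 2) * (t - T)) = -(α * (t - T)) := by push_cast; ring
    rw [h5, Real.exp_neg, ← div_eq_mul_inv, le_div_iff₀ (Real.exp_pos _)]
    linarith
  exact (pow_le_pow_iff_left₀ (norm_nonneg _) (by positivity) two_ne_zero).1 h2

/-- trajectory pieces -/
def traj (ℓ : ℝ) (x : ℝ → ι → ℝ) (hx : Continuous x) (t : ℝ) (i : ι) : C(Icc (0:ℝ) ℓ, ℂ) :=
  ⟨fun τ => (x (t + τ) i : ℂ), by fun_prop⟩

theorem traj_cont (ℓ : ℝ) (x : ℝ → ι → ℝ) (hx : Continuous x) : Continuous (traj ℓ x hx) := by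
  refine continuous_pi fun i => ?_
  exact (ContinuousMap.curry ⟨fun q : ℝ × Icc (0:ℝ) ℓ => (x (q.1 + q.2) i : ℂ), by fun_prop⟩).continuous

theorem quadN_traj (ℓ : ℝ) (x : ℝ → ι → ℝ) (hx : Continuous x) (t : ℝ) (i : ι) (τ : Icc (0:ℝ) ℓ) :
    quadN B (traj ℓ x hx t) i τ = ((∑ j, ∑ k, B i j k * (x (t + τ) j * x (t + τ) k) : ℝ) : ℂ) := by
  simp [quadN, traj, ContinuousMap.sum_apply]

theorem QSys.ext (h : QSys lam B α x) {ℓ : ℝ} :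
    ∃ (T C R : ℝ) (X : ℂ → ι → C(Icc (0:ℝ) ℓ, ℂ)), 0 < C ∧ DifferentiableOn ℂ X rhp ∧ (∀ z ∈ rhp, ‖X z‖ ≤ R) ∧
      ∀ s : ℝ, 0 < s → ∀ i τ, X s i τ = (x (T + (s + C * Real.log (1 + s)) + τ) i : ℂ) := by
  have hα := h.hα
  set ε := α / 2 with hε'
  have hε : 0 < ε := by positivity
  set C := 2 / ε with hC'
  have hC : 0 < C := by positivity
  have hεC : ε * C = 2 := by rw [hC']; field_simp
  have hq := quadC_nonneg B
  obtain ⟨T, E, hE0, hE, hdec⟩ := h.decay (η := 1 / (16 * (quadC B + 1) * (1 + C))) (by positivity)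
  have hsmall : 8 * (quadC B * (2 * E) * (1 + C)) ≤ 1 := by
    rw [le_div_iff₀ (by positivity)] at hE
    have : 0 ≤ E * (1 + C) := by positivity
    nlinarith
  set g : ℝ → ℝ := fun s => s + C * Real.log (1 + s) with hg
  have hHg : ∀ s : ℝ, 0 ≤ s → Hc C s = ((g s : ℝ) : ℂ) := by
    intro s hs
    have : ((Real.log (1 + s) : ℝ) : ℂ) = Complex.log (1 + s) := by
      rw [Complex.ofReal_log (by linarith)]; push_cast; rfl
    simp only [Hc, hg]; push_cast; rw [← this]
  have hg0 : ∀ s : ℝ, 0 ≤ s → 0 ≤ g s := fun s hs => by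
    have := Real.log_nonneg (x := 1 + s) (by linarith)
    simp only [hg]; positivity
  have hgd : ∀ s : ℝ, 0 ≤ s → HasDerivAt g (1 + C / (1 + s)) s := by
    intro s hs
    have h1 : HasDerivAt (fun s : ℝ => 1 + s) 1 s := by simpa using (hasDerivAt_id s).const_add 1
    have := (hasDerivAt_id s).add ((h1.log (by linarith)).const_mul C)
    have e : 1 + C / (1 + s) = 1 + C * (1 / (1 + s)) := by ring
    rw [e]; exact this
  have hgc : ContinuousOn g (Ioi 0) := fun s hs => (hgd s (le_of_lt hs)).continuousAt.continuousWithinAt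
  set X0 := traj ℓ x h.contx
  have hX0c : Continuous X0 := traj_cont ℓ x h.contx
  set xh : ℝ → ι → C(Icc (0:ℝ) ℓ, ℂ) := fun s => X0 (T + g s) with hxh
  have hwg : ∀ s : ℝ, 0 ≤ s → wgt ε C s = Real.exp (-ε * g s) := fun s hs => by
    unfold wgt; rw [hHg s hs, Complex.ofReal_re]
  have hX0b : ∀ s, 0 ≤ s → ‖X0 (T + s)‖ ≤ E * Real.exp (-ε * s) := by
    intro s hs
    refine (pi_norm_le_iff_of_nonneg (by positivity)).2 fun i => ?_
    refine (ContinuousMap.norm_le _ (by positivity)).2 fun τ => ?_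
    have h1 := hdec (T + s + τ) (by have := τ.2.1; linarith)
    have h2 := norm_le_pi_norm (x (T + s + τ)) i
    have h3 : ‖X0 (T + s) i τ‖ = ‖x (T + s + τ) i‖ := by
      simp [X0, traj]
    rw [h3]
    refine (h2.trans h1).trans ?_
    have := mul_nonneg hε.le τ.2.1
    refine mul_le_mul_of_nonneg_left (Real.exp_le_exp.2 ?_) hE0
    rw [← hε']
    linarith
  have hxb : ∀ s : ℝ, 0 < s → ‖xh s‖ ≤ 2 * E * wgt ε C s := by
    intro s hs
    rw [hwg s hs.le]
    have := hX0b (g s) (hg0 s hs.le)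
    have h2 : 0 ≤ E * Real.exp (-ε * g s) := by positivity
    simp only [hxh]; linarith
  have hxc : ContinuousOn xh (Ioi 0) := hX0c.comp_continuousOn (continuousOn_const.add hgc)
  have hlam : ∀ i, ε ≤ lam i := fun i => le_trans (by simp only [hε']; linarith) (h.hlam i)
  have hx0 : 2 * ‖X0 T‖ ≤ 2 * E := by
    have := hX0b 0 le_rfl
    simp at this; linarith
  have hxe : ∀ s : ℝ, 0 < s → xh s = pstep lam B C (X0 T) (fun z => xh z.re) s := by
    intro s hs
    have hsr : (s : ℂ) ∈ rhp := by simpa [rhp] using hs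
    have hxc' : ContinuousOn (fun z : ℂ => xh z.re) rhp :=
      hxc.comp Complex.continuous_re.continuousOn (fun z hz => hz)
    funext i
    have hint : IntervalIntegrable (pker lam B C (fun z => xh z.re) i s) volume 0 1 := by
      obtain ⟨hi1, hi2⟩ := arctan_bound ‖(s:ℂ)‖ (norm_nonneg _)
      refine (hi1.const_mul (wgt ε C s * (quadC B * (2 * (2 * E)) * (2 * E) * (1 + C)))).mono_fun'
        (pker_meas lam B C hxc' i hsr) ?_
      refine (ae_restrict_iff' measurableSet_uIoc).2 (Eventually.of_forall fun r hr => ?_)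
      have hrs : 0 < r * s := by
        rw [uIoc_of_le zero_le_one] at hr; exact mul_pos hr.1 hs
      have hb : ‖xh ((r : ℂ) * s).re‖ ≤ 2 * E * wgt ε C (r * s) := by
        have := hxb _ hrs
        push_cast at this
        simpa using this
      have := pker_diff_le (lam := lam) (B := B) (Y := fun z => xh z.re) (Y' := fun _ => 0) hε hεC hlam
        (D := 2 * E) (by positivity) i hsr hr hb
        (by simpa using mul_nonneg (by positivity : 0 ≤ 2 * E) (wgt_pos ε C (r * s)).le) (by simpa using hb)
      simpa [pker_zero] using this
    ext τ
    have hev : (∫ r in (0:ℝ)..1, pker lam B C (fun z => xh z.re) i s r) τ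
        = ∫ r in (0:ℝ)..1, pker lam B C (fun z => xh z.re) i s r τ := by
      have := (ContinuousMap.evalCLM ℂ τ).intervalIntegral_comp_comm hint
      exact this.symm
    show xh s i τ = (Complex.exp (-(lam i) * Hc C s) • X0 T i + ∫ r in (0:ℝ)..1, pker lam B C (fun z => xh z.re) i s r) τ
    rw [ContinuousMap.add_apply, hev]
    have hker : ∀ r ∈ Set.uIcc (0:ℝ) 1, pker lam B C (fun z => xh z.re) i s r τ =
        ((Real.exp (-(lam i) * (g s - g (r * s))) * ((1 + C / (1 + r * s)) * s) *
          (∑ j, ∑ k, B i j k * (x (T + g (r * s) + τ) j * x (T + g (r * s) + τ) k)) : ℝ) : ℂ) := by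
      intro r hr
      rw [uIcc_of_le zero_le_one] at hr
      have hrs : 0 ≤ r * s := mul_nonneg hr.1 hs.le
      have e1 : (r : ℂ) * s = ((r * s : ℝ) : ℂ) := by push_cast; rfl
      unfold pker
      rw [ContinuousMap.smul_apply, e1, hHg s hs.le, hHg _ hrs]
      simp only [hxh, X0, Complex.ofReal_re]
      rw [quadN_traj, smul_eq_mul]
      simp only [Hc']
      push_cast
      rfl
    have hcd : ∀ r ∈ Set.uIcc (0:ℝ) 1, HasDerivAt (fun r : ℝ => Real.exp (-(lam i) * (g s - g (r * s))) *
          x (T + g (r * s) + τ) i)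
        (Real.exp (-(lam i) * (g s - g (r * s))) * ((1 + C / (1 + r * s)) * s) *
          (∑ j, ∑ k, B i j k * (x (T + g (r * s) + τ) j * x (T + g (r * s) + τ) k))) r := by
      intro r hr
      rw [uIcc_of_le zero_le_one] at hr
      have hrs : 0 ≤ r * s := mul_nonneg hr.1 hs.le
      have h1 : HasDerivAt (fun r => r * s) s r := by simpa using (hasDerivAt_id r).mul_const s
      have h2 : HasDerivAt (fun r => g (r * s)) ((1 + C / (1 + r * s)) * s) r :=
        HasDerivAt.comp r (hgd _ hrs) h1
      have h3 := ((h2.const_sub (g s)).const_mul (-(lam i))).exp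
      have h4 : HasDerivAt (fun r => T + g (r * s) + τ) ((1 + C / (1 + r * s)) * s) r :=
        (h2.const_add T).add_const _
      have h5 := HasDerivAt.comp r (h.ode (T + g (r * s) + τ) i) h4
      refine (h3.mul h5).congr_deriv ?_
      simp only [Function.comp]
      ring
    have hcont : ContinuousOn (fun r : ℝ => Real.exp (-(lam i) * (g s - g (r * s))) * ((1 + C / (1 + r * s)) * s) *
          (∑ j, ∑ k, B i j k * (x (T + g (r * s) + τ) j * x (T + g (r * s) + τ) k))) (Set.uIcc 0 1) := by
      have hgc : ContinuousOn (fun r => g (r * s)) (Set.uIcc 0 1) := by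
        intro r hr
        rw [uIcc_of_le zero_le_one] at hr
        exact (ContinuousAt.comp (f := fun r => r * s) (hgd _ (mul_nonneg hr.1 hs.le)).continuousAt
          (by fun_prop)).continuousWithinAt
      have hxx : ∀ j, ContinuousOn (fun r => x (T + g (r * s) + τ) j) (Set.uIcc 0 1) := fun j =>
        ((continuous_apply j).comp h.contx).comp_continuousOn ((continuousOn_const.add hgc).add continuousOn_const)
      refine ContinuousOn.mul (ContinuousOn.mul ?_ (ContinuousOn.mul ?_ continuousOn_const)) ?_
      · exact Real.continuous_exp.comp_continuousOn (continuousOn_const.mul (continuousOn_const.sub hgc))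
      · refine continuousOn_const.add (continuousOn_const.div (by fun_prop) fun r hr => ?_)
        rw [uIcc_of_le zero_le_one] at hr
        have := mul_nonneg hr.1 hs.le
        positivity
      · exact continuousOn_finsetSum _ fun j _ => continuousOn_finsetSum _ fun k _ =>
          continuousOn_const.mul ((hxx j).mul (hxx k))
    rw [intervalIntegral.integral_congr hker, intervalIntegral.integral_ofReal,
      intervalIntegral.integral_eq_sub_of_hasDerivAt hcd hcont.intervalIntegrable]
    have g0 : g 0 = 0 := by simp [hg]
    rw [ContinuousMap.smul_apply, smul_eq_mul, hHg s hs.le]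
    simp only [hxh, X0, traj, ContinuousMap.coe_mk, one_mul, sub_self, mul_zero, zero_mul, Real.exp_zero, g0, sub_zero,
      add_zero]
    push_cast
    ring
  obtain ⟨X, hX1, hX2, hX3⟩ := picard_main hε hεC hlam hsmall (by positivity) hx0 xh hxc hxb hxe
  refine ⟨T, C, 2 * E, X, hC, hX1, hX2, fun s hs i τ => ?_⟩
  rw [hX3 s hs]
  rfl

end energy

section superdecay
variable {ι : Type*} [Fintype ι] {lam : ι → ℝ} {B : ι → ι → ι → ℝ} {α : ℝ} {x : ℝ → ι → ℝ}

/-- observable -/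
def obs (ℓ : ℝ) (ψ : ℝ → ℝ) (x : ℝ → ι → ℝ) (P : MvPolynomial ι ℝ) (s : ℝ) : ℝ :=
  ∫ τ in (0:ℝ)..ℓ, ψ τ * MvPolynomial.eval (x (s + τ)) P

theorem aeval_diff (P : MvPolynomial ι ℝ) :
    Differentiable ℂ (fun v : ι → ℂ => MvPolynomial.aeval v P) := by
  induction P using MvPolynomial.induction_on with
  | C a => simp only [MvPolynomial.aeval_C]; exact differentiable_const _
  | add p q hp hq => simp only [map_add]; exact hp.add hq
  | mul_X p i hp =>
    simp only [map_mul, MvPolynomial.aeval_X]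
    exact hp.mul (differentiable_apply i)

theorem aeval_ofReal (v : ι → ℝ) (P : MvPolynomial ι ℝ) :
    MvPolynomial.aeval (fun i => (v i : ℂ)) P = ((MvPolynomial.eval v P : ℝ) : ℂ) := by
  induction P using MvPolynomial.induction_on with
  | C a => simp
  | add p q hp hq => simp [map_add, hp, hq]
  | mul_X p i hp => simp [map_mul, hp]

theorem QSys.superdecay (h : QSys lam B α x) {ℓ : ℝ} (hℓ : 0 < ℓ) {ψ : ℝ → ℝ} (hψ : Continuous ψ)
    (P : MvPolynomial ι ℝ)
    (hsd : ∀ n : ℕ, ∃ K S : ℝ, ∀ s, S ≤ s → |obs ℓ ψ x P s| ≤ K * Real.exp (-n * s)) :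
    ∃ S, ∀ s, S ≤ s → obs ℓ ψ x P s = 0 := by
  obtain ⟨T, C, R, X, hC, hX1, hX2, hX3⟩ := h.ext (ℓ := ℓ)
  set G : ℂ → ℝ → ℂ := fun z τ => (ψ τ : ℂ) * MvPolynomial.aeval (fun i => X z i (projIcc 0 ℓ hℓ.le τ)) P with hG
  set Φ : ℂ → ℂ := fun z => ∫ τ in (0:ℝ)..ℓ, G z τ with hΦ
  have hPc : Continuous (fun v : ι → ℂ => MvPolynomial.aeval v P) := (aeval_diff P).continuous
  have hGc : ∀ z, Continuous (G z) := by
    intro z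
    refine (Complex.continuous_ofReal.comp hψ).mul (hPc.comp (continuous_pi fun i => ?_))
    exact (X z i).continuous.comp continuous_projIcc
  obtain ⟨M1, hM1⟩ := (isCompact_closedBall (0 : ι → ℂ) R).exists_bound_of_continuousOn hPc.continuousOn
  obtain ⟨M2, hM2⟩ := (isCompact_Icc (a := (0:ℝ)) (b := ℓ)).exists_bound_of_continuousOn hψ.continuousOn
  have hGb : ∀ z ∈ rhp, ∀ τ ∈ Set.uIoc (0:ℝ) ℓ, ‖G z τ‖ ≤ M2 * M1 := by
    intro z hz τ hτ
    rw [uIoc_of_le hℓ.le] at hτ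
    have h1 := hM2 τ ⟨hτ.1.le, hτ.2⟩
    have hb : ∀ i, ‖X z i (projIcc 0 ℓ hℓ.le τ)‖ ≤ R := fun i =>
      ((X z i).norm_coe_le_norm _).trans ((norm_le_pi_norm (X z) i).trans (hX2 z hz))
    have hR : 0 ≤ R := (norm_nonneg _).trans (hX2 z hz)
    have h2 := hM1 (fun i => X z i (projIcc 0 ℓ hℓ.le τ)) (by
      rw [mem_closedBall_zero_iff]; exact (pi_norm_le_iff_of_nonneg hR).2 hb)
    rw [hG, norm_mul, Complex.norm_real]
    exact mul_le_mul h1 h2 (norm_nonneg _) ((norm_nonneg _).trans h1)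
  have hΦd : DifferentiableOn ℂ Φ rhp := by
    refine paramHol isOpen_rhp G (fun τ hτ => ?_) (fun z hz => (hGc z).aestronglyMeasurable) ?_
    · have h1 : DifferentiableOn ℂ (fun z => (fun i => X z i (projIcc 0 ℓ hℓ.le τ))) rhp := by
        rw [differentiableOn_pi]
        intro i
        have := (differentiableOn_pi.1 hX1 i)
        exact (ContinuousMap.evalCLM ℂ (projIcc 0 ℓ hℓ.le τ)).differentiable.comp_differentiableOn this
      exact (differentiableOn_const _).mul ((aeval_diff P).comp_differentiableOn h1)
    · intro z hz
      exact ⟨M2 * M1, 1, one_pos, fun w _ hw r hr => hGb w hw r hr⟩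
  have hΦb : ∀ z ∈ rhp, ‖Φ z‖ ≤ M2 * M1 * |ℓ - 0| := fun z hz =>
    intervalIntegral.norm_integral_le_of_norm_le_const (hGb z hz)
  have hΦr : ∀ s : ℝ, 0 < s → Φ s = ((obs ℓ ψ x P (T + (s + C * Real.log (1 + s))) : ℝ) : ℂ) := by
    intro s hs
    simp only [hΦ, hG, obs]
    rw [← intervalIntegral.integral_ofReal]
    refine intervalIntegral.integral_congr fun τ hτ => ?_
    rw [uIcc_of_le hℓ.le] at hτ
    simp only [hX3 s hs, projIcc_of_mem hℓ.le hτ]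
    rw [aeval_ofReal]
    push_cast; rfl
  set f : ℂ → ℂ := fun z => Φ (z + 1) with hf
  have hmem : ∀ z : ℂ, 0 ≤ z.re → z + 1 ∈ rhp := fun z hz => by
    show 0 < (z + 1).re
    simp; linarith
  have hfd : ∀ z : ℂ, 0 ≤ z.re → DifferentiableAt ℂ f z := fun z hz => by
    have h1 : DifferentiableAt ℂ Φ (z + 1) := hΦd.differentiableAt (isOpen_rhp.mem_nhds (hmem z hz))
    exact DifferentiableAt.comp (g := Φ) (f := fun z : ℂ => z + 1) z h1 (by fun_prop)
  have hlog : ∀ s : ℝ, 0 ≤ s → 0 ≤ Real.log (1 + (s + 1)) := fun s hs => Real.log_nonneg (by linarith)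
  have key := PhragmenLindelof.eq_zero_on_right_half_plane_of_superexponential_decay (f := f) ?_ ?_ ?_ ?_
  · refine ⟨T + (1 + C * Real.log (1 + 1)), fun s hs => ?_⟩
    -- surjectivity
    have hgc : ContinuousOn (fun r : ℝ => T + (r + C * Real.log (1 + r))) (Icc 1 (s - T + 1)) := by
      refine continuousOn_const.add (continuousOn_id.add (continuousOn_const.mul ?_))
      refine ContinuousOn.log (by fun_prop) fun r hr => ?_
      have := hr.1
      positivity
    have hs1 : 1 ≤ s - T + 1 := by
      have := mul_nonneg hC.le (Real.log_nonneg (x := 1 + 1) (by norm_num))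
      linarith
    have hiv := intermediate_value_Icc hs1 hgc
    obtain ⟨r, hr, hrs⟩ := hiv (show s ∈ Icc _ _ from ⟨hs, by
      have := mul_nonneg hC.le (Real.log_nonneg (x := 1 + (s - T + 1)) (by linarith))
      linarith⟩)
    have h1 := key (show ((r - 1 : ℝ) : ℂ) ∈ {z : ℂ | 0 ≤ z.re} by
      show 0 ≤ ((r - 1 : ℝ) : ℂ).re
      rw [Complex.ofReal_re]; linarith [hr.1])
    simp only [hf] at h1
    have e : ((r - 1 : ℝ) : ℂ) + 1 = (r : ℂ) := by push_cast; ring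
    rw [e, hΦr r (by linarith [hr.1])] at h1
    simp only at hrs
    rw [hrs] at h1
    simpa using h1
  · refine DifferentiableOn.diffContOnCl fun z hz => ?_
    have : z ∈ {z : ℂ | 0 ≤ z.re} := by
      have h2 : closure {z : ℂ | 0 < z.re} ⊆ {z : ℂ | 0 ≤ z.re} :=
        closure_minimal (fun z (hz : 0 < z.re) => (le_of_lt hz : 0 ≤ z.re)) (isClosed_le continuous_const Complex.continuous_re)
      exact h2 hz
    exact (hfd z this).differentiableWithinAt
  · refine ⟨0, by norm_num, 0, ?_⟩
    refine IsBigO.of_bound (M2 * M1 * |ℓ - 0|) ?_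
    refine Filter.eventually_inf_principal.2 (Eventually.of_forall fun z hz => ?_)
    simpa using hΦb _ (hmem z (le_of_lt hz))
  · intro n
    obtain ⟨K, S, hK⟩ := hsd (n + 1)
    have hK' : ∀ᶠ s : ℝ in atTop, Real.exp s ^ n * ‖f s‖ ≤ (|K| * Real.exp (-(n+1) * T)) * Real.exp (-s) := by
      filter_upwards [eventually_ge_atTop (0:ℝ), eventually_ge_atTop (S - T)] with s hs0 hs1
      have e : f s = ((obs ℓ ψ x P (T + ((s + 1) + C * Real.log (1 + (s + 1)))) : ℝ) : ℂ) := by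
        rw [← hΦr (s + 1) (by linarith)]; simp [hf]
      have hl := mul_nonneg hC.le (hlog s hs0)
      rw [e, Complex.norm_real, Real.norm_eq_abs]
      have h1 := hK (T + ((s + 1) + C * Real.log (1 + (s + 1)))) (by linarith)
      have h2 : K * Real.exp (-((n + 1 : ℕ) : ℝ) * (T + ((s + 1) + C * Real.log (1 + (s + 1))))) ≤
          |K| * Real.exp (-(n+1) * (T + s)) := by
        refine mul_le_mul (le_abs_self K) (Real.exp_le_exp.2 ?_) (Real.exp_pos _).le (abs_nonneg _)
        push_cast
        have : (0:ℝ) ≤ n + 1 := by positivity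
        nlinarith
      calc _ ≤ Real.exp s ^ n * (|K| * Real.exp (-(n+1) * (T + s))) := by
            gcongr; exact h1.trans h2
        _ = _ := by
            rw [← Real.exp_nat_mul, mul_left_comm, ← Real.exp_add, mul_assoc, ← Real.exp_add]
            congr 2; ring
    refine squeeze_zero' (Eventually.of_forall fun s => by positivity) hK' ?_
    have := (Real.tendsto_exp_neg_atTop_nhds_zero).const_mul (|K| * Real.exp (-(n+1) * T))
    simpa using this
  · exact ⟨M2 * M1 * |ℓ - 0|, fun y => hΦb _ (hmem _ (by simp))⟩

end superdecay

/-- decay of order almost `N` -/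
def ON (N : ℝ) (φ : ℝ → ℝ) : Prop :=
  ∀ N' < N, ∃ K S : ℝ, ∀ s, S ≤ s → |φ s| ≤ K * Real.exp (-N' * s)

def EvNZ (φ : ℝ → ℝ) : Prop := ∃ S : ℝ, ∀ s, S ≤ s → φ s ≠ 0

theorem step_nz {φ r : ℝ → ℝ} {l : ℝ} (hφ : ∀ s, HasDerivAt φ (r s - l * φ s) s) (hr : Continuous r)
    (h : EvNZ r) : EvNZ φ := by
  obtain ⟨S, hS⟩ := h
  set g : ℝ → ℝ := fun s => Real.exp (l * s) * φ s with hg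
  have hgd : ∀ s, HasDerivAt g (Real.exp (l * s) * r s) s := by
    intro s
    have h1 : HasDerivAt (fun s => Real.exp (l * s)) (Real.exp (l * s) * (l * 1)) s :=
      ((hasDerivAt_id s).const_mul l).exp
    refine (h1.mul (hφ s)).congr_deriv ?_
    ring
  have hgc : ContinuousOn g (Ici S) := fun s _ => (hgd s).continuousAt.continuousWithinAt
  have hinj : InjOn g (Ici S) := by
    have hsign : (∀ s ∈ Ici S, 0 < r s) ∨ (∀ s ∈ Ici S, r s < 0) := by
      by_contra hcon
      push Not at hcon
      obtain ⟨⟨a, ha, ha'⟩, ⟨b, hb, hb'⟩⟩ := hcon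
      have hpc : IsPreconnected (Ici S) := isPreconnected_Ici
      obtain ⟨c, hc, hc'⟩ := hpc.intermediate_value ha hb hr.continuousOn (show (0:ℝ) ∈ Icc (r a) (r b) from ⟨ha', hb'⟩)
      exact hS c hc hc'
    rcases hsign with hs | hs
    · apply StrictMonoOn.injOn
      refine strictMonoOn_of_deriv_pos (convex_Ici S) hgc fun s hs' => ?_
      rw [(hgd s).deriv]
      exact mul_pos (Real.exp_pos _) (hs s (interior_subset hs'))
    · apply StrictAntiOn.injOn
      refine strictAntiOn_of_deriv_neg (convex_Ici S) hgc fun s hs' => ?_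
      rw [(hgd s).deriv]
      exact mul_neg_of_pos_of_neg (Real.exp_pos _) (hs s (interior_subset hs'))
  by_cases hz : ∃ a ∈ Ici S, φ a = 0
  · obtain ⟨a, ha, ha0⟩ := hz
    refine ⟨a + 1, fun s hs h0 => ?_⟩
    have hsS : s ∈ Ici S := by
      have : S ≤ a := ha
      show S ≤ s
      linarith
    have := hinj ha hsS (by simp [hg, ha0, h0])
    linarith
  · push Not at hz
    exact ⟨S, fun s hs => hz s hs⟩

theorem step_dec {φ r : ℝ → ℝ} {l N : ℝ} (hφ : ∀ s, HasDerivAt φ (r s - l * φ s) s)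
    (h : ON N r) : EvNZ φ ∨ ON N φ := by
  by_cases hnz : EvNZ φ
  · exact Or.inl hnz
  right
  intro N' hN'
  obtain ⟨N1, h1, h2, h3⟩ : ∃ N1, N' < N1 ∧ N1 < N ∧ N1 ≠ l := by
    by_cases hc : (N' + N) / 2 = l
    · exact ⟨(N' + (N' + N) / 2) / 2, by linarith, by linarith, by rw [← hc]; intro hh; linarith⟩
    · exact ⟨(N' + N) / 2, by linarith, by linarith, hc⟩
  suffices ∃ K S : ℝ, ∀ s, S ≤ s → |φ s| ≤ K * Real.exp (-N1 * s) by
    obtain ⟨K, S, hK⟩ := this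
    refine ⟨|K|, max S 0, fun s hs => (hK s ((le_max_left _ _).trans hs)).trans ?_⟩
    have hs0 : 0 ≤ s := (le_max_right _ _).trans hs
    refine mul_le_mul (le_abs_self K) (Real.exp_le_exp.2 ?_) (Real.exp_pos _).le (abs_nonneg _)
    nlinarith
  obtain ⟨K, S, hK⟩ := h N1 h2
  set g : ℝ → ℝ := fun s => Real.exp (l * s) * φ s with hg
  set m := l - N1 with hm
  have hm0 : m ≠ 0 := sub_ne_zero.2 h3.symm
  have hgd : ∀ s, HasDerivAt g (Real.exp (l * s) * r s) s := by
    intro s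
    have h1 : HasDerivAt (fun s => Real.exp (l * s)) (Real.exp (l * s) * (l * 1)) s :=
      ((hasDerivAt_id s).const_mul l).exp
    refine (h1.mul (hφ s)).congr_deriv ?_
    ring
  have hgb : ∀ s, S ≤ s → |Real.exp (l * s) * r s| ≤ K * Real.exp (m * s) := by
    intro s hs
    rw [abs_mul, abs_of_pos (Real.exp_pos _)]
    calc _ ≤ Real.exp (l * s) * (K * Real.exp (-N1 * s)) := by gcongr; exact hK s hs
      _ = K * Real.exp (m * s) := by
        rw [mul_left_comm, ← Real.exp_add]; congr 2; rw [hm]; ring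
  have hK0 : 0 ≤ K := by
    have := (abs_nonneg _).trans (hK S le_rfl)
    exact nonneg_of_mul_nonneg_left this (Real.exp_pos _)
  have hed : ∀ s, HasDerivAt (fun s => K / m * Real.exp (m * s)) (K * Real.exp (m * s)) s := by
    intro s
    have := (((hasDerivAt_id s).const_mul m).exp).const_mul (K / m)
    refine this.congr_deriv ?_
    simp only [id]
    field_simp
  have hmono : MonotoneOn (fun s => g s + K / m * Real.exp (m * s)) (Ici S) := by
    have hd := fun s => (hgd s).add (hed s)
    refine monotoneOn_of_deriv_nonneg (convex_Ici S) (fun s _ => (hd s).continuousAt.continuousWithinAt)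
      (fun s _ => (hd s).differentiableAt.differentiableWithinAt) fun s hs => ?_
    have h1 : deriv (fun s => g s + K / m * Real.exp (m * s)) s = _ := (hd s).deriv
    rw [h1]
    rw [interior_Ici] at hs
    have := (abs_le.1 (hgb s (le_of_lt hs))).1
    linarith
  have hanti : AntitoneOn (fun s => g s - K / m * Real.exp (m * s)) (Ici S) := by
    have hd := fun s => (hgd s).sub (hed s)
    refine antitoneOn_of_deriv_nonpos (convex_Ici S) (fun s _ => (hd s).continuousAt.continuousWithinAt)
      (fun s _ => (hd s).differentiableAt.differentiableWithinAt) fun s hs => ?_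
    have h1 : deriv (fun s => g s - K / m * Real.exp (m * s)) s = _ := (hd s).deriv
    rw [h1]
    rw [interior_Ici] at hs
    have := (abs_le.1 (hgb s (le_of_lt hs))).2
    linarith
  have fin : ∀ s (Kc : ℝ), |g s| ≤ Kc * Real.exp (m * s) → |φ s| ≤ Kc * Real.exp (-N1 * s) := by
    intro s Kc hh
    simp only [hg, abs_mul, abs_of_pos (Real.exp_pos (l * s))] at hh
    have e : Real.exp (m * s) = Real.exp (l * s) * Real.exp (-N1 * s) := by
      rw [← Real.exp_add]; congr 1; rw [hm]; ring
    rw [e, mul_left_comm] at hh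
    exact le_of_mul_le_mul_left hh (Real.exp_pos _)
  rcases lt_or_gt_of_ne hm0 with hneg | hpos
  · -- limit exists
    have hbd : ∀ s, S ≤ s → ∀ t, S ≤ t → g s + K / m * Real.exp (m * s) ≤ g t - K / m * Real.exp (m * t) := by
      intro s hs t ht
      have hc : ∀ w, K / m * Real.exp (m * w) ≤ 0 := fun w =>
        mul_nonpos_of_nonpos_of_nonneg (div_nonpos_of_nonneg_of_nonpos hK0 hneg.le) (Real.exp_pos _).le
      have a1 := hmono (mem_Ici.2 hs) (mem_Ici.2 (hs.trans (le_max_left s t))) (le_max_left s t)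
      have a2 := hanti (mem_Ici.2 ht) (mem_Ici.2 (ht.trans (le_max_right s t))) (le_max_right s t)
      simp only at a1 a2
      have := hc (max s t)
      linarith
    set c := sSup ((fun s => g s + K / m * Real.exp (m * s)) '' Ici S) with hc
    have hne : ((fun s => g s + K / m * Real.exp (m * s)) '' Ici S).Nonempty := ⟨_, S, mem_Ici.2 le_rfl, rfl⟩
    have hc1 : ∀ s, S ≤ s → g s + K / m * Real.exp (m * s) ≤ c := fun s hs =>
      le_csSup ⟨g S - K / m * Real.exp (m * S), by rintro _ ⟨t, ht, rfl⟩; exact hbd t ht S le_rfl⟩ ⟨s, hs, rfl⟩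
    have hc2 : ∀ s, S ≤ s → c ≤ g s - K / m * Real.exp (m * s) := fun s hs =>
      csSup_le hne (by rintro _ ⟨t, ht, rfl⟩; exact hbd t ht s hs)
    by_cases hc0 : c = 0
    · refine ⟨-(K / m), S, fun s hs => fin s _ ?_⟩
      have a1 := hc1 s hs
      have a2 := hc2 s hs
      rw [hc0] at a1 a2
      rw [abs_le]; constructor <;> linarith
    · exfalso
      apply hnz
      have ht : Tendsto (fun s => K / m * Real.exp (m * s)) atTop (𝓝 0) := by
        have : Tendsto (fun s => m * s) atTop atBot := tendsto_id.const_mul_atTop_of_neg hneg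
        simpa using (Real.tendsto_exp_atBot.comp this).const_mul (K / m)
      have ht2 : ∀ᶠ s in atTop, |K / m * Real.exp (m * s)| < |c| := by
        have := ht.abs
        rw [abs_zero] at this
        exact this.eventually_lt_const (abs_pos.2 hc0)
      obtain ⟨S2, hS2⟩ := eventually_atTop.1 ht2
      refine ⟨max S S2, fun s hs h0 => ?_⟩
      have a1 := hc1 s ((le_max_left _ _).trans hs)
      have a2 := hc2 s ((le_max_left _ _).trans hs)
      have a3 := hS2 s ((le_max_right _ _).trans hs)
      have g0 : g s = 0 := by simp [hg, h0]
      rw [g0] at a1 a2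
      have : |c| ≤ |K / m * Real.exp (m * s)| := by
        rw [abs_le]
        constructor
        · have := le_abs_self (K / m * Real.exp (m * s)); have := neg_abs_le (K / m * Real.exp (m * s)); linarith
        · have := neg_abs_le (K / m * Real.exp (m * s)); linarith
      linarith
  · refine ⟨|g S + K / m * Real.exp (m * S)| + |g S - K / m * Real.exp (m * S)| + K / m, max S 0, fun s hs => fin s _ ?_⟩
    have hsS := (le_max_left _ _).trans hs
    have a1 := hmono (mem_Ici.2 le_rfl) (mem_Ici.2 hsS) hsS
    have a2 := hanti (mem_Ici.2 le_rfl) (mem_Ici.2 hsS) hsS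
    simp only at a1 a2
    have hs0 : 0 ≤ s := (le_max_right _ _).trans hs
    have he1 : 1 ≤ Real.exp (m * s) := Real.one_le_exp (by positivity)
    have b1 := neg_abs_le (g S + K / m * Real.exp (m * S))
    have b2 := le_abs_self (g S - K / m * Real.exp (m * S))
    set u := |g S + K / m * Real.exp (m * S)|
    set v := |g S - K / m * Real.exp (m * S)|
    have hu : 0 ≤ u := abs_nonneg _
    have hv : 0 ≤ v := abs_nonneg _
    rw [abs_le]
    constructor <;> nlinarith [mul_le_mul_of_nonneg_left he1 hu, mul_le_mul_of_nonneg_left he1 hv]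

section alg
variable {ι : Type*} [Fintype ι]

open MvPolynomial in
/-- the vector field as a derivation -/
def dlt (lam : ι → ℝ) (B : ι → ι → ι → ℝ) : Derivation ℝ (MvPolynomial ι ℝ) (MvPolynomial ι ℝ) :=
  MvPolynomial.mkDerivation ℝ (fun i => (-lam i) • (X i : MvPolynomial ι ℝ) + ∑ j, ∑ k, B i j k • (X j * X k))

def Mk (k : ℕ) : Submodule ℝ (MvPolynomial ι ℝ) :=
  Submodule.span ℝ {P | ∃ e : ι →₀ ℕ, k ≤ e.degree ∧ P = MvPolynomial.monomial e 1}

theorem Mk_mono (k : ℕ) {e : ι →₀ ℕ} (h : k ≤ e.degree) :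
    MvPolynomial.monomial e (1:ℝ) ∈ Mk (ι := ι) k := Submodule.subset_span ⟨e, h, rfl⟩

theorem Mk_anti {k l : ℕ} (h : k ≤ l) : Mk (ι := ι) l ≤ Mk k :=
  Submodule.span_mono fun _ ⟨e, he, hP⟩ => ⟨e, h.trans he, hP⟩

theorem Mk_mul {a b : ℕ} {P R : MvPolynomial ι ℝ} (hP : P ∈ Mk a) (hR : R ∈ Mk b) : P * R ∈ Mk (ι := ι) (a + b) := by
  have h := Submodule.mul_mem_mul hP hR
  unfold Mk at h
  rw [Submodule.span_mul_span] at h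
  refine Submodule.span_le.2 ?_ h
  rintro _ ⟨_, ⟨e, he, rfl⟩, _, ⟨f, hf, rfl⟩, rfl⟩
  simp only [MvPolynomial.monomial_mul, mul_one]
  refine Mk_mono _ ?_
  rw [map_add]; omega

theorem Mk_zero (P : MvPolynomial ι ℝ) : P ∈ Mk (ι := ι) 0 := by
  rw [MvPolynomial.as_sum P]
  refine Submodule.sum_mem _ fun e _ => ?_
  have : MvPolynomial.monomial e (P.coeff e) = P.coeff e • MvPolynomial.monomial e (1:ℝ) := by
    rw [MvPolynomial.smul_monomial]; simp
  rw [this]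
  exact Submodule.smul_mem _ _ (Mk_mono 0 (Nat.zero_le _))

def ldot (lam : ι → ℝ) (e : ι →₀ ℕ) : ℝ := ∑ i, (e i : ℝ) * lam i

theorem dlt_key (lam : ι → ℝ) (B : ι → ι → ι → ℝ) (e : ι →₀ ℕ) :
    dlt lam B (MvPolynomial.monomial e 1) + ldot lam e • MvPolynomial.monomial e 1 ∈ Mk (ι := ι) (e.degree + 1) := by
  classical
  have hadd : ∀ f g : ι →₀ ℕ,
      dlt lam B (MvPolynomial.monomial f 1) + ldot lam f • MvPolynomial.monomial f 1 ∈ Mk (ι := ι) (f.degree + 1) →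
      dlt lam B (MvPolynomial.monomial g 1) + ldot lam g • MvPolynomial.monomial g 1 ∈ Mk (ι := ι) (g.degree + 1) →
      dlt lam B (MvPolynomial.monomial (f + g) 1) + ldot lam (f + g) • MvPolynomial.monomial (f + g) 1
        ∈ Mk (ι := ι) ((f + g).degree + 1) := by
    intro f g hf hg
    have e1 : MvPolynomial.monomial (f + g) (1:ℝ) = MvPolynomial.monomial f 1 * MvPolynomial.monomial g 1 := by
      rw [MvPolynomial.monomial_mul, mul_one]
    have e2 : ldot lam (f + g) = ldot lam f + ldot lam g := by
      simp [ldot, add_mul, Finset.sum_add_distrib]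
    have e3 : dlt lam B (MvPolynomial.monomial (f + g) 1) + ldot lam (f + g) • MvPolynomial.monomial (f + g) 1
      = MvPolynomial.monomial f 1 * (dlt lam B (MvPolynomial.monomial g 1) + ldot lam g • MvPolynomial.monomial g 1)
        + MvPolynomial.monomial g 1 * (dlt lam B (MvPolynomial.monomial f 1) + ldot lam f • MvPolynomial.monomial f 1) := by
      rw [e1, e2, Derivation.leibniz]
      simp only [smul_eq_mul, MvPolynomial.smul_eq_C_mul, map_add]
      ring
    rw [e3]
    refine Submodule.add_mem _ ?_ ?_
    · have := Mk_mul (Mk_mono f.degree le_rfl) hg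
      rwa [← add_assoc, ← map_add] at this
    · have := Mk_mul (Mk_mono g.degree le_rfl) hf
      rwa [← add_assoc, ← map_add, add_comm g f] at this
  have hz : dlt lam B (MvPolynomial.monomial 0 1) + ldot lam 0 • MvPolynomial.monomial 0 1
      ∈ Mk (ι := ι) ((0 : ι →₀ ℕ).degree + 1) := by
    have : (MvPolynomial.monomial 0 (1:ℝ) : MvPolynomial ι ℝ) = 1 := rfl
    rw [this]
    simp [ldot]
  have h1 : ∀ i, dlt lam B (MvPolynomial.monomial (Finsupp.single i 1) 1) +
      ldot lam (Finsupp.single i 1) • MvPolynomial.monomial (Finsupp.single i 1) 1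
      ∈ Mk (ι := ι) ((Finsupp.single i 1 : ι →₀ ℕ).degree + 1) := by
    intro i
    have e1 : (MvPolynomial.monomial (Finsupp.single i 1) (1:ℝ) : MvPolynomial ι ℝ) = MvPolynomial.X i := rfl
    have e2 : ldot lam (Finsupp.single i 1) = lam i := by
      simp [ldot, Finsupp.single_apply]
    have e3 : dlt lam B (MvPolynomial.X i) = (-lam i) • (MvPolynomial.X i : MvPolynomial ι ℝ) +
        ∑ j, ∑ k, B i j k • (MvPolynomial.X j * MvPolynomial.X k) := by
      simp [dlt, MvPolynomial.mkDerivation_X]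
    rw [e1, e2, e3]
    have e4 : (-lam i) • (MvPolynomial.X i : MvPolynomial ι ℝ) +
        ∑ j, ∑ k, B i j k • (MvPolynomial.X j * MvPolynomial.X k) + lam i • MvPolynomial.X i
        = ∑ j, ∑ k, B i j k • (MvPolynomial.X j * MvPolynomial.X k) := by
      rw [neg_smul]; abel
    rw [e4]
    have hX : ∀ j : ι, (MvPolynomial.X j : MvPolynomial ι ℝ) ∈ Mk (ι := ι) 1 := fun j =>
      Mk_mono (e := Finsupp.single j 1) 1 (by simp)
    refine Submodule.sum_mem _ fun j _ => Submodule.sum_mem _ fun k _ => Submodule.smul_mem _ _ ?_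
    have := Mk_mul (hX j) (hX k)
    simpa using this
  have hs : ∀ i n, dlt lam B (MvPolynomial.monomial (Finsupp.single i n) 1) +
      ldot lam (Finsupp.single i n) • MvPolynomial.monomial (Finsupp.single i n) 1
      ∈ Mk (ι := ι) ((Finsupp.single i n : ι →₀ ℕ).degree + 1) := by
    intro i n
    induction n with
    | zero => rw [Finsupp.single_zero]; exact hz
    | succ n ih => rw [Finsupp.single_add]; exact hadd _ _ ih (h1 i)
  induction e using Finsupp.induction_linear with
  | zero => exact hz
  | add f g hf hg => exact hadd f g hf hg
  | single i n => exact hs i n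

theorem Mk_dlt (lam : ι → ℝ) (B : ι → ι → ι → ℝ) (c : ℝ) {k : ℕ} {P : MvPolynomial ι ℝ} (hP : P ∈ Mk k) :
    dlt lam B P + c • P ∈ Mk (ι := ι) k := by
  refine Submodule.add_mem _ ?_ (Submodule.smul_mem _ _ hP)
  induction hP using Submodule.span_induction with
  | mem P h =>
    obtain ⟨e, he, rfl⟩ := h
    have h1 := Mk_anti (show k ≤ e.degree + 1 by omega) (dlt_key lam B e)
    have h2 := Submodule.smul_mem _ (ldot lam e) (Mk_mono k he)
    have := Submodule.sub_mem _ h1 h2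
    simpa using this
  | zero => simp
  | add P R _ _ hP hR => rw [map_add]; exact Submodule.add_mem _ hP hR
  | smul a P _ hP => rw [Derivation.map_smul]; exact Submodule.smul_mem _ _ hP

/-- intermediate spaces -/
def Ak (k : ℕ) (S : Finset (ι →₀ ℕ)) : Submodule ℝ (MvPolynomial ι ℝ) :=
  Submodule.span ℝ ((fun e => MvPolynomial.monomial e (1:ℝ)) '' (S : Set (ι →₀ ℕ))) ⊔ Mk (k + 1)

theorem Ak_dlt (lam : ι → ℝ) (B : ι → ι → ι → ℝ) (c : ℝ) {k : ℕ} {S : Finset (ι →₀ ℕ)} (hS : ∀ e ∈ S, e.degree = k)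
    {P : MvPolynomial ι ℝ} (hP : P ∈ Ak k S) : dlt lam B P + c • P ∈ Ak (ι := ι) k S := by
  refine Submodule.add_mem _ ?_ (Submodule.smul_mem _ _ hP)
  obtain ⟨P1, h1, P2, h2, rfl⟩ := Submodule.mem_sup.1 hP
  rw [map_add]
  refine Submodule.add_mem _ ?_ (Submodule.mem_sup_right (by simpa using Mk_dlt lam B 0 h2))
  clear hP
  induction h1 using Submodule.span_induction with
  | mem P h =>
    obtain ⟨e, he, rfl⟩ := h
    have a1 : dlt lam B (MvPolynomial.monomial e 1) + ldot lam e • MvPolynomial.monomial e 1 ∈ Ak (ι := ι) k S := by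
      have := dlt_key lam B e
      rw [hS e he] at this
      exact Submodule.mem_sup_right this
    have a2 : ldot lam e • MvPolynomial.monomial e (1:ℝ) ∈ Ak (ι := ι) k S :=
      Submodule.smul_mem _ _ (Submodule.mem_sup_left (Submodule.subset_span ⟨e, he, rfl⟩))
    have := Submodule.sub_mem _ a1 a2
    simpa using this
  | zero => simp
  | add P R _ _ hP hR => rw [map_add]; exact Submodule.add_mem _ hP hR
  | smul a P _ hP => rw [Derivation.map_smul]; exact Submodule.smul_mem _ _ hP

open Classical in
theorem Ak_insert (lam : ι → ℝ) (B : ι → ι → ι → ℝ) {k : ℕ} {S : Finset (ι →₀ ℕ)} (hS : ∀ e ∈ S, e.degree = k)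
    {e : ι →₀ ℕ} (he : e.degree = k)
    {P : MvPolynomial ι ℝ} (hP : P ∈ Ak k (insert e S)) : dlt lam B P + ldot lam e • P ∈ Ak (ι := ι) k S := by
  obtain ⟨P1, h1, P2, h2, rfl⟩ := Submodule.mem_sup.1 hP
  rw [Finset.coe_insert, Set.image_insert_eq] at h1
  obtain ⟨a, P3, h3, rfl⟩ := Submodule.mem_span_insert.1 h1
  have e1 : dlt lam B (a • MvPolynomial.monomial e 1 + P3 + P2) + ldot lam e • (a • MvPolynomial.monomial e 1 + P3 + P2)
    = a • (dlt lam B (MvPolynomial.monomial e 1) + ldot lam e • MvPolynomial.monomial e 1) +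
      (dlt lam B (P3 + P2) + ldot lam e • (P3 + P2)) := by
    simp only [map_add, Derivation.map_smul, smul_add, smul_comm a]
    abel
  rw [e1]
  refine Submodule.add_mem _ (Submodule.smul_mem _ _ ?_) (Ak_dlt lam B _ hS ?_)
  · have := dlt_key lam B e
    rw [he] at this
    exact Submodule.mem_sup_right this
  · exact Submodule.mem_sup.2 ⟨P3, h3, P2, h2, rfl⟩

open Classical in
theorem Mk_le_Ak (k : ℕ) : Mk (ι := ι) k ≤ Ak k (Finset.finsuppAntidiag Finset.univ k) := by
  refine Submodule.span_le.2 ?_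
  rintro _ ⟨e, he, rfl⟩
  rcases eq_or_lt_of_le he with h | h
  · refine Submodule.mem_sup_left (Submodule.subset_span ⟨e, ?_, rfl⟩)
    simp only [Finset.mem_coe, Finset.mem_finsuppAntidiag]
    refine ⟨?_, Finset.subset_univ _⟩
    rw [h, Finsupp.degree_eq_sum]
  · exact Submodule.mem_sup_right (Mk_mono (k+1) h)

theorem Mk_eval {k : ℕ} {P : MvPolynomial ι ℝ} (hP : P ∈ Mk (ι := ι) k) :
    ∃ c : ℝ, 0 ≤ c ∧ ∀ v : ι → ℝ, ‖v‖ ≤ 1 → |MvPolynomial.eval v P| ≤ c * ‖v‖ ^ k := by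
  induction hP using Submodule.span_induction with
  | mem P h =>
    obtain ⟨e, he, rfl⟩ := h
    refine ⟨1, zero_le_one, fun v hv => ?_⟩
    rw [MvPolynomial.eval_monomial, one_mul, one_mul, Finsupp.prod_fintype _ _ (by simp), Finset.abs_prod]
    calc _ ≤ ∏ i, ‖v‖ ^ e i := by
          refine Finset.prod_le_prod (fun _ _ => abs_nonneg _) fun i _ => ?_
          rw [abs_pow]
          exact pow_le_pow_left₀ (abs_nonneg _) (norm_le_pi_norm v i) _
      _ = ‖v‖ ^ e.degree := by rw [Finset.prod_pow_eq_pow_sum, Finsupp.degree_eq_sum]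
      _ ≤ _ := pow_le_pow_of_le_one (norm_nonneg _) hv he
  | zero => exact ⟨0, le_rfl, fun v _ => by simp⟩
  | add P R _ _ hP hR =>
    obtain ⟨c, hc, h1⟩ := hP
    obtain ⟨c', hc', h2⟩ := hR
    refine ⟨c + c', by positivity, fun v hv => ?_⟩
    rw [map_add, add_mul]
    exact (abs_add_le _ _).trans (add_le_add (h1 v hv) (h2 v hv))
  | smul a P _ hP =>
    obtain ⟨c, hc, h1⟩ := hP
    refine ⟨|a| * c, by positivity, fun v hv => ?_⟩
    rw [MvPolynomial.smul_eval, abs_mul, mul_assoc]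
    exact mul_le_mul_of_nonneg_left (h1 v hv) (abs_nonneg _)

end alg

theorem convDeriv {f f' ψ : ℝ → ℝ} {ℓ : ℝ} (hf : ∀ t, HasDerivAt f (f' t) t) (hf' : Continuous f')
    (hψ : Continuous ψ) (s : ℝ) :
    HasDerivAt (fun s => ∫ τ in (0:ℝ)..ℓ, ψ τ * f (s + τ)) (∫ τ in (0:ℝ)..ℓ, ψ τ * f' (s + τ)) s := by
  have hfc : Continuous f := continuous_iff_continuousAt.2 fun t => (hf t).continuousAt
  have hc : Continuous (fun q : ℝ × ℝ => ψ q.2 * f' (q.1 + q.2)) := by fun_prop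
  obtain ⟨M, hM⟩ := ((isCompact_closedBall s 1).prod (isCompact_uIcc (a := (0:ℝ)) (b := ℓ))).exists_bound_of_continuousOn
    hc.continuousOn
  have := intervalIntegral.hasDerivAt_integral_of_dominated_loc_of_deriv_le
    (μ := volume) (a := 0) (b := ℓ) (F := fun s τ => ψ τ * f (s + τ)) (F' := fun s τ => ψ τ * f' (s + τ))
    (x₀ := s) (s := Metric.closedBall s 1) (bound := fun _ => M)
    (Metric.closedBall_mem_nhds _ one_pos)
    (Eventually.of_forall fun r => (by fun_prop : Continuous fun τ => ψ τ * f (r + τ)).aestronglyMeasurable)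
    ((by fun_prop : Continuous fun τ => ψ τ * f (s + τ)).intervalIntegrable _ _)
    ((by fun_prop : Continuous fun τ => ψ τ * f' (s + τ)).aestronglyMeasurable)
    (Eventually.of_forall fun τ hτ r hr => hM (r, τ) ⟨hr, uIoc_subset_uIcc hτ⟩)
    intervalIntegrable_const
    (Eventually.of_forall fun τ hτ r hr => by
      have h1 : HasDerivAt (fun r => f (r + τ)) (f' (r + τ)) r := by
        exact (hf (r + τ)).comp_add_const r τ
      exact h1.const_mul _)
  exact this.2

section alt
variable {ι : Type*} [Fintype ι] {lam : ι → ℝ} {B : ι → ι → ι → ℝ} {α : ℝ} {x : ℝ → ι → ℝ}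

theorem QSys.evald (h : QSys lam B α x) (P : MvPolynomial ι ℝ) (t : ℝ) :
    HasDerivAt (fun t => MvPolynomial.eval (x t) P) (MvPolynomial.eval (x t) (dlt lam B P)) t := by
  induction P using MvPolynomial.induction_on with
  | C a => simpa [dlt] using hasDerivAt_const t a
  | add p q hp hq => simp only [map_add]; exact hp.add hq
  | mul_X p i hp =>
    have h1 : HasDerivAt (fun t => MvPolynomial.eval (x t) (MvPolynomial.X i))
        (MvPolynomial.eval (x t) (dlt lam B (MvPolynomial.X i))) t := by
      have := h.ode t i
      simpa [dlt, MvPolynomial.mkDerivation_X] using this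
    simp only [map_mul]
    refine (hp.mul h1).congr_deriv ?_
    rw [Derivation.leibniz]
    simp only [smul_eq_mul, map_add, map_mul]
    ring

theorem QSys.obsd (h : QSys lam B α x) {ℓ : ℝ} {ψ : ℝ → ℝ} (hψ : Continuous ψ) (P : MvPolynomial ι ℝ) (s : ℝ) :
    HasDerivAt (obs ℓ ψ x P) (obs ℓ ψ x (dlt lam B P) s) s := by
  have hc : Continuous (fun t => MvPolynomial.eval (x t) (dlt lam B P)) :=
    continuous_iff_continuousAt.2 fun t => (h.evald _ t).continuousAt
  exact convDeriv (fun t => h.evald P t) hc hψ s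

theorem QSys.obsc (h : QSys lam B α x) {ℓ : ℝ} {ψ : ℝ → ℝ} (hψ : Continuous ψ) (P : MvPolynomial ι ℝ) :
    Continuous (obs ℓ ψ x P) := continuous_iff_continuousAt.2 fun s => (h.obsd hψ P s).continuousAt

theorem QSys.obs_lin (h : QSys lam B α x) {ℓ : ℝ} {ψ : ℝ → ℝ} (hψ : Continuous ψ) (P R : MvPolynomial ι ℝ) (c s : ℝ) :
    obs ℓ ψ x (P + c • R) s = obs ℓ ψ x P s + c * obs ℓ ψ x R s := by
  have hc : ∀ P : MvPolynomial ι ℝ, Continuous (fun t => MvPolynomial.eval (x t) P) := fun P =>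
    continuous_iff_continuousAt.2 fun t => (h.evald _ t).continuousAt
  have h1 : ∀ P : MvPolynomial ι ℝ, Continuous (fun τ => ψ τ * MvPolynomial.eval (x (s + τ)) P) := fun P =>
    hψ.mul ((hc P).comp (by fun_prop : Continuous fun τ : ℝ => s + τ))
  unfold obs
  rw [← intervalIntegral.integral_const_mul, ← intervalIntegral.integral_add ((h1 P).intervalIntegrable _ _)
    (((h1 R).const_mul c).intervalIntegrable _ _)]
  congr 1
  funext τ
  rw [map_add, MvPolynomial.smul_eval]; ring

theorem QSys.obs_decay (h : QSys lam B α x) {ℓ : ℝ} (hℓ : 0 < ℓ) {ψ : ℝ → ℝ} (hψ : Continuous ψ) {k : ℕ}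
    {P : MvPolynomial ι ℝ} (hP : P ∈ Mk (ι := ι) k) :
    ∃ K S : ℝ, ∀ s, S ≤ s → |obs ℓ ψ x P s| ≤ K * Real.exp (-(k * (α / 2)) * s) := by
  have hα := h.hα
  obtain ⟨T, E, hE0, hE1, hdec⟩ := h.decay one_pos
  obtain ⟨c, hc, hev⟩ := Mk_eval hP
  obtain ⟨M, hM⟩ := (isCompact_Icc (a := (0:ℝ)) (b := ℓ)).exists_bound_of_continuousOn hψ.continuousOn
  have hM0 : 0 ≤ M := (norm_nonneg _).trans (hM 0 ⟨le_rfl, hℓ.le⟩)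
  refine ⟨M * (c * Real.exp (k * (α / 2) * T)) * |ℓ - 0|, T, fun s hs => ?_⟩
  have hb : ∀ τ ∈ Set.uIoc (0:ℝ) ℓ, ‖ψ τ * MvPolynomial.eval (x (s + τ)) P‖ ≤
      M * (c * Real.exp (k * (α / 2) * T)) * Real.exp (-(k * (α / 2)) * s) := by
    intro τ hτ
    rw [uIoc_of_le hℓ.le] at hτ
    have h1 := hdec (s + τ) (by linarith [hτ.1])
    have h2 : ‖x (s + τ)‖ ≤ Real.exp (-(α / 2) * (s - T)) := by
      refine h1.trans ?_
      calc _ ≤ 1 * Real.exp (-(α / 2) * (s + τ - T)) := by gcongr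
        _ ≤ _ := by
          rw [one_mul]; apply Real.exp_le_exp.2
          nlinarith [mul_pos hα hτ.1]
    have h3 : ‖x (s + τ)‖ ≤ 1 := h2.trans (Real.exp_le_one_iff.2 (by nlinarith))
    have h4 := hev _ h3
    rw [norm_mul, mul_assoc M]
    refine mul_le_mul (hM τ ⟨hτ.1.le, hτ.2⟩) ?_ (norm_nonneg _) hM0
    rw [Real.norm_eq_abs, mul_assoc, ← Real.exp_add]
    refine h4.trans (mul_le_mul_of_nonneg_left ?_ hc)
    calc _ ≤ Real.exp (-(α / 2) * (s - T)) ^ k := by gcongr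
      _ = _ := by rw [← Real.exp_nat_mul]; congr 1; ring
  have := intervalIntegral.norm_integral_le_of_norm_le_const hb
  rw [Real.norm_eq_abs] at this
  refine this.trans (le_of_eq ?_)
  ring

open Classical in
theorem QSys.alt1 (h : QSys lam B α x) {ℓ : ℝ} (hℓ : 0 < ℓ) {ψ : ℝ → ℝ} (hψ : Continuous ψ) (N : ℝ) (K : ℕ)
    (hK : N ≤ K * (α / 2)) (j : ℕ) : ∀ k, k + j = K → ∀ P : MvPolynomial ι ℝ, P ∈ Mk (ι := ι) k →
      EvNZ (obs ℓ ψ x P) ∨ ON N (obs ℓ ψ x P) := by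
  induction j with
  | zero =>
    intro k hk P hP
    right
    intro N' hN'
    obtain ⟨C, S, hC⟩ := h.obs_decay hℓ hψ hP
    refine ⟨|C|, max S 0, fun s hs => (hC s ((le_max_left _ _).trans hs)).trans ?_⟩
    have hs0 : 0 ≤ s := (le_max_right _ _).trans hs
    refine mul_le_mul (le_abs_self C) (Real.exp_le_exp.2 ?_) (Real.exp_pos _).le (abs_nonneg _)
    have : k = K := by omega
    subst this
    nlinarith
  | succ j ih =>
    intro k hk
    have hA : ∀ S : Finset (ι →₀ ℕ), (∀ e ∈ S, e.degree = k) → ∀ P ∈ Ak (ι := ι) k S,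
        EvNZ (obs ℓ ψ x P) ∨ ON N (obs ℓ ψ x P) := by
      intro S
      induction S using Finset.induction_on with
      | empty =>
        intro _ P hP
        have : P ∈ Mk (ι := ι) (k + 1) := by simpa [Ak] using hP
        exact ih (k + 1) (by omega) P this
      | insert e S he ihS =>
        intro hS P hP
        have hS' : ∀ e ∈ S, e.degree = k := fun e' he' => hS e' (Finset.mem_insert_of_mem he')
        have h1 := Ak_insert lam B hS' (hS e (Finset.mem_insert_self _ _)) hP
        have hd : ∀ s, HasDerivAt (obs ℓ ψ x P) (obs ℓ ψ x (dlt lam B P + ldot lam e • P) s -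
            ldot lam e * obs ℓ ψ x P s) s := by
          intro s
          rw [h.obs_lin hψ]
          simpa using h.obsd hψ P s
        rcases ihS hS' _ h1 with h2 | h2
        · exact Or.inl (step_nz hd (h.obsc hψ _) h2)
        · exact step_dec hd h2
    intro P hP
    refine hA _ (fun e he => ?_) P (Mk_le_Ak k hP)
    rw [Finset.mem_finsuppAntidiag] at he
    rw [Finsupp.degree_eq_sum]; exact he.1

theorem QSys.alt (h : QSys lam B α x) {ℓ : ℝ} (hℓ : 0 < ℓ) {ψ : ℝ → ℝ} (hψ : Continuous ψ)
    (P : MvPolynomial ι ℝ) : EvNZ (obs ℓ ψ x P) ∨ ∃ S, ∀ s, S ≤ s → obs ℓ ψ x P s = 0 := by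
  by_cases hnz : EvNZ (obs ℓ ψ x P)
  · exact Or.inl hnz
  right
  refine h.superdecay hℓ hψ P fun n => ?_
  have hα := h.hα
  obtain ⟨K, hK⟩ := exists_nat_ge (((n : ℝ) + 1) / (α / 2))
  rw [div_le_iff₀ (by positivity)] at hK
  rcases h.alt1 hℓ hψ ((n : ℝ) + 1) K hK K 0 (by omega) P (Mk_zero P) with h1 | h1
  · exact absurd h1 hnz
  · exact h1 n (by linarith)

end alt

theorem qa_step {g : ℕ → ℝ → ℝ} (hg : ∀ n r, HasDerivAt (g n) (g (n+1) r) r) {r0 T C K : ℝ}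
    (hC : 0 ≤ C) (hK : 0 < K)
    (hb : ∀ n r, r0 ≤ r → r ≤ T → |g n r| ≤ C * n.factorial * K ^ n) (h0 : ∀ n, g n r0 = 0) :
    ∀ n r, r0 ≤ r → r ≤ T → r - r0 ≤ 1 / (4 * K) → g n r = 0 := by
  have key : ∀ j n r, r0 ≤ r → r ≤ T →
      |g n r| ≤ C * ((n + j).factorial / j.factorial) * K ^ (n + j) * (r - r0) ^ j := by
    intro j
    induction j with
    | zero => intro n r h1 h2; simpa using hb n r h1 h2
    | succ j ih =>
      intro n r h1 h2
      set D : ℝ := C * ((n + 1 + j).factorial / j.factorial) * K ^ (n + 1 + j) with hD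
      have := image_norm_le_of_norm_deriv_right_le_deriv_boundary (f := g n) (f' := g (n+1)) (a := r0) (b := r)
        (B := fun s => D * ((s - r0) ^ (j + 1) / (j + 1))) (B' := fun s => D * (s - r0) ^ j)
        (fun s _ => (hg n s).continuousAt.continuousWithinAt) (fun s _ => (hg n s).hasDerivWithinAt)
        (by simp [h0]) (fun s => by
          have e : HasDerivAt (fun s : ℝ => s - r0) 1 s := (hasDerivAt_id s).sub_const r0
          have := ((e.fun_pow (j+1)).div_const ((j:ℝ) + 1)).const_mul D
          refine this.congr_deriv ?_
          have : (j:ℝ) + 1 ≠ 0 := by positivity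
          push_cast
          field_simp
          try simp) (fun s hs => by
          rw [Real.norm_eq_abs]; exact ih (n+1) s hs.1 (hs.2.le.trans h2)) (right_mem_Icc.2 h1)
      rw [Real.norm_eq_abs] at this
      refine this.trans (le_of_eq ?_)
      rw [hD, Nat.factorial_succ j, show n + 1 + j = n + (j + 1) by ring]
      have : (j:ℝ) + 1 ≠ 0 := by positivity
      have : (j.factorial:ℝ) ≠ 0 := by positivity
      push_cast
      field_simp
  intro n r h1 h2 h3
  have hr : 0 ≤ r - r0 := by linarith
  have hKr : K * (r - r0) ≤ 1 / 4 := by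
    calc K * (r - r0) ≤ K * (1 / (4 * K)) := by gcongr
      _ = 1/4 := by field_simp
  have hlim : Tendsto (fun j : ℕ => C * n.factorial * K ^ n * 2 ^ n * (1/2:ℝ) ^ j) atTop (𝓝 0) := by
    simpa using (tendsto_pow_atTop_nhds_zero_of_lt_one (r := (1/2:ℝ)) (by norm_num) (by norm_num)).const_mul
      (C * n.factorial * K ^ n * 2 ^ n)
  have : |g n r| ≤ 0 := by
    refine ge_of_tendsto hlim (Eventually.of_forall fun j => ?_)
    refine (key j n r h1 h2).trans ?_
    have e1 : ((n + j).factorial / j.factorial : ℝ) ≤ n.factorial * 2 ^ (n + j) := by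
      rw [div_le_iff₀ (by positivity)]
      have a1 := Nat.add_choose_mul_factorial_mul_factorial n j
      have a2 : (n + j).choose j ≤ 2 ^ (n + j) := Nat.choose_le_two_pow _ _
      have : (n + j).factorial ≤ n.factorial * 2 ^ (n+j) * j.factorial := by
        rw [← a1]
        calc _ ≤ 2 ^ (n+j) * n.factorial * j.factorial := by gcongr
          _ = _ := by ring
      exact_mod_cast this
    calc C * ((n + j).factorial / j.factorial) * K ^ (n + j) * (r - r0) ^ j
        ≤ C * (n.factorial * 2 ^ (n + j)) * K ^ (n + j) * (r - r0) ^ j := by gcongr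
      _ = C * n.factorial * K ^ n * 2 ^ n * (2 * (K * (r - r0))) ^ j := by rw [mul_pow, mul_pow]; ring
      _ ≤ C * n.factorial * K ^ n * 2 ^ n * (1/2:ℝ) ^ j := by
        gcongr
        linarith
  exact abs_nonpos_iff.1 this

theorem qa_all {g : ℕ → ℝ → ℝ} (hg : ∀ n r, HasDerivAt (g n) (g (n+1) r) r) {T C K : ℝ}
    (hC : 0 ≤ C) (hK : 0 < K)
    (hb : ∀ n r, 0 ≤ r → r ≤ T → |g n r| ≤ C * n.factorial * K ^ n) (h0 : ∀ n, g n 0 = 0) :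
    ∀ n r, 0 ≤ r → r ≤ T → g n r = 0 := by
  have hδ : 0 < 1 / (4 * K) := by positivity
  have key : ∀ k : ℕ, ∀ n r, 0 ≤ r → r ≤ T → r ≤ k * (1 / (4 * K)) → g n r = 0 := by
    intro k
    induction k with
    | zero => intro n r h1 h2 h3; have : r = 0 := by push_cast at h3; linarith
              rw [this]; exact h0 n
    | succ k ih =>
      intro n r h1 h2 h3
      by_cases h4 : r ≤ k * (1 / (4*K))
      · exact ih n r h1 h2 h4
      · push Not at h4
        have hk : (0:ℝ) ≤ k * (1 / (4*K)) := by positivity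
        refine qa_step hg (r0 := k * (1 / (4*K))) (T := T) hC hK (fun n s hs => hb n s (hk.trans hs))
          (fun m => ih m _ hk (by linarith) le_rfl) n r h4.le h2 ?_
        push_cast at h3; linarith
  intro n r h1 h2
  obtain ⟨k, hk⟩ := exists_nat_ge (r / (1 / (4*K)))
  exact key k n r h1 h2 ((div_le_iff₀ hδ).1 hk)

section pb
variable {ι : Type*} [Fintype ι]

inductive PB : ℕ → ℝ → MvPolynomial ι ℝ → Prop
  | const (c : ℝ) : PB 0 |c| (MvPolynomial.C c)
  | mulX {m a P} (i : ι) : PB m a P → PB (m+1) a (P * MvPolynomial.X i)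
  | add {m a b P R} : PB m a P → PB m b R → PB m (a+b) (P + R)
  | smul {m a P} (c : ℝ) : PB m a P → PB m (|c| * a) (c • P)
  | up {m m' a a' P} : PB m a P → m ≤ m' → a ≤ a' → PB m' a' P

theorem PB.nonneg {m : ℕ} {a : ℝ} {P : MvPolynomial ι ℝ} (h : PB m a P) : 0 ≤ a := by
  induction h with
  | const c => exact abs_nonneg c
  | mulX i _ ih => exact ih
  | add _ _ h1 h2 => positivity
  | smul c _ h => positivity
  | up _ _ h2 h3 => linarith

theorem PB.eval {m : ℕ} {a : ℝ} {P : MvPolynomial ι ℝ} (h : PB m a P) {x : ι → ℝ} {R : ℝ} (hR : 1 ≤ R)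
    (hx : ‖x‖ ≤ R) : |MvPolynomial.eval x P| ≤ a * R ^ m := by
  induction h with
  | const c => simp
  | mulX i h ih =>
    have : |x i| ≤ R := (norm_le_pi_norm x i).trans hx
    have h0 := h.nonneg
    rw [map_mul, MvPolynomial.eval_X, abs_mul, pow_succ, ← mul_assoc]
    gcongr
  | add _ _ h1 h2 => rw [map_add, add_mul]; exact (abs_add_le _ _).trans (add_le_add h1 h2)
  | smul c _ h => rw [MvPolynomial.smul_eval, abs_mul, mul_assoc]; gcongr
  | up h h1 h2 ih =>
    have := h.nonneg
    refine ih.trans ?_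
    have := this.trans h2
    gcongr

theorem PB.sum {m : ℕ} {κ : Type*} (s : Finset κ) {a : κ → ℝ} {P : κ → MvPolynomial ι ℝ}
    (h : ∀ k ∈ s, PB m (a k) (P k)) : PB m (∑ k ∈ s, a k) (∑ k ∈ s, P k) := by
  classical
  induction s using Finset.induction_on with
  | empty => simpa using (PB.const (ι := ι) 0).up (Nat.zero_le m) (by simp : |(0:ℝ)| ≤ 0)
  | insert k s hk ih =>
    rw [Finset.sum_insert hk, Finset.sum_insert hk]
    exact (h k (by simp)).add (ih fun j hj => h j (by simp [hj]))

theorem PB.exists (P : MvPolynomial ι ℝ) : ∃ m a, PB m a P := by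
  induction P using MvPolynomial.induction_on with
  | C c => exact ⟨_, _, PB.const c⟩
  | add p q hp hq =>
    obtain ⟨m, a, h⟩ := hp
    obtain ⟨m', a', h'⟩ := hq
    exact ⟨max m m', a + a', (h.up (le_max_left _ _) le_rfl).add (h'.up (le_max_right _ _) le_rfl)⟩
  | mul_X p i hp =>
    obtain ⟨m, a, h⟩ := hp
    exact ⟨_, _, h.mulX i⟩

def dK (lam : ι → ℝ) (B : ι → ι → ι → ℝ) : ℝ := ∑ i, (|lam i| + ∑ j, ∑ k, |B i j k|)

theorem PB.dlt (lam : ι → ℝ) (B : ι → ι → ι → ℝ) {m : ℕ} {a : ℝ} {P : MvPolynomial ι ℝ} (h : PB m a P) :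
    PB (m+1) (m * dK lam B * a) (dlt lam B P) := by
  have hK : 0 ≤ dK lam B := by unfold dK; positivity
  induction h with
  | const c =>
    have : WaveBlowup.dlt lam B (MvPolynomial.C c) = MvPolynomial.C 0 := by simp [WaveBlowup.dlt]
    rw [this]
    exact (PB.const (ι := ι) 0).up (Nat.zero_le _) (by simp)
  | @mulX m a P i h ih =>
    rw [Derivation.leibniz]
    have e1 : WaveBlowup.dlt lam B (MvPolynomial.X i) =
      (-lam i) • (MvPolynomial.X i : MvPolynomial ι ℝ) + ∑ j, ∑ k, B i j k • (MvPolynomial.X j * MvPolynomial.X k) := by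
      simp [WaveBlowup.dlt, MvPolynomial.mkDerivation_X]
    have e2 : P • WaveBlowup.dlt lam B (MvPolynomial.X i) =
      (-lam i) • (P * MvPolynomial.X i) + ∑ j, ∑ k, B i j k • (P * MvPolynomial.X j * MvPolynomial.X k) := by
      rw [e1, smul_eq_mul, mul_add, Finset.mul_sum]
      simp only [Finset.mul_sum, mul_smul_comm, mul_assoc]
    have h2 : PB (m+2) (|lam i| * a + ∑ j, ∑ k, |B i j k| * a) (P • WaveBlowup.dlt lam B (MvPolynomial.X i)) := by
      rw [e2]
      refine PB.add ?_ (PB.sum _ fun j _ => PB.sum _ fun k _ => ((h.mulX j).mulX k).smul _)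
      have := (h.mulX i).smul (-lam i)
      rw [abs_neg] at this
      exact this.up (by omega) le_rfl
    have h3 := h2.add (ih.mulX i)
    rw [show (MvPolynomial.X i : MvPolynomial ι ℝ) • WaveBlowup.dlt lam B P = WaveBlowup.dlt lam B P * MvPolynomial.X i by
      rw [smul_eq_mul, mul_comm]]
    refine h3.up (by omega) ?_
    have h4 : |lam i| + ∑ j, ∑ k, |B i j k| ≤ dK lam B :=
      Finset.single_le_sum (f := fun i => |lam i| + ∑ j, ∑ k, |B i j k|) (fun _ _ => by positivity) (Finset.mem_univ i)
    have h5 := mul_le_mul_of_nonneg_right h4 h.nonneg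
    simp only [← Finset.sum_mul]
    push_cast
    nlinarith
  | add _ _ h1 h2 => rw [map_add]; exact (h1.add h2).up le_rfl (by rw [mul_add])
  | smul c _ h => rw [Derivation.map_smul]; exact (h.smul c).up le_rfl (le_of_eq (by ring))
  | up h h1 h2 ih =>
    have := h.nonneg
    refine ih.up (by omega) ?_
    gcongr

theorem PB.iter (lam : ι → ℝ) (B : ι → ι → ι → ℝ) {m : ℕ} {a : ℝ} {P : MvPolynomial ι ℝ} (h : PB (m+1) a P) (n : ℕ) :
    PB (m+1+n) ((m+1).ascFactorial n * dK lam B ^ n * a) ((WaveBlowup.dlt lam B)^[n] P) := by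
  induction n with
  | zero => simpa using h
  | succ n ih =>
    rw [Function.iterate_succ_apply']
    refine (ih.dlt lam B).up (by omega) (le_of_eq ?_)
    rw [Nat.ascFactorial_succ]
    push_cast; ring

theorem QSys.main {lam : ι → ℝ} {B : ι → ι → ι → ℝ} {α : ℝ} {x : ℝ → ι → ℝ}
    (h : QSys lam B α x) {ℓ : ℝ} (hℓ : 0 < ℓ) {ψ : ℝ → ℝ} (hψ : Continuous ψ)
    (P : MvPolynomial ι ℝ) : EvNZ (obs ℓ ψ x P) ∨ ∀ s, obs ℓ ψ x P s = 0 := by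
  rcases h.alt hℓ hψ P with h1 | ⟨S, hS⟩
  · exact Or.inl h1
  right
  intro s1
  by_cases hs1 : S + 1 ≤ s1
  · exact hS s1 (by linarith)
  push Not at hs1
  set S' := S + 1
  set φ : ℕ → ℝ → ℝ := fun n => obs ℓ ψ x ((dlt lam B)^[n] P) with hφ
  have hd : ∀ n s, HasDerivAt (φ n) (φ (n+1) s) s := by
    intro n s
    have := h.obsd (ℓ := ℓ) hψ ((dlt lam B)^[n] P) s
    simp only [hφ, Function.iterate_succ_apply']
    exact this
  have hz : ∀ n s, S < s → φ n s = 0 := by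
    intro n
    induction n with
    | zero => intro s hs; exact hS s hs.le
    | succ n ih =>
      intro s hs
      have : φ n =ᶠ[𝓝 s] fun _ => 0 := by
        filter_upwards [lt_mem_nhds hs] with t ht using ih t ht
      exact (hd n s).unique ((hasDerivAt_const s (0:ℝ)).congr_of_eventuallyEq this)
  obtain ⟨m, a, hP⟩ := PB.exists P
  have hP1 := hP.up (Nat.le_succ m) le_rfl
  obtain ⟨R0, hR0⟩ := (isCompact_Icc (a := s1) (b := S' + ℓ)).exists_bound_of_continuousOn h.contx.continuousOn
  obtain ⟨Mψ, hMψ⟩ := (isCompact_Icc (a := (0:ℝ)) (b := ℓ)).exists_bound_of_continuousOn hψ.continuousOn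
  set R := max R0 1
  have hR : 1 ≤ R := le_max_right _ _
  have ha := hP.nonneg
  have hKn : 0 ≤ dK lam B := by unfold dK; positivity
  set K : ℝ := 2 * (dK lam B + 1) * R with hK
  have hMψ0 : 0 ≤ Mψ := (norm_nonneg _).trans (hMψ 0 ⟨le_rfl, hℓ.le⟩)
  have hbd : ∀ n s, s1 ≤ s → s ≤ S' → |φ n s| ≤ (Mψ * (a * R ^ (m+1) * 2 ^ m) * ℓ) * n.factorial * K ^ n := by
    intro n s h1 h2
    have e1 : ∀ τ ∈ uIoc (0:ℝ) ℓ, ‖ψ τ * MvPolynomial.eval (x (s + τ)) ((dlt lam B)^[n] P)‖ ≤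
        Mψ * (a * R ^ (m+1) * 2 ^ m * n.factorial * K ^ n) := by
      intro τ hτ
      rw [uIoc_of_le hℓ.le] at hτ
      rw [norm_mul]
      refine mul_le_mul (hMψ τ ⟨hτ.1.le, hτ.2⟩) ?_ (norm_nonneg _) hMψ0
      rw [Real.norm_eq_abs]
      refine ((hP1.iter lam B n).eval hR ((hR0 (s + τ) ⟨by linarith [hτ.1], by linarith [hτ.2]⟩).trans
        (le_max_left _ _))).trans ?_
      have e2 : ((m+1).ascFactorial n : ℝ) ≤ n.factorial * 2 ^ (m + n) := by
        rw [Nat.ascFactorial_eq_factorial_mul_choose]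
        exact_mod_cast Nat.mul_le_mul_left _ (Nat.choose_le_two_pow _ _)
      calc _ ≤ (n.factorial * 2 ^ (m + n)) * (dK lam B + 1) ^ n * a * R ^ (m + 1 + n) := by
            gcongr
            linarith
        _ = _ := by rw [hK, mul_pow, mul_pow]; ring
    have := intervalIntegral.norm_integral_le_of_norm_le_const e1
    rw [Real.norm_eq_abs, sub_zero, abs_of_pos hℓ] at this
    refine this.trans (le_of_eq ?_)
    ring
  have := qa_all (g := fun n r => (-1) ^ n * φ n (S' - r)) (T := S' - s1)
    (C := Mψ * (a * R ^ (m+1) * 2 ^ m) * ℓ) (K := K) (fun n r => by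
      have e := ((hd n (S' - r)).comp_const_sub S' r).const_mul ((-1:ℝ) ^ n)
      refine e.congr_deriv ?_
      ring) (by positivity) (by positivity)
    (fun n r h1 h2 => by
      simp only [abs_mul, abs_pow, abs_neg, abs_one, one_pow, one_mul]
      exact hbd n _ (by linarith) (by linarith))
    (fun n => by simp only [sub_zero]; rw [hz n S' (by simp [S'])]; simp) 0 (S' - s1) (by linarith) le_rfl
  simpa [hφ] using this
end pb

structure PC (d : ℕ) (p θ a b α β : ℝ) : Prop where
  hp : 1 < p
  hθ : 0 < θ
  hθp : θ * (p - 1) = 2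
  ha : a = θ * ((d:ℝ) - 2 - θ)
  ha0 : 0 < a
  hb : b = (d:ℝ) - 2 - 2 * θ
  hb0 : 0 < b
  hα : 0 < α
  hαβ : α < β
  hsum : α + β = b
  hprod : α * β = (p - 1) * a
  hgam : gam d p = α + θ
  hd : (11:ℝ) ≤ d
  hθd : 2 / (p - 1) = θ

theorem PC.mk' (d : ℕ) (hd : 11 ≤ d) (p : ℝ) (hp1 : 1 < p) (hp : pJL d < p) :
    ∃ θ a b α β, PC d p θ a b α β := by
  have hd' : (11:ℝ) ≤ d := by exact_mod_cast hd
  set s := Real.sqrt ((d:ℝ) - 1) with hs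
  have hs2 : s ^ 2 = (d:ℝ) - 1 := Real.sq_sqrt (by linarith)
  have hs3 : 3 < s := by
    rw [hs]; apply Real.lt_sqrt_of_sq_lt; linarith
  set θ := 2 / (p - 1) with hθ
  have hp0 : 0 < p - 1 := by linarith
  have hθ0 : 0 < θ := by positivity
  have hθp : θ * (p - 1) = 2 := by rw [hθ]; field_simp
  have hden : 0 < (d:ℝ) - 4 - 2 * s := by nlinarith
  have hlt : θ < ((d:ℝ) - 4 - 2 * s) / 2 := by
    have h1 : 4 / ((d:ℝ) - 4 - 2 * s) < p - 1 := by
      have := hp; unfold pJL at this; linarith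
    rw [div_lt_iff₀ hden] at h1
    rw [hθ, div_lt_div_iff₀ hp0 two_pos]
    linarith
  have hD : 0 < (d:ℝ) - 2 - θ := by linarith
  have hcin : cInfty d p ^ (p - 1) = θ * ((d:ℝ) - 2 - θ) := by
    unfold cInfty
    rw [← Real.rpow_mul (by positivity), one_div, inv_mul_cancel₀ hp0.ne', Real.rpow_one]
  have hpa : p * (θ * ((d:ℝ) - 2 - θ)) = (θ + 2) * ((d:ℝ) - 2 - θ) := by
    have : p * θ = θ + 2 := by linarith
    rw [← mul_assoc, this]
  have hdis : discr d p = 4 * (((d:ℝ) - 4) / 2 - s - θ) * (((d:ℝ) - 4) / 2 + s - θ) := by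
    unfold discr
    rw [hcin, mul_assoc, hpa]
    nlinarith
  have hdis0 : 0 < discr d p := by
    rw [hdis]
    apply _root_.mul_pos <;> linarith
  set r := Real.sqrt (discr d p) with hr
  have hr0 : 0 < r := Real.sqrt_pos.2 hdis0
  have hr2 : r ^ 2 = discr d p := Real.sq_sqrt hdis0.le
  have hr3 : r ^ 2 = ((d:ℝ) - 2 - 2 * θ) ^ 2 - 8 * ((d:ℝ) - 2 - θ) := by
    rw [hr2]; unfold discr; rw [hcin, mul_assoc, hpa]; ring
  have hb0 : 0 < (d:ℝ) - 2 - 2 * θ := by linarith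
  have hrb : r < (d:ℝ) - 2 - 2 * θ := by
    apply lt_of_pow_lt_pow_left₀ 2 hb0.le
    rw [hr3]; linarith
  refine ⟨θ, θ * ((d:ℝ) - 2 - θ), (d:ℝ) - 2 - 2 * θ, ((d:ℝ) - 2 - 2 * θ - r) / 2, ((d:ℝ) - 2 - 2 * θ + r) / 2,
    hp1, hθ0, hθp, rfl, by positivity, rfl, hb0, by linarith, by linarith, by ring, ?_, ?_, hd', rfl⟩
  · have : (p - 1) * (θ * ((d:ℝ) - 2 - θ)) = 2 * ((d:ℝ) - 2 - θ) := by rw [← mul_assoc, mul_comm (p-1), hθp]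
    rw [this]
    nlinarith
  · unfold gam; rw [← hr]; ring

/-- comparison -/
theorem cmp_small {g g' f : ℝ → ℝ} {b : ℝ} (hb : 0 < b) (hg : ∀ t, HasDerivAt g (g' t) t)
    (hle : ∀ᶠ t in atTop, g' t ≤ -b * g t + f t) (hf : Tendsto f atTop (𝓝 0)) {ε : ℝ} (hε : 0 < ε) :
    ∀ᶠ t in atTop, g t ≤ ε := by
  have h1 : ∀ᶠ t in atTop, f t ≤ b * ε / 2 := (hf.eventually (ge_mem_nhds (by positivity)))
  obtain ⟨T, hT⟩ := eventually_atTop.1 (hle.and h1)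
  set k : ℝ → ℝ := fun t => (g t - ε / 2) * Real.exp (b * t) with hk
  have hkd : ∀ t, HasDerivAt k ((g' t + b * (g t - ε / 2)) * Real.exp (b * t)) t := by
    intro t
    have e1 : HasDerivAt (fun t => Real.exp (b * t)) (Real.exp (b * t) * b) t := by
      have : HasDerivAt (fun t : ℝ => b * t) b t := by simpa using (hasDerivAt_id t).const_mul b
      exact this.exp
    refine (((hg t).sub_const (ε/2)).mul e1).congr_deriv ?_
    ring
  have hanti : AntitoneOn k (Ici T) := by
    refine antitoneOn_of_deriv_nonpos (convex_Ici T) (fun t _ => (hkd t).continuousAt.continuousWithinAt)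
      (fun t _ => (hkd t).differentiableAt.differentiableWithinAt) fun t ht => ?_
    rw [interior_Ici] at ht
    rw [(hkd t).deriv]
    obtain ⟨h2, h3⟩ := hT t (le_of_lt ht)
    apply mul_nonpos_of_nonpos_of_nonneg _ (Real.exp_pos _).le
    nlinarith
  have hlim : Tendsto (fun t => |k T| * Real.exp (-(b * t))) atTop (𝓝 0) := by
    have : Tendsto (fun t : ℝ => Real.exp (-(b * t))) atTop (𝓝 0) :=
      Real.tendsto_exp_neg_atTop_nhds_zero.comp (tendsto_id.const_mul_atTop hb)
    simpa using this.const_mul |k T|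
  filter_upwards [hlim.eventually (ge_mem_nhds (half_pos hε)), eventually_ge_atTop T] with t h4 h5
  have h6 : k t ≤ |k T| := (hanti self_mem_Ici h5 h5).trans (le_abs_self _)
  have h7 : (g t - ε/2) = k t * Real.exp (-(b*t)) := by
    rw [hk]; simp only; rw [mul_assoc, ← Real.exp_add]; simp
  have : k t * Real.exp (-(b*t)) ≤ |k T| * Real.exp (-(b*t)) := by gcongr
  linarith

theorem cmp_lim {g g' f : ℝ → ℝ} {b : ℝ} (hb : 0 < b) (hg : ∀ t, HasDerivAt g (g' t) t)
    (hle : ∀ t, g' t = -b * g t + f t) (hf : Tendsto f atTop (𝓝 0)) : Tendsto g atTop (𝓝 0) := by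
  rw [Metric.tendsto_nhds]
  intro ε hε
  have h1 := cmp_small hb hg (Eventually.of_forall fun t => (hle t).le) hf (half_pos hε)
  have h2 := cmp_small (g := fun t => -g t) (g' := fun t => -g' t) (f := fun t => -f t) hb (fun t => (hg t).neg)
    (Eventually.of_forall fun t => by rw [hle t]; linarith) (by simpa using hf.neg) (half_pos hε)
  filter_upwards [h1, h2] with t h3 h4
  rw [Real.dist_eq, sub_zero, abs_lt]
  constructor <;> linarith

/-- the autonomous dynamics in Emden-Fowler variables -/
structure Dyn (p a b θ : ℝ) (w v : ℝ → ℝ) : Prop where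
  hw : ∀ t, HasDerivAt w (v t) t
  hv : ∀ t, HasDerivAt v (-b * v t + a * w t - w t ^ p) t
  wpos : ∀ t, 0 < w t
  vpos : ∀ t, 0 < v t
  w0 : Tendsto w atBot (𝓝 0)
  v0 : Tendsto v atBot (𝓝 0)
  q0 : Tendsto (fun t => (-b * v t + a * w t - w t ^ p) / v t) atBot (𝓝 θ)

section dyn
variable {d : ℕ} {p θ a b α β : ℝ} {w v : ℝ → ℝ}

theorem Dyn.energy (C : PC d p θ a b α β) (D : Dyn p a b θ w v) (t : ℝ) :
    v t ^ 2 / 2 - a * w t ^ 2 / 2 + w t ^ (p + 1) / (p + 1) ≤ 0 := by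
  have hp := C.hp
  set E : ℝ → ℝ := fun t => v t ^ 2 / 2 - a * w t ^ 2 / 2 + w t ^ (p + 1) / (p + 1) with hE
  have hEd : ∀ t, HasDerivAt E (-b * v t ^ 2) t := by
    intro t
    have e3 := ((D.hw t).rpow_const (p := p + 1) (Or.inl (D.wpos t).ne')).div_const (p + 1)
    refine (((((D.hv t).fun_pow 2).div_const 2).sub ((((D.hw t).fun_pow 2).const_mul a).div_const 2)).add e3).congr_deriv ?_
    have : p + 1 ≠ 0 := by linarith
    rw [add_sub_cancel_right]
    field_simp
    push_cast
    ring
  have hanti : Antitone E := antitone_of_deriv_nonpos (fun t => (hEd t).differentiableAt) fun t => by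
    rw [(hEd t).deriv]; nlinarith [sq_nonneg (v t), C.hb0]
  have hlim : Tendsto E atBot (𝓝 0) := by
    have e := (((D.v0.pow 2).div_const 2).sub (((D.w0.pow 2).const_mul a).div_const 2)).add
      ((D.w0.rpow_const (p := p + 1) (Or.inr (by linarith))).div_const (p + 1))
    have h0 : (0:ℝ) ^ (p + 1) = 0 := Real.zero_rpow (by linarith)
    simpa [h0] using e
  exact ge_of_tendsto hlim (by filter_upwards [eventually_le_atBot t] with s hs using hanti hs)

theorem Dyn.wp (D : Dyn p a b θ w v) (t : ℝ) : w t ^ p = w t * w t ^ (p - 1) := by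
  rw [Real.rpow_sub_one (D.wpos t).ne']
  field_simp [(D.wpos t).ne']

theorem Dyn.mono (D : Dyn p a b θ w v) : StrictMono w :=
  strictMono_of_deriv_pos fun t => by rw [(D.hw t).deriv]; exact D.vpos t

theorem Dyn.mbdd (C : PC d p θ a b α β) (D : Dyn p a b θ w v) (t : ℝ) : w t ^ (p - 1) ≤ a * (p + 1) / 2 := by
  have h := D.energy C t
  have hp := C.hp
  have e : w t ^ (p + 1) = w t ^ 2 * w t ^ (p - 1) := by
    rw [show p + 1 = 2 + (p - 1) by ring, Real.rpow_add (D.wpos t)]; norm_num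
  rw [e] at h
  have h2 : w t ^ 2 * (w t ^ (p - 1) / (p + 1) - a / 2) ≤ 0 := by
    have : 0 ≤ v t ^ 2 / 2 := by positivity
    have e2 : w t ^ 2 * (w t ^ (p - 1) / (p + 1) - a / 2) = w t ^ 2 * w t ^ (p - 1) / (p + 1) - a * w t ^ 2 / 2 := by ring
    linarith
  have h3 : 0 < w t ^ 2 := pow_pos (D.wpos t) 2
  have h4 : w t ^ (p - 1) / (p + 1) - a / 2 ≤ 0 := by
    by_contra hc; push Not at hc; nlinarith
  have h5 : w t ^ (p - 1) / (p + 1) ≤ a / 2 := by linarith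
  rw [div_le_iff₀ (by linarith)] at h5
  linarith

theorem Dyn.limits (C : PC d p θ a b α β) (D : Dyn p a b θ w v) :
    ∃ l, 0 < l ∧ l ^ (p - 1) = a ∧ Tendsto w atTop (𝓝 l) ∧ Tendsto v atTop (𝓝 0) ∧ ∀ t, w t ^ (p - 1) < a := by
  have hp0 : 0 < p - 1 := by linarith [C.hp]
  have hbd : ∀ t, w t ≤ (a * (p + 1) / 2) ^ (1 / (p - 1)) := by
    intro t
    have := Real.rpow_le_rpow (Real.rpow_nonneg (D.wpos t).le _) (D.mbdd C t) (by positivity : 0 ≤ 1 / (p - 1))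
    rwa [← Real.rpow_mul (D.wpos t).le, mul_one_div_cancel hp0.ne', Real.rpow_one] at this
  obtain ⟨l, hl⟩ : ∃ l, Tendsto w atTop (𝓝 l) :=
    ⟨_, tendsto_atTop_ciSup D.mono.monotone ⟨_, by rintro _ ⟨t, rfl⟩; exact hbd t⟩⟩
  have hlt : ∀ t, w t < l := fun t => (D.mono (lt_add_one t)).trans_le (D.mono.monotone.ge_of_tendsto hl _)
  have hl0 : 0 < l := (D.wpos 0).trans (hlt 0)
  have hm : Tendsto (fun t => w t ^ p) atTop (𝓝 (l ^ p)) := hl.rpow_const (Or.inl hl0.ne')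
  set c := (a * l - l ^ p) / b with hc
  have hb := C.hb0
  have hvc : Tendsto (fun t => v t - c) atTop (𝓝 0) := by
    refine cmp_lim (g' := fun t => -b * v t + a * w t - w t ^ p) (f := fun t => (a * w t - w t ^ p) - (a * l - l ^ p)) hb
      (fun t => (D.hv t).sub_const c) (fun t => ?_) ?_
    · rw [hc]; field_simp; ring
    · have := ((hl.const_mul a).sub hm).sub_const (a * l - l ^ p)
      simpa using this
  have hvl : Tendsto v atTop (𝓝 c) := by simpa using hvc.add_const c
  have hc0 : c = 0 := by
    by_contra hne
    have hcn : 0 ≤ c := ge_of_tendsto hvl (Eventually.of_forall fun t => (D.vpos t).le)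
    have hcp : 0 < c := lt_of_le_of_ne hcn (Ne.symm hne)
    obtain ⟨T, hT⟩ := eventually_atTop.1 (hvl.eventually (le_mem_nhds (half_lt_self hcp)))
    have hmono : MonotoneOn (fun t => w t - c / 2 * t) (Ici T) := by
      have hdd : ∀ t, HasDerivAt (fun t => w t - c / 2 * t) (v t - c / 2) t := fun t => by
        refine ((D.hw t).fun_sub ((hasDerivAt_id' t).const_mul (c / 2))).congr_deriv ?_
        ring
      refine monotoneOn_of_deriv_nonneg (convex_Ici T) (fun t _ => (hdd t).continuousAt.continuousWithinAt)
        (fun t _ => (hdd t).differentiableAt.differentiableWithinAt) fun t ht => ?_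
      rw [interior_Ici] at ht
      rw [(hdd t).deriv]
      linarith [hT t (le_of_lt ht)]
    have hT2 : T ≤ T + 2 * l / c := le_add_of_nonneg_right (by positivity)
    have h1 := hmono (self_mem_Ici : T ∈ Ici T) hT2 hT2
    simp only at h1
    have h2 : c / 2 * (T + 2 * l / c) = c / 2 * T + l := by field_simp
    rw [h2] at h1
    linarith [hlt (T + 2 * l / c), D.wpos T]
  have hla : l ^ (p - 1) = a := by
    have h1 : a * l - l ^ p = 0 := by
      rw [hc, _root_.div_eq_zero_iff] at hc0
      exact hc0.resolve_right hb.ne'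
    rw [Real.rpow_sub_one hl0.ne']
    field_simp
    linarith
  refine ⟨l, hl0, hla, hl, hc0 ▸ hvl, fun t => ?_⟩
  rw [← hla]
  exact Real.rpow_lt_rpow (D.wpos t).le (hlt t) hp0

/-- minus the log-derivative of v -/
def qf (a b p : ℝ) (w v : ℝ → ℝ) (t : ℝ) : ℝ := b - (a * w t - w t ^ p) / v t

theorem Dyn.mder (D : Dyn p a b θ w v) (t : ℝ) :
    HasDerivAt (fun t => w t ^ (p - 1)) ((p - 1) * w t ^ (p - 1) * (v t / w t)) t := by
  refine ((D.hw t).rpow_const (p := p - 1) (Or.inl (D.wpos t).ne')).congr_deriv ?_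
  rw [Real.rpow_sub_one (D.wpos t).ne' (p - 1)]
  field_simp

theorem Dyn.nder (D : Dyn p a b θ w v) (t : ℝ) :
    HasDerivAt (fun t => w t * (w t ^ (p - 1) - a)) ((p - 1) * a * v t + p * (v t * (w t ^ (p - 1) - a))) t := by
  refine ((D.hw t).mul ((D.mder t).sub_const a)).congr_deriv ?_
  have := (D.wpos t).ne'
  field_simp
  ring

theorem Dyn.qder (C : PC d p θ a b α β) (D : Dyn p a b θ w v) (t : ℝ) :
    HasDerivAt (qf a b p w v) ((qf a b p w v t - α) * (qf a b p w v t - β) + p * (w t ^ (p - 1) - a)) t := by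
  have hv0 := (D.vpos t).ne'
  have e : qf a b p w v = fun t => b + w t * (w t ^ (p - 1) - a) / v t := by
    funext s; unfold qf; rw [D.wp s]; ring
  rw [e]
  refine (((D.nder t).div (D.hv t) hv0).const_add b).congr_deriv ?_
  rw [D.wp t]
  have e1 : ∀ z : ℝ, (b + z - α) * (b + z - β) = z * (b + z) + (p - 1) * a := by
    intro z; rw [← C.hprod, ← C.hsum]; ring
  simp only [e1]
  field_simp
  ring

theorem Dyn.qcont (C : PC d p θ a b α β) (D : Dyn p a b θ w v) : Continuous (qf a b p w v) :=
  continuous_iff_continuousAt.2 fun t => (D.qder C t).continuousAt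

theorem Dyn.qbot (D : Dyn p a b θ w v) : Tendsto (qf a b p w v) atBot (𝓝 (-θ)) := by
  refine D.q0.neg.congr fun t => ?_
  unfold qf
  have := (D.vpos t).ne'
  field_simp
  ring

theorem Dyn.qlt (C : PC d p θ a b α β) (D : Dyn p a b θ w v) (t : ℝ) : qf a b p w v t < α := by
  obtain ⟨l, hl0, hla, hl, hv, hma⟩ := D.limits C
  have h0 : ∀ᶠ s in atBot, qf a b p w v s < α :=
    D.qbot.eventually (gt_mem_nhds (by linarith [C.hθ, C.hα]))
  obtain ⟨s, hs, hst⟩ := (h0.and (eventually_le_atBot t)).exists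
  set q := qf a b p w v with hq
  have hqc : Continuous q := D.qcont C
  set G : ℝ → ℝ := fun t => ∫ r in s..t, (q r - β) with hG
  have hGd : ∀ t, HasDerivAt G (q t - β) t := fun t =>
    intervalIntegral.integral_hasDerivAt_right ((hqc.sub continuous_const).intervalIntegrable _ _)
      ((hqc.sub continuous_const).stronglyMeasurableAtFilter _ _) (hqc.sub continuous_const).continuousAt
  have hkd : ∀ t, HasDerivAt (fun t => (q t - α) * Real.exp (-G t)) (p * (w t ^ (p - 1) - a) * Real.exp (-G t)) t := by
    intro t
    refine (((D.qder C t).sub_const α).mul (hGd t).fun_neg.exp).congr_deriv ?_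
    rw [hq]
    ring
  have hanti : Antitone (fun t => (q t - α) * Real.exp (-G t)) :=
    antitone_of_deriv_nonpos (fun t => (hkd t).differentiableAt) fun t => by
      rw [(hkd t).deriv]
      apply mul_nonpos_of_nonpos_of_nonneg _ (Real.exp_pos _).le
      nlinarith [hma t, C.hp]
  have h1 := hanti hst
  simp only at h1
  have h2 : (q s - α) * Real.exp (-G s) < 0 := mul_neg_of_neg_of_pos (by linarith) (Real.exp_pos _)
  by_contra hc
  push Not at hc
  have : 0 ≤ (q t - α) * Real.exp (-G t) := mul_nonneg (by linarith) (Real.exp_pos _).le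
  linarith

theorem Dyn.qtop (C : PC d p θ a b α β) (D : Dyn p a b θ w v) : Tendsto (qf a b p w v) atTop (𝓝 α) := by
  obtain ⟨l, hl0, hla, hl, hv, hma⟩ := D.limits C
  set q := qf a b p w v with hq
  have hm : Tendsto (fun t => w t ^ (p - 1)) atTop (𝓝 a) := by
    rw [← hla]; exact hl.rpow_const (Or.inl hl0.ne')
  rw [Metric.tendsto_nhds]
  intro ε hε
  have := cmp_small (g := fun t => α - q t) (g' := fun t => -((q t - α) * (q t - β) + p * (w t ^ (p - 1) - a)))
    (f := fun t => -(p * (w t ^ (p - 1) - a))) (b := β - α) (by linarith [C.hαβ])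
    (fun t => (D.qder C t).const_sub α) (Eventually.of_forall fun t => by
      have := D.qlt C t
      nlinarith [sq_nonneg (q t - α)]) (by simpa using ((hm.sub_const a).const_mul p).neg) (half_pos hε)
  filter_upwards [this] with t ht
  have h2 := D.qlt C t
  rw [Real.dist_eq, abs_lt]
  constructor <;> linarith
end dyn

theorem bdd_of_limits {g : ℝ → ℝ} (hg : Continuous g) {l m : ℝ} (h1 : Tendsto g atBot (𝓝 l))
    (h2 : Tendsto g atTop (𝓝 m)) : ∃ C, ∀ t, |g t| ≤ C := by
  obtain ⟨A, hA⟩ := eventually_atBot.1 (h1.abs.eventually (ge_mem_nhds (lt_add_one |l|)))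
  obtain ⟨B, hB⟩ := eventually_atTop.1 (h2.abs.eventually (ge_mem_nhds (lt_add_one |m|)))
  obtain ⟨K, hK⟩ := (isCompact_Icc (a := A) (b := B)).exists_bound_of_continuousOn hg.continuousOn
  refine ⟨max (|l| + 1) (max (|m| + 1) K), fun t => ?_⟩
  rcases le_total t A with h | h
  · exact (hA t h).trans (le_max_left _ _)
  rcases le_total B t with h' | h'
  · exact (hB t h').trans ((le_max_left _ _).trans (le_max_right _ _))
  · exact (hK t ⟨h, h'⟩).trans ((le_max_right _ _).trans (le_max_right _ _))

section gs
variable {d : ℕ} {p θ a b α β : ℝ} {Q : ℝ → ℝ}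

theorem Qd (hQ : IsGroundState d p Q) (y : ℝ) : HasDerivAt Q (deriv Q y) y :=
  ((hQ.smooth.differentiable (by simp)) y).hasDerivAt

theorem Qsm' (hQ : IsGroundState d p Q) : ContDiff ℝ (⊤ : ℕ∞) (deriv Q) := by
  have := hQ.smooth
  exact ((contDiff_infty_iff_deriv (f := Q)).1 this).2

theorem Qdd (hQ : IsGroundState d p Q) (y : ℝ) : HasDerivAt (deriv Q) (deriv (deriv Q) y) y :=
  (((Qsm' hQ).differentiable (by simp)) y).hasDerivAt

theorem h_sm (hQ : IsGroundState d p Q) : ContDiff ℝ (⊤ : ℕ∞) (Lam1 p Q) := by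
  unfold Lam1
  exact (contDiff_const.mul hQ.smooth).add (contDiff_id.mul (Qsm' hQ))

theorem h_cont (hQ : IsGroundState d p Q) : Continuous (Lam1 p Q) := (h_sm hQ).continuous

theorem h_der (hQ : IsGroundState d p Q) (y : ℝ) : HasDerivAt (Lam1 p Q) (deriv (Lam1 p Q) y) y :=
  (((h_sm hQ).differentiable (by simp)) y).hasDerivAt

theorem h_sm' (hQ : IsGroundState d p Q) : ContDiff ℝ (⊤ : ℕ∞) (deriv (Lam1 p Q)) :=
  ((contDiff_infty_iff_deriv (f := Lam1 p Q)).1 (h_sm hQ)).2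

theorem h_der_eq (C : PC d p θ a b α β) (hQ : IsGroundState d p Q) {y : ℝ} (hy : 0 < y) :
    deriv (Lam1 p Q) y = (θ - ((d:ℝ) - 2)) * deriv Q y - y * Q y ^ p := by
  have h1 : HasDerivAt (Lam1 p Q) (2 / (p - 1) * deriv Q y + (1 * deriv Q y + y * deriv (deriv Q) y)) y :=
    ((Qd hQ y).const_mul _).fun_add ((hasDerivAt_id' y).fun_mul (Qdd hQ y))
  rw [h1.deriv, C.hθd]
  have := hQ.ode y hy
  have e : y * deriv (deriv Q) y = - ((d:ℝ) - 1) * deriv Q y - y * Q y ^ p := by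
    have e2 : deriv (deriv Q) y = -(((d : ℝ) - 1) / y * deriv Q y) - Q y ^ p := by linarith
    rw [e2]; field_simp
  rw [e]; ring

theorem h_dd (C : PC d p θ a b α β) (hQ : IsGroundState d p Q) {y : ℝ} (hy : 0 < y) :
    deriv (deriv (Lam1 p Q)) y + ((d : ℝ) - 1) / y * deriv (Lam1 p Q) y + p * Q y ^ (p - 1) * Lam1 p Q y = 0 := by
  have hq0 := hQ.pos y hy.le
  have h1 : HasDerivAt (deriv (Lam1 p Q)) ((θ - ((d:ℝ) - 2)) * deriv (deriv Q) y -
      (1 * Q y ^ p + y * (deriv Q y * p * Q y ^ (p - 1)))) y := by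
    have h2 : HasDerivAt (fun y => (θ - ((d:ℝ) - 2)) * deriv Q y - y * Q y ^ p) _ y :=
      ((Qdd hQ y).const_mul _).fun_sub ((hasDerivAt_id' y).fun_mul ((Qd hQ y).rpow_const (p := p) (Or.inl hq0.ne')))
    refine h2.congr_of_eventuallyEq ?_
    filter_upwards [lt_mem_nhds hy] with z hz using h_der_eq C hQ hz
  rw [h1.deriv, h_der_eq C hQ hy]
  have e2 : deriv (deriv Q) y = -(((d : ℝ) - 1) / y * deriv Q y) - Q y ^ p := by linarith [hQ.ode y hy]
  have e3 : Q y ^ p = Q y * Q y ^ (p - 1) := by rw [Real.rpow_sub_one hq0.ne']; field_simp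
  unfold Lam1
  rw [e2, C.hθd, e3]
  have e4 : p * θ = θ + 2 := by linarith [C.hθp]
  field_simp
  linear_combination (Q y * Q y ^ (p-1) * y) * e4

/-- Emden-Fowler variables -/
def efw (θ : ℝ) (Q : ℝ → ℝ) (t : ℝ) : ℝ := Real.exp (θ * t) * Q (Real.exp t)
def efv (p θ : ℝ) (Q : ℝ → ℝ) (t : ℝ) : ℝ := Real.exp (θ * t) * Lam1 p Q (Real.exp t)

theorem efw_pow (C : PC d p θ a b α β) (hQ : IsGroundState d p Q) (t : ℝ) :
    efw θ Q t ^ p = Real.exp (θ * t) * (Real.exp t ^ 2 * Q (Real.exp t) ^ p) := by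
  unfold efw
  have hq0 := hQ.pos _ (Real.exp_pos t).le
  rw [Real.mul_rpow (Real.exp_pos _).le hq0.le, ← Real.exp_mul, ← Real.exp_nat_mul, ← mul_assoc, ← Real.exp_add]
  congr 2
  push_cast
  linear_combination t * C.hθp

theorem exp_lin_der (θ t : ℝ) : HasDerivAt (fun t => Real.exp (θ * t)) (θ * Real.exp (θ * t)) t := by
  have : HasDerivAt (fun t : ℝ => θ * t) θ t := by simpa using (hasDerivAt_id t).const_mul θ
  exact this.exp.congr_deriv (mul_comm _ _)

theorem efv_der' (hQ : IsGroundState d p Q) (t : ℝ) :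
    HasDerivAt (efv p θ Q) (θ * efv p θ Q t + Real.exp (θ * t) * (Real.exp t * deriv (Lam1 p Q) (Real.exp t))) t := by
  have h1 := (h_der hQ (Real.exp t)).comp t (Real.hasDerivAt_exp t)
  refine ((exp_lin_der θ t).mul h1).congr_deriv ?_
  unfold efv; simp only [Function.comp]; ring

theorem efv_rhs (C : PC d p θ a b α β) (hQ : IsGroundState d p Q) (t : ℝ) :
    -b * efv p θ Q t + a * efw θ Q t - efw θ Q t ^ p =
      θ * efv p θ Q t + Real.exp (θ * t) * (Real.exp t * deriv (Lam1 p Q) (Real.exp t)) := by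
  rw [efw_pow C hQ, h_der_eq C hQ (Real.exp_pos t)]
  unfold efv efw Lam1
  rw [C.hθd, C.ha, C.hb]
  ring

theorem exp_bot : Tendsto Real.exp atBot (𝓝[>] 0) :=
  tendsto_nhdsWithin_iff.2 ⟨Real.tendsto_exp_atBot, Eventually.of_forall fun t => Real.exp_pos t⟩

theorem gs_dyn (C : PC d p θ a b α β) (hQ : IsGroundState d p Q) (hpos : ∀ y : ℝ, 0 ≤ y → 0 < Lam1 p Q y) :
    Dyn p a b θ (efw θ Q) (efv p θ Q) := by
  have hθt : Tendsto (fun t : ℝ => Real.exp (θ * t)) atBot (𝓝 0) :=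
    Real.tendsto_exp_atBot.comp (tendsto_id.const_mul_atBot C.hθ)
  refine ⟨fun t => ?_, fun t => ?_, fun t => ?_, fun t => ?_, ?_, ?_, ?_⟩
  · have h1 := (Qd hQ (Real.exp t)).comp t (Real.hasDerivAt_exp t)
    refine ((exp_lin_der θ t).mul h1).congr_deriv ?_
    unfold efv Lam1; rw [C.hθd]; simp only [Function.comp]; ring
  · rw [efv_rhs C hQ]; exact efv_der' hQ t
  · exact _root_.mul_pos (Real.exp_pos _) (hQ.pos _ (Real.exp_pos t).le)
  · exact _root_.mul_pos (Real.exp_pos _) (hpos _ (Real.exp_pos t).le)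
  · have h2 : Tendsto (fun t => Q (Real.exp t)) atBot (𝓝 (Q 0)) :=
      (hQ.smooth.continuous.tendsto 0).comp Real.tendsto_exp_atBot
    have h5 := hθt.mul h2
    rw [zero_mul] at h5
    exact h5
  · have h2 : Tendsto (fun t => Lam1 p Q (Real.exp t)) atBot (𝓝 (Lam1 p Q 0)) :=
      ((h_cont hQ).tendsto 0).comp Real.tendsto_exp_atBot
    have h5 := hθt.mul h2
    rw [zero_mul] at h5
    exact h5
  · have h2 : Tendsto (fun t => Lam1 p Q (Real.exp t)) atBot (𝓝 (Lam1 p Q 0)) :=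
      ((h_cont hQ).tendsto 0).comp Real.tendsto_exp_atBot
    have h3 : Tendsto (fun t => deriv (Lam1 p Q) (Real.exp t)) atBot (𝓝 (deriv (Lam1 p Q) 0)) :=
      ((h_sm' hQ).continuous.tendsto 0).comp Real.tendsto_exp_atBot
    have h4 := ((Real.tendsto_exp_atBot.mul h3).div h2 (hpos 0 le_rfl).ne').const_add θ
    simp only [zero_mul, zero_div, add_zero] at h4
    refine h4.congr fun t => ?_
    rw [efv_rhs C hQ]
    have := (hpos _ (Real.exp_pos t).le).ne'
    have := (Real.exp_pos (θ * t)).ne'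
    unfold efv
    simp only [Pi.div_apply]
    field_simp

theorem W_eq (hQ : IsGroundState d p Q) (hpos : ∀ y : ℝ, 0 ≤ y → 0 < Lam1 p Q y) {y : ℝ} (hy : 0 < y) :
    Wpot p Q y = deriv (Lam1 p Q) y / Lam1 p Q y := by
  unfold Wpot
  exact ((h_der hQ y).log (hpos y hy.le).ne').deriv

theorem yW_eq (C : PC d p θ a b α β) (hQ : IsGroundState d p Q) (hpos : ∀ y : ℝ, 0 ≤ y → 0 < Lam1 p Q y) {y : ℝ}
    (hy : 0 < y) : y * Wpot p Q y = -qf a b p (efw θ Q) (efv p θ Q) (Real.log y) - θ := by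
  rw [W_eq hQ hpos hy]
  have h1 := efv_rhs C hQ (Real.log y)
  have hv := ((gs_dyn C hQ hpos).vpos (Real.log y)).ne'
  have e : qf a b p (efw θ Q) (efv p θ Q) (Real.log y) =
      - ((-b * efv p θ Q (Real.log y) + a * efw θ Q (Real.log y) - efw θ Q (Real.log y) ^ p) / efv p θ Q (Real.log y)) := by
    unfold qf; field_simp; ring
  rw [e, h1]
  unfold efv
  rw [Real.exp_log hy]
  have := (hpos _ hy.le).ne'
  have := (Real.exp_pos (θ * Real.log y)).ne'
  field_simp
  ring

/-- summary of the facts on W -/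
theorem W_facts (C : PC d p θ a b α β) (hQ : IsGroundState d p Q) (hpos : ∀ y : ℝ, 0 ≤ y → 0 < Lam1 p Q y) :
    (∀ y, 0 < y → -(α + θ) ≤ y * Wpot p Q y) ∧ Tendsto (fun y => y * Wpot p Q y) atTop (𝓝 (-(α + θ))) ∧
    ∃ K, 0 < K ∧ ∀ y, 0 < y → |y * Wpot p Q y| ≤ K := by
  have D := gs_dyn C hQ hpos
  refine ⟨fun y hy => ?_, ?_, ?_⟩
  · rw [yW_eq C hQ hpos hy]; linarith [D.qlt C (Real.log y)]
  · have := (((D.qtop C).comp Real.tendsto_log_atTop).neg).sub_const θ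
    rw [show -(α + θ) = -α - θ by ring]
    refine this.congr' ?_
    filter_upwards [eventually_gt_atTop 0] with y hy
    rw [yW_eq C hQ hpos hy]; rfl
  · obtain ⟨K, hK⟩ := bdd_of_limits (D.qcont C) D.qbot (D.qtop C)
    have hK0 : 0 ≤ K := (abs_nonneg _).trans (hK 0)
    refine ⟨K + θ, by linarith [C.hθ], fun y hy => ?_⟩
    rw [yW_eq C hQ hpos hy]
    have := abs_le.1 (hK (Real.log y))
    have := C.hθ
    rw [abs_le]; constructor <;> linarith
end gs

section sys
variable {d : ℕ} {p θ a b α β : ℝ} {w v : ℝ → ℝ}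

def sLam (α β : ℝ) : Fin 4 → ℝ := ![β, α, β, α]
def sv (α β : ℝ) : Fin 4 → ℝ := ![1 / (β - α), -1 / (β - α), 0, 0]
def sr (α β : ℝ) : Fin 4 → ℝ := ![0, 0, 1 / (β - α), -1 / (β - α)]
def sm (α β : ℝ) : Fin 4 → ℝ := ![0, 0, -α / (β - α), β / (β - α)]
def sB (p α β : ℝ) (i j k : Fin 4) : ℝ :=
  (![p, p, 0, 0] : Fin 4 → ℝ) i * (sv α β j * sm α β k) + (![0, 0, -β, -α] : Fin 4 → ℝ) i * (sr α β j * sr α β k)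
    + (![0, 0, p - 1, p - 1] : Fin 4 → ℝ) i * (sm α β j * sr α β k)

theorem sB_sum (p α β : ℝ) (i : Fin 4) (x : Fin 4 → ℝ) :
    ∑ j, ∑ k, sB p α β i j k * (x j * x k) =
      (![p, p, 0, 0] : Fin 4 → ℝ) i * ((∑ j, sv α β j * x j) * (∑ k, sm α β k * x k)) +
      (![0, 0, -β, -α] : Fin 4 → ℝ) i * ((∑ j, sr α β j * x j) * (∑ k, sr α β k * x k)) +
      (![0, 0, p - 1, p - 1] : Fin 4 → ℝ) i * ((∑ j, sm α β j * x j) * (∑ k, sr α β k * x k)) := by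
  rw [Finset.sum_mul_sum, Finset.sum_mul_sum, Finset.sum_mul_sum]
  simp only [Finset.mul_sum, ← Finset.sum_add_distrib]
  refine Finset.sum_congr rfl fun j _ => Finset.sum_congr rfl fun k _ => ?_
  unfold sB; ring

def sx (p a α β : ℝ) (w v : ℝ → ℝ) (t : ℝ) : Fin 4 → ℝ :=
  ![β * v t + w t * (w t ^ (p - 1) - a), α * v t + w t * (w t ^ (p - 1) - a),
    β * (v t / w t) + (w t ^ (p - 1) - a), α * (v t / w t) + (w t ^ (p - 1) - a)]

theorem sx_v (h : α < β) (t : ℝ) : ∑ j, sv α β j * sx p a α β w v t j = v t := by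
  have : β - α ≠ 0 := by linarith
  simp [Fin.sum_univ_four, sv, sx]; field_simp; ring

theorem sx_r (h : α < β) (t : ℝ) : ∑ j, sr α β j * sx p a α β w v t j = v t / w t := by
  have : β - α ≠ 0 := by linarith
  simp [Fin.sum_univ_four, sr, sx]
  generalize v t / w t = z
  field_simp; ring

theorem sx_m (h : α < β) (t : ℝ) : ∑ j, sm α β j * sx p a α β w v t j = w t ^ (p - 1) - a := by
  have : β - α ≠ 0 := by linarith
  simp [Fin.sum_univ_four, sm, sx]
  generalize v t / w t = z
  field_simp; ring

theorem sx_sys (C : PC d p θ a b α β) (D : Dyn p a b θ w v) :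
    QSys (sLam α β) (sB p α β) α (sx p a α β w v) := by
  have hvd : ∀ t, HasDerivAt v (-b * v t - w t * (w t ^ (p - 1) - a)) t := fun t =>
    (D.hv t).congr_deriv (by rw [D.wp t]; ring)
  have hrd : ∀ t, HasDerivAt (fun t => v t / w t) (-b * (v t / w t) - (w t ^ (p - 1) - a) - (v t / w t) * (v t / w t)) t := by
    intro t
    have hw0 := (D.wpos t).ne'
    refine ((hvd t).fun_div (D.hw t) hw0).congr_deriv ?_
    field_simp
  have hmd : ∀ t, HasDerivAt (fun t => w t ^ (p - 1) - a) ((p - 1) * (a + (w t ^ (p - 1) - a)) * (v t / w t)) t :=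
    fun t => ((D.mder t).sub_const a).congr_deriv (by ring)
  have hs := C.hsum
  have hpr := C.hprod
  refine ⟨C.hα, fun i => ?_, fun t i => ?_, ?_⟩
  · have := C.hαβ.le
    fin_cases i <;> simp [sLam, this]
  · rw [sB_sum, sx_v C.hαβ, sx_r C.hαβ, sx_m C.hαβ]
    fin_cases i
    · refine (((hvd t).const_mul β).fun_add (D.nder t)).congr_deriv ?_
      simp [sLam, sx]
      rw [← hs, ← hpr]; ring
    · refine (((hvd t).const_mul α).fun_add (D.nder t)).congr_deriv ?_
      simp [sLam, sx]
      rw [← hs, ← hpr]; ring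
    · refine (((hrd t).const_mul β).fun_add (hmd t)).congr_deriv ?_
      simp [sLam, sx]
      generalize v t / w t = z
      rw [← hs]; linear_combination (-z) * hpr
    · refine (((hrd t).const_mul α).fun_add (hmd t)).congr_deriv ?_
      simp [sLam, sx]
      generalize v t / w t = z
      rw [← hs]; linear_combination (-z) * hpr
  · obtain ⟨l, hl0, hla, hl, hv, hma⟩ := D.limits C
    have hm : Tendsto (fun t => w t ^ (p - 1) - a) atTop (𝓝 0) := by
      have : Tendsto (fun t => w t ^ (p - 1)) atTop (𝓝 (l ^ (p - 1))) := hl.rpow_const (Or.inl hl0.ne')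
      simpa [hla] using this.sub_const a
    have hr : Tendsto (fun t => v t / w t) atTop (𝓝 0) := by
      have := hv.div hl hl0.ne'
      rw [zero_div] at this
      exact this
    have hn := hl.mul hm
    rw [tendsto_pi_nhds]
    intro i
    fin_cases i
    · simpa [sx] using (hv.const_mul β).add hn
    · simpa [sx] using (hv.const_mul α).add hn
    · simpa [sx] using (hr.const_mul β).add hm
    · simpa [sx] using (hr.const_mul α).add hm

def sP (α β : ℝ) : MvPolynomial (Fin 4) ℝ := (∑ j, MvPolynomial.C (sv α β j) * MvPolynomial.X j) ^ 2

theorem sP_eval (h : α < β) (t : ℝ) : MvPolynomial.eval (sx p a α β w v t) (sP α β) = v t ^ 2 := by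
  unfold sP
  rw [map_pow, map_sum]
  simp only [map_mul, MvPolynomial.eval_C, MvPolynomial.eval_X]
  rw [sx_v h]

theorem sys_alt (C : PC d p θ a b α β) (D : Dyn p a b θ w v) {ℓ : ℝ} (hℓ : 0 < ℓ) {ψ : ℝ → ℝ} (hψ : Continuous ψ) :
    EvNZ (fun s => ∫ τ in (0:ℝ)..ℓ, ψ τ * v (s + τ) ^ 2) ∨ ∀ s, ∫ τ in (0:ℝ)..ℓ, ψ τ * v (s + τ) ^ 2 = 0 := by
  have := (sx_sys C D).main hℓ hψ (sP α β)
  unfold obs at this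
  simpa only [sP_eval C.hαβ] using this
end sys

/-- Laplace-type injectivity -/
theorem laplace_inj {ψ : ℝ → ℝ} (hψ : Continuous ψ) {ℓ : ℝ} (hℓ : 0 < ℓ) {k₁ k₂ : ℝ} (hk : k₁ < k₂)
    (hz : ∀ σ ∈ Ioo k₁ k₂, ∫ τ in (0:ℝ)..ℓ, ψ τ * Real.exp (σ * τ) = 0) : ∫ τ in (0:ℝ)..ℓ, ψ τ = 0 := by
  obtain ⟨Mψ, hM⟩ := (isCompact_Icc (a := (0:ℝ)) (b := ℓ)).exists_bound_of_continuousOn hψ.continuousOn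
  set Ψ : ℂ → ℂ := fun z => ∫ τ in (0:ℝ)..ℓ, (ψ τ : ℂ) * Complex.exp (z * τ) with hΨ
  have hd : DifferentiableOn ℂ Ψ univ := by
    refine paramHol isOpen_univ (fun z τ => (ψ τ : ℂ) * Complex.exp (z * τ)) ?_ ?_ ?_
    · intro r _; fun_prop
    · intro z _
      exact (by fun_prop : Continuous fun τ : ℝ => (ψ τ : ℂ) * Complex.exp (z * τ)).aestronglyMeasurable
    · intro z _
      refine ⟨Mψ * Real.exp ((‖z‖ + 1) * ℓ), 1, one_pos, fun x hx _ r hr => ?_⟩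
      rw [uIoc_of_le hℓ.le] at hr
      have hM0 : 0 ≤ Mψ := (norm_nonneg _).trans (hM 0 ⟨le_rfl, hℓ.le⟩)
      rw [norm_mul, Complex.norm_real, Complex.norm_exp]
      refine mul_le_mul (hM r ⟨hr.1.le, hr.2⟩) ?_ (Real.exp_pos _).le hM0
      apply Real.exp_le_exp.2
      have h1 : ‖x‖ ≤ ‖z‖ + 1 := by
        have : ‖x - z‖ < 1 := by simpa [dist_eq_norm] using hx
        have := norm_le_norm_add_norm_sub z x
        rw [norm_sub_rev] at this
        linarith
      calc (x * r).re ≤ ‖x * r‖ := Complex.re_le_norm _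
        _ = ‖x‖ * r := by rw [norm_mul, Complex.norm_real, Real.norm_of_nonneg hr.1.le]
        _ ≤ (‖z‖ + 1) * ℓ := mul_le_mul h1 hr.2 hr.1.le (by positivity)
  have hreal : ∀ σ : ℝ, Ψ σ = ((∫ τ in (0:ℝ)..ℓ, ψ τ * Real.exp (σ * τ) : ℝ) : ℂ) := by
    intro σ
    rw [hΨ, ← intervalIntegral.integral_ofReal]
    refine intervalIntegral.integral_congr fun τ _ => ?_
    push_cast; rfl
  have han : AnalyticOnNhd ℂ Ψ univ := hd.analyticOnNhd isOpen_univ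
  set σ₀ := (k₁ + k₂) / 2 with hσ
  have hfreq : ∃ᶠ z in 𝓝[≠] (σ₀ : ℂ), Ψ z = (fun _ => (0:ℂ)) z := by
    have h1 : ∃ᶠ σ : ℝ in 𝓝[≠] σ₀, Ψ (σ : ℂ) = 0 := by
      apply Eventually.frequently
      filter_upwards [nhdsWithin_le_nhds (Ioo_mem_nhds (show k₁ < σ₀ by linarith) (show σ₀ < k₂ by linarith))] with σ h
      rw [hreal, hz σ h]; simp
    have h2 : Tendsto (fun σ : ℝ => (σ : ℂ)) (𝓝[≠] σ₀) (𝓝[≠] (σ₀ : ℂ)) := by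
      refine tendsto_nhdsWithin_iff.2 ⟨(Complex.continuous_ofReal.tendsto σ₀).mono_left nhdsWithin_le_nhds, ?_⟩
      filter_upwards [self_mem_nhdsWithin] with σ h
      simpa using h
    exact h2.frequently h1
  have h0 := AnalyticOnNhd.eq_of_frequently_eq (𝕜 := ℂ) (f := Ψ) (g := fun _ => 0) han analyticOnNhd_const hfreq
  have h1 : Ψ ((0:ℝ):ℂ) = 0 := by rw [h0]
  rw [hreal] at h1
  have h2 := Complex.ofReal_eq_zero.1 h1
  simpa using h2

theorem conv_zero {ψ g : ℝ → ℝ} (hψ : Continuous ψ) {ℓ : ℝ} (hℓ : 0 < ℓ) (hg : Integrable g) (hgc : Continuous g)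
    (hg0 : ∀ t, 0 < g t) (hz : ∀ s, ∫ τ in (0:ℝ)..ℓ, ψ τ * g (s + τ) = 0) : ∫ τ in (0:ℝ)..ℓ, ψ τ = 0 := by
  set k : ℝ → ℝ := (Ioc 0 ℓ).indicator ψ with hk
  have hki : Integrable k :=
    (integrable_indicator_iff measurableSet_Ioc).2 ((hψ.integrableOn_Icc).mono_set Ioc_subset_Icc_self)
  have hkn : Integrable (fun τ => k (-τ)) := hki.comp_neg
  have h1 := integral_convolution (μ := volume) (ν := volume) (ContinuousLinearMap.mul ℝ ℝ) hkn hg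
  have h2 : ∀ s, (convolution (fun τ => k (-τ)) g (ContinuousLinearMap.mul ℝ ℝ) volume) s = 0 := by
    intro s
    unfold convolution
    simp only [ContinuousLinearMap.mul_apply']
    have e := integral_neg_eq_self (fun τ => k τ * g (s + τ)) volume
    have e2 : (fun τ => k (-τ) * g (s - τ)) = fun τ => (fun τ => k τ * g (s + τ)) (-τ) := by
      funext τ; simp [sub_eq_add_neg]
    rw [e2, e]
    have e3 : (fun τ => k τ * g (s + τ)) = (Ioc 0 ℓ).indicator (fun τ => ψ τ * g (s + τ)) := by
      funext τ
      simp only [hk, indicator]; split_ifs <;> simp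
    rw [e3, integral_indicator measurableSet_Ioc, ← intervalIntegral.integral_of_le hℓ.le, hz s]
  simp only [h2, integral_zero, ContinuousLinearMap.mul_apply'] at h1
  rw [integral_neg_eq_self k volume] at h1
  have h3 : 0 < ∫ t, g t := by
    rw [integral_pos_iff_support_of_nonneg (fun t => (hg0 t).le) hg]
    have : Function.support g = univ := by
      ext t; simp [(hg0 t).ne']
    rw [this]; simp
  have h4 : ∫ τ, k τ = 0 := by
    rcases mul_eq_zero.1 h1.symm with h | h
    · exact h
    · exact absurd h h3.ne'
  rw [hk, integral_indicator measurableSet_Ioc, ← intervalIntegral.integral_of_le hℓ.le] at h4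
  exact h4

section ef
variable {d : ℕ} {p θ a b α β : ℝ} {Q : ℝ → ℝ}

theorem efv_cont (hQ : IsGroundState d p Q) : Continuous (efv p θ Q) :=
  continuous_iff_continuousAt.2 fun t => (efv_der' hQ t).continuousAt

theorem efv_bdd (C : PC d p θ a b α β) (hQ : IsGroundState d p Q) (hpos : ∀ y : ℝ, 0 ≤ y → 0 < Lam1 p Q y) :
    ∃ K, ∀ t, |efv p θ Q t| ≤ K := by
  have D := gs_dyn C hQ hpos
  obtain ⟨l, hl0, hla, hl, hv, hma⟩ := D.limits C
  exact bdd_of_limits (efv_cont hQ) D.v0 hv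

theorem lap_int (C : PC d p θ a b α β) (hQ : IsGroundState d p Q) (hpos : ∀ y : ℝ, 0 ≤ y → 0 < Lam1 p Q y)
    {e : ℝ} (he : 0 < e) (he2 : e < 2 * θ) : Integrable (fun t => Real.exp (-e * t) * efv p θ Q t ^ 2) := by
  obtain ⟨K, hK⟩ := efv_bdd C hQ hpos
  have hc : Continuous (fun t => Real.exp (-e * t) * efv p θ Q t ^ 2) := by
    have := efv_cont (θ := θ) hQ
    fun_prop
  obtain ⟨H, hH⟩ := (isCompact_Icc (a := (0:ℝ)) (b := 1)).exists_bound_of_continuousOn (h_cont hQ).continuousOn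
  rw [← integrableOn_univ, ← Iic_union_Ioi (a := (0:ℝ)), integrableOn_union]
  constructor
  · refine Integrable.mono' ((integrableOn_exp_mul_Iic (a := 2 * θ - e) (by linarith) 0).const_mul (H ^ 2))
      hc.aestronglyMeasurable ?_
    filter_upwards [ae_restrict_mem measurableSet_Iic] with t ht
    have h1 : |Lam1 p Q (Real.exp t)| ≤ H := hH _ ⟨(Real.exp_pos t).le, Real.exp_le_one_iff.2 ht⟩
    rw [Real.norm_of_nonneg (by positivity)]
    unfold efv
    have h2 : Lam1 p Q (Real.exp t) ^ 2 ≤ H ^ 2 := by rw [← sq_abs]; gcongr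
    have h3 : Real.exp (-e * t) * Real.exp (θ * t) ^ 2 = Real.exp ((2 * θ - e) * t) := by
      rw [← Real.exp_nat_mul, ← Real.exp_add]; congr 1; push_cast; ring
    rw [mul_pow, ← mul_assoc, h3, mul_comm]
    gcongr
  · refine Integrable.mono' ((integrableOn_exp_mul_Ioi (a := -e) (by linarith) 0).const_mul (K ^ 2))
      hc.aestronglyMeasurable ?_
    filter_upwards with t
    have h2 : efv p θ Q t ^ 2 ≤ K ^ 2 := by rw [← sq_abs]; gcongr; exact hK t
    rw [Real.norm_of_nonneg (by positivity), mul_comm]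
    gcongr

/-- main nonvanishing alternative -/
theorem ef_evnz (C : PC d p θ a b α β) (hQ : IsGroundState d p Q) (hpos : ∀ y : ℝ, 0 ≤ y → 0 < Lam1 p Q y)
    {ψ : ℝ → ℝ} (hψ : Continuous ψ) {ℓ : ℝ} (hℓ : 0 < ℓ) (hψ1 : ∫ τ in (0:ℝ)..ℓ, ψ τ ≠ 0) (κ : ℝ) :
    EvNZ (fun s => ∫ τ in (0:ℝ)..ℓ, ψ τ * (Real.exp (κ * (s + τ)) * efv p θ Q (s + τ) ^ 2)) := by
  have D := gs_dyn C hQ hpos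
  have hψκ : Continuous (fun τ => ψ τ * Real.exp (κ * τ)) := by fun_prop
  rcases sys_alt C D hℓ hψκ with h | h
  · obtain ⟨S, hS⟩ := h
    refine ⟨S, fun s hs => ?_⟩
    have e : ∫ τ in (0:ℝ)..ℓ, ψ τ * (Real.exp (κ * (s + τ)) * efv p θ Q (s + τ) ^ 2) =
        Real.exp (κ * s) * ∫ τ in (0:ℝ)..ℓ, ψ τ * Real.exp (κ * τ) * efv p θ Q (s + τ) ^ 2 := by
      rw [← intervalIntegral.integral_const_mul]
      refine intervalIntegral.integral_congr fun τ _ => ?_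
      show _ * _ = _ * _
      rw [mul_add, Real.exp_add]; ring
    simp only [e]
    exact mul_ne_zero (Real.exp_pos _).ne' (hS s hs)
  · exfalso
    apply hψ1
    refine laplace_inj hψ hℓ (k₁ := κ) (k₂ := κ + 2 * θ) (by linarith [C.hθ]) fun σ hσ => ?_
    have hψσ : Continuous (fun τ => ψ τ * Real.exp (σ * τ)) := by fun_prop
    have hc : Continuous (fun t => Real.exp (-(σ - κ) * t) * efv p θ Q t ^ 2) := by
      have := efv_cont (θ := θ) hQ
      fun_prop
    refine conv_zero hψσ hℓ (lap_int C hQ hpos (e := σ - κ) (by linarith [hσ.1]) (by linarith [hσ.2])) hc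
      (fun t => _root_.mul_pos (Real.exp_pos _) (pow_pos (D.vpos t) 2)) fun s => ?_
    have e : ∫ τ in (0:ℝ)..ℓ, ψ τ * Real.exp (σ * τ) * (Real.exp (-(σ - κ) * (s + τ)) * efv p θ Q (s + τ) ^ 2) =
        Real.exp (-(σ - κ) * s) * ∫ τ in (0:ℝ)..ℓ, ψ τ * Real.exp (κ * τ) * efv p θ Q (s + τ) ^ 2 := by
      rw [← intervalIntegral.integral_const_mul]
      refine intervalIntegral.integral_congr fun τ _ => ?_
      show _ * _ = _ * _
      have : Real.exp (σ * τ) * Real.exp (-(σ - κ) * (s + τ)) = Real.exp (-(σ - κ) * s) * Real.exp (κ * τ) := by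
        rw [← Real.exp_add, ← Real.exp_add]; congr 1; ring
      linear_combination (ψ τ * efv p θ Q (s + τ) ^ 2) * this
    rw [e, h s, mul_zero]

theorem F_repr (hd : 1 ≤ d) (hQ : IsGroundState d p Q) {χ : ℝ → ℝ} (hχ : IsCutoff χ) (s : ℝ) :
    rInner d (fun y => scaleCut χ (Real.exp s) y * Lam1 p Q y) (Lam1 p Q) =
      ∫ τ in (0:ℝ)..Real.log 2, (-(deriv χ (Real.exp τ) * Real.exp τ)) *
        (∫ z in (0:ℝ)..Real.exp (s + τ), Lam1 p Q z ^ 2 * z ^ (d - 1)) := by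
  set M := Real.exp s with hM
  have hM0 : 0 < M := Real.exp_pos s
  have hℓ : (0:ℝ) ≤ Real.log 2 := Real.log_nonneg (by norm_num)
  have hχc := hχ.smooth.continuous
  have hχd : ∀ y, HasDerivAt χ (deriv χ y) y := fun y => (hχ.smooth.differentiable (by simp) y).hasDerivAt
  have hχ'c : Continuous (deriv χ) := hχ.smooth.continuous_deriv (by simp)
  have hhc := h_cont hQ
  set k : ℝ → ℝ := fun z => Lam1 p Q z ^ 2 * z ^ (d - 1) with hk
  have hkc : Continuous k := by fun_prop
  set H : ℝ → ℝ := fun y => ∫ z in (0:ℝ)..y, k z with hH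
  have hHd : ∀ y, HasDerivAt H (k y) y := fun y => hkc.integral_hasStrictDerivAt 0 y |>.hasDerivAt
  have hHc : Continuous H := continuous_iff_continuousAt.2 fun y => (hHd y).continuousAt
  have e1 : rInner d (fun y => scaleCut χ M y * Lam1 p Q y) (Lam1 p Q) = ∫ y in (0:ℝ)..(2 * M), χ (y / M) * k y := by
    unfold rInner scaleCut
    rw [intervalIntegral.integral_of_le (by linarith)]
    rw [setIntegral_eq_of_subset_of_forall_sdiff_eq_zero measurableSet_Ioi (s := Ioc 0 (2 * M)) Ioc_subset_Ioi_self]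
    · refine setIntegral_congr_fun measurableSet_Ioc fun y _ => ?_
      simp only [hk]; ring
    · intro y hy
      have h1 : 0 < y := hy.1
      have h2 : 2 * M < y := by
        by_contra hc; push Not at hc; exact hy.2 ⟨h1, hc⟩
      have : χ (y / M) = 0 := hχ.eq_zero _ (by
        rw [abs_of_pos (by positivity), le_div_iff₀ hM0]; exact h2.le)
      show χ (y / M) * _ * _ * _ = 0
      rw [this]; ring
  have hci : Continuous (fun y => χ (y / M) * k y) := by fun_prop
  have e2 : ∫ y in (0:ℝ)..M, χ (y / M) * k y = H M := by
    refine intervalIntegral.integral_congr fun y hy => ?_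
    rw [uIcc_of_le hM0.le] at hy
    show χ (y / M) * k y = k y
    rw [hχ.eq_one _ (by rw [abs_of_nonneg (div_nonneg hy.1 hM0.le), div_le_one hM0]; exact hy.2), one_mul]
  have hexp : ∀ τ, HasDerivAt (fun τ => Real.exp (s + τ)) (Real.exp (s + τ)) τ := fun τ => by
    exact ((hasDerivAt_id' τ).const_add s).exp.congr_deriv (by ring)
  have e3 : ∫ y in M..(2 * M), χ (y / M) * k y =
      ∫ τ in (0:ℝ)..Real.log 2, χ (Real.exp τ) * (k (Real.exp (s + τ)) * Real.exp (s + τ)) := by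
    have := intervalIntegral.integral_comp_mul_deriv (a := 0) (b := Real.log 2) (f := fun τ => Real.exp (s + τ))
      (f' := fun τ => Real.exp (s + τ)) (g := fun y => χ (y / M) * k y) (fun τ _ => hexp τ)
      (by fun_prop) hci
    simp only [add_zero, Real.exp_add s (Real.log 2), Real.exp_log two_pos] at this
    rw [← hM] at this
    rw [mul_comm 2 M, ← this]
    refine intervalIntegral.integral_congr fun τ _ => ?_
    simp only [Function.comp]
    have : Real.exp (s + τ) / M = Real.exp τ := by rw [Real.exp_add, ← hM]; field_simp
    rw [this]; ring
  have e4 := intervalIntegral.integral_mul_deriv_eq_deriv_mul (a := 0) (b := Real.log 2)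
    (u := fun τ => χ (Real.exp τ)) (u' := fun τ => deriv χ (Real.exp τ) * Real.exp τ)
    (v := fun τ => H (Real.exp (s + τ))) (v' := fun τ => k (Real.exp (s + τ)) * Real.exp (s + τ))
    (fun τ _ => (hχd _).comp τ (Real.hasDerivAt_exp τ)) (fun τ _ => (hHd _).comp τ (hexp τ))
    ((by fun_prop : Continuous fun τ => deriv χ (Real.exp τ) * Real.exp τ).intervalIntegrable _ _)
    ((by fun_prop : Continuous fun τ => k (Real.exp (s + τ)) * Real.exp (s + τ)).intervalIntegrable _ _)
  rw [e1, ← intervalIntegral.integral_add_adjacent_intervals (hci.intervalIntegrable 0 M) (hci.intervalIntegrable M _),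
    e2, e3, e4]
  have c2 : χ 2 = 0 := hχ.eq_zero 2 (by norm_num)
  have c1 : χ 1 = 1 := hχ.eq_one 1 (by norm_num)
  simp only [Real.exp_log two_pos, Real.exp_zero, c1, c2, add_zero, neg_mul, intervalIntegral.integral_neg]
  rw [← hM]
  ring

theorem F_evnz (C : PC d p θ a b α β) (hQ : IsGroundState d p Q) (hpos : ∀ y : ℝ, 0 ≤ y → 0 < Lam1 p Q y)
    {χ : ℝ → ℝ} (hχ : IsCutoff χ) : ∃ M₀ : ℝ, 0 < M₀ ∧ ∀ M, M₀ ≤ M →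
      rInner d (fun y => scaleCut χ M y * Lam1 p Q y) (Lam1 p Q) ≠ 0 := by
  have hd1 : 1 ≤ d := by
    have : (1:ℝ) ≤ d := by linarith [C.hd]
    exact_mod_cast this
  have hℓ : (0:ℝ) < Real.log 2 := Real.log_pos (by norm_num)
  have hχd : ∀ y, HasDerivAt χ (deriv χ y) y := fun y => (hχ.smooth.differentiable (by simp) y).hasDerivAt
  have hχ'c : Continuous (deriv χ) := hχ.smooth.continuous_deriv (by simp)
  have hhc := h_cont hQ
  set ψ : ℝ → ℝ := fun τ => -(deriv χ (Real.exp τ) * Real.exp τ) with hψ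
  have hψc : Continuous ψ := by fun_prop
  have hψ1 : ∫ τ in (0:ℝ)..Real.log 2, ψ τ = 1 := by
    have := intervalIntegral.integral_eq_sub_of_hasDerivAt (a := 0) (b := Real.log 2) (f := fun τ => -χ (Real.exp τ))
      (f' := ψ) (fun τ _ => ((hχd _).comp τ (Real.hasDerivAt_exp τ)).neg) (hψc.intervalIntegrable _ _)
    rw [this, Real.exp_log two_pos, Real.exp_zero, hχ.eq_zero 2 (by norm_num), hχ.eq_one 1 (by norm_num)]
    norm_num
  set k : ℝ → ℝ := fun z => Lam1 p Q z ^ 2 * z ^ (d - 1) with hk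
  have hkc : Continuous k := by fun_prop
  have hGd : ∀ t, HasDerivAt (fun t => ∫ z in (0:ℝ)..Real.exp t, k z) (k (Real.exp t) * Real.exp t) t := fun t =>
    ((hkc.integral_hasStrictDerivAt 0 (Real.exp t)).hasDerivAt).comp t (Real.hasDerivAt_exp t)
  have hkef : ∀ t, k (Real.exp t) * Real.exp t = Real.exp ((d - 2 * θ) * t) * efv p θ Q t ^ 2 := by
    intro t
    simp only [hk]; unfold efv
    rw [mul_pow, mul_assoc, ← pow_succ, Nat.sub_add_cancel hd1, ← Real.exp_nat_mul, ← Real.exp_nat_mul, mul_comm,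
      ← mul_assoc, ← Real.exp_add]
    congr 2; push_cast; ring
  have hFd := fun s => convDeriv (ℓ := Real.log 2) hGd (by fun_prop) hψc s
  have hnz := ef_evnz C hQ hpos hψc hℓ (by rw [hψ1]; exact one_ne_zero) (d - 2 * θ)
  have hcr : Continuous (fun s => ∫ τ in (0:ℝ)..Real.log 2, ψ τ * (k (Real.exp (s + τ)) * Real.exp (s + τ))) := by
    apply intervalIntegral.continuous_parametric_intervalIntegral_of_continuous' (by fun_prop)
  obtain ⟨S, hS⟩ := step_nz (l := 0) (fun s => (hFd s).congr_deriv (by ring)) hcr (by simpa only [hkef] using hnz)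
  refine ⟨Real.exp S, Real.exp_pos S, fun M hM => ?_⟩
  have hM0 : 0 < M := (Real.exp_pos S).trans_le hM
  have h1 := F_repr hd1 hQ hχ (Real.log M)
  rw [Real.exp_log hM0] at h1
  rw [h1]
  exact hS _ ((Real.le_log_iff_exp_le hM0).2 hM)
end ef

section phi
variable {d : ℕ} {p θ a b α β : ℝ} {Q : ℝ → ℝ}

/-- smooth on `(0,∞)`, supported in `(0,2M]`, equal to `c h` on `(0,M)`. -/
structure SCl (p : ℝ) (Q : ℝ → ℝ) (M : ℝ) (g : ℝ → ℝ) (c : ℝ) : Prop where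
  sm : ContDiffOn ℝ (⊤ : ℕ∞) g (Ioi 0)
  z : ∀ y, 2 * M < y → g y = 0
  e : ∀ y, 0 < y → y < M → g y = c * Lam1 p Q y

theorem cd_deriv {g : ℝ → ℝ} (h : ContDiffOn ℝ (⊤ : ℕ∞) g (Ioi 0)) :
    ContDiffOn ℝ (⊤ : ℕ∞) (deriv g) (Ioi 0) :=
  h.deriv_of_isOpen isOpen_Ioi (by simp)

theorem SCl.neg {M c : ℝ} {g : ℝ → ℝ} (h : SCl p Q M g c) : SCl p Q M (fun y => -g y) (-c) :=
  ⟨h.sm.neg, fun y hy => by rw [h.z y hy, neg_zero], fun y h1 h2 => by rw [h.e y h1 h2]; ring⟩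

theorem SCl.Lop (C : PC d p θ a b α β) (hQ : IsGroundState d p Q) {M c : ℝ} {g : ℝ → ℝ}
    (hM : 0 < M) (h : SCl p Q M g c) : SCl p Q M (Lop d p Q g) 0 := by
  refine ⟨?_, ?_, ?_⟩
  · unfold WaveBlowup.Lop
    have h1 := cd_deriv h.sm
    have h2 := cd_deriv h1
    have hQs : ContDiffOn ℝ (⊤ : ℕ∞) (fun y => Q y ^ (p - 1)) (Ioi 0) :=
      hQ.smooth.contDiffOn.rpow_const_of_ne (fun y hy => (hQ.pos y (le_of_lt hy)).ne')
    have hi : ContDiffOn ℝ (⊤ : ℕ∞) (fun y : ℝ => ((d : ℝ) - 1) / y) (Ioi 0) :=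
      contDiffOn_const.div contDiffOn_id (fun y hy => (ne_of_gt hy))
    exact ((h2.add (hi.mul h1)).neg).sub ((contDiffOn_const.mul hQs).mul h.sm)
  · intro y hy
    have e0 : g =ᶠ[𝓝 y] fun _ => 0 := by
      filter_upwards [isOpen_Ioi.mem_nhds hy] with z hz using h.z z hz
    have e1 := e0.deriv
    have e2 := e1.deriv
    unfold WaveBlowup.Lop
    rw [e2.eq_of_nhds, e1.eq_of_nhds, e0.eq_of_nhds]
    simp
  · intro y hy hy2
    have e0 : g =ᶠ[𝓝 y] fun y => c * Lam1 p Q y := by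
      filter_upwards [isOpen_Ioo.mem_nhds (⟨hy, hy2⟩ : y ∈ Ioo 0 M)] with z hz using h.e z hz.1 hz.2
    have e1 := e0.deriv
    have e1' : deriv (fun y => c * Lam1 p Q y) = fun y => c * deriv (Lam1 p Q) y := by
      funext z; exact ((h_der hQ z).const_mul c).deriv
    rw [e1'] at e1
    have e2 := e1.deriv
    have e2' : deriv (fun y => c * deriv (Lam1 p Q) y) y = c * deriv (deriv (Lam1 p Q)) y := by
      apply deriv_const_mul
      exact ((h_sm' hQ).differentiable (by simp)) y
    unfold WaveBlowup.Lop
    rw [e2.eq_of_nhds, e1.eq_of_nhds, e0.eq_of_nhds, e2']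
    linear_combination (-c) * h_dd C hQ hy

theorem SCl.bdd (hQ : IsGroundState d p Q) {M c : ℝ} {g : ℝ → ℝ} (hM : 0 < M) (h : SCl p Q M g c) :
    ∃ B, 0 < B ∧ ∀ y, 0 < y → |g y| ≤ B := by
  have hc : ContinuousOn g (Icc (M / 2) (2 * M)) := h.sm.continuousOn.mono fun y hy => by
    have := hy.1
    simp only [mem_Ioi]; linarith
  obtain ⟨B1, h1⟩ := isCompact_Icc.exists_bound_of_continuousOn hc
  obtain ⟨B2, h2⟩ := (isCompact_Icc (a := (0:ℝ)) (b := M)).exists_bound_of_continuousOn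
    ((h_cont hQ).const_mul c).continuousOn
  refine ⟨|B1| + |B2| + 1, by positivity, fun y hy => ?_⟩
  have a1 := le_abs_self B1
  have a2 := le_abs_self B2
  have a3 := abs_nonneg B1
  have a4 := abs_nonneg B2
  rcases lt_or_ge y M with k | k
  · have := h2 y ⟨hy.le, k.le⟩
    rw [Real.norm_eq_abs, ← h.e y hy k] at this
    linarith
  · rcases le_or_gt y (2 * M) with k2 | k2
    · have := h1 y ⟨by linarith, k2⟩
      rw [Real.norm_eq_abs] at this
      linarith
    · rw [h.z y k2, abs_zero]; linarith

theorem SCl.int (hQ : IsGroundState d p Q) {M c : ℝ} {g : ℝ → ℝ} (hM : 0 < M) (h : SCl p Q M g c) :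
    IntegrableOn (fun y => g y * Lam1 p Q y * y ^ (d - 1)) (Ioi 0) := by
  obtain ⟨B, hB, hb⟩ := h.bdd hQ hM
  have hhc := h_cont hQ
  have hm : AEStronglyMeasurable (fun y => g y * Lam1 p Q y * y ^ (d - 1)) (volume.restrict (Ioi 0)) := by
    refine ContinuousOn.aestronglyMeasurable ?_ measurableSet_Ioi
    exact (h.sm.continuousOn.mul hhc.continuousOn).mul (continuous_pow _).continuousOn
  rw [← Ioc_union_Ioi_eq_Ioi (show (0:ℝ) ≤ 2 * M by linarith)]
  refine IntegrableOn.union ?_ ?_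
  · have hk : IntegrableOn (fun y => B * |Lam1 p Q y * y ^ (d - 1)|) (Ioc 0 (2 * M)) :=
      ((by fun_prop : Continuous (fun y => B * |Lam1 p Q y * y ^ (d - 1)|)).integrableOn_Icc).mono_set Ioc_subset_Icc_self
    refine Integrable.mono' hk (hm.mono_measure (Measure.restrict_mono Ioc_subset_Ioi_self le_rfl)) ?_
    refine (ae_restrict_iff' measurableSet_Ioc).2 (ae_of_all _ fun y hy => ?_)
    rw [Real.norm_eq_abs, mul_assoc, abs_mul]
    exact mul_le_mul_of_nonneg_right (hb y hy.1) (abs_nonneg _)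
  · refine (integrableOn_zero (s := Ioi (2 * M)) (μ := volume) (ε' := ℝ)).congr_fun (fun y hy => ?_) measurableSet_Ioi
    simp only [h.z y hy]; simp

theorem SCl.orth (C : PC d p θ a b α β) (hQ : IsGroundState d p Q) {M c : ℝ} {g : ℝ → ℝ}
    (hM : 0 < M) (h : SCl p Q M g c) : rInner d (WaveBlowup.Lop d p Q g) (Lam1 p Q) = 0 := by
  have hL := h.Lop C hQ hM
  have hd1 : 2 ≤ d := by
    have : (2:ℝ) ≤ d := by linarith [C.hd]
    exact_mod_cast this
  have hhc := h_cont hQ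
  unfold rInner
  rw [setIntegral_eq_of_subset_of_forall_sdiff_eq_zero measurableSet_Ioi (s := Ioc (M / 2) (3 * M))
    (fun y hy => by have := hy.1; simp only [mem_Ioi]; linarith)]
  · rw [← intervalIntegral.integral_of_le (by linarith)]
    have hder : ∀ y ∈ uIcc (M / 2) (3 * M), HasDerivAt
        (fun y => -(y ^ (d - 1) * (deriv g y * Lam1 p Q y - g y * deriv (Lam1 p Q) y)))
        (WaveBlowup.Lop d p Q g y * Lam1 p Q y * y ^ (d - 1)) y := by
      intro y hy
      rw [uIcc_of_le (by linarith)] at hy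
      have hy0 : 0 < y := by linarith [hy.1]
      have g1 : HasDerivAt g (deriv g y) y :=
        ((h.sm.contDiffAt (Ioi_mem_nhds hy0)).differentiableAt (by simp)).hasDerivAt
      have g2 : HasDerivAt (deriv g) (deriv (deriv g) y) y :=
        (((cd_deriv h.sm).contDiffAt (Ioi_mem_nhds hy0)).differentiableAt (by simp)).hasDerivAt
      have h1 := h_der hQ y
      have h2 : HasDerivAt (deriv (Lam1 p Q)) (deriv (deriv (Lam1 p Q)) y) y :=
        ((h_sm' hQ).differentiable (by simp) y).hasDerivAt
      have hh := h_dd C hQ hy0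
      refine (((hasDerivAt_pow (d - 1) y).fun_mul ((g2.fun_mul h1).fun_sub (g1.fun_mul h2))).fun_neg).congr_deriv ?_
      unfold WaveBlowup.Lop
      have hp : y ^ (d - 1) = y * y ^ (d - 1 - 1) := by rw [← pow_succ']; congr 1; omega
      have hc : ((d - 1 : ℕ) : ℝ) = d - 1 := by rw [Nat.cast_sub (by omega)]; simp
      rw [hc, hp]
      have hy' := hy0.ne'
      have e : deriv (deriv (Lam1 p Q)) y = -((d - 1) / y * deriv (Lam1 p Q) y) - p * Q y ^ (p - 1) * Lam1 p Q y := by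
        linarith
      rw [e]
      field_simp
      ring
    rw [intervalIntegral.integral_eq_sub_of_hasDerivAt hder]
    · have z1 : g =ᶠ[𝓝 (3 * M)] fun _ => 0 := by
        filter_upwards [isOpen_Ioi.mem_nhds (show 2 * M < 3 * M by linarith)] with z hz using h.z z hz
      have e0 : g =ᶠ[𝓝 (M / 2)] fun y => c * Lam1 p Q y := by
        filter_upwards [isOpen_Ioo.mem_nhds (⟨by linarith, by linarith⟩ : M / 2 ∈ Ioo 0 M)] with z hz using h.e z hz.1 hz.2
      have e1 := e0.deriv.eq_of_nhds
      rw [((h_der hQ (M / 2)).const_mul c).deriv] at e1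
      rw [e1, e0.eq_of_nhds, z1.eq_of_nhds, z1.deriv.eq_of_nhds]
      simp
      right; ring
    · refine ContinuousOn.intervalIntegrable ?_
      refine ((hL.sm.continuousOn.mul hhc.continuousOn).mul (continuous_pow _).continuousOn).mono ?_
      intro y hy
      rw [uIcc_of_le (by linarith)] at hy
      have := hy.1
      simp only [mem_Ioi]; linarith
  · intro y hy
    have hy0 : 0 < y := hy.1
    rcases lt_or_ge y M with k | k
    · rw [hL.e y hy0 k]; ring
    · have : 2 * M < y := by
        by_contra hc
        push Not at hc
        exact hy.2 ⟨by linarith, by linarith⟩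
      rw [hL.z y this]; ring

theorem base_SCl (hQ : IsGroundState d p Q) {χ : ℝ → ℝ} (hχ : IsCutoff χ) {M : ℝ} (hM : 0 < M) :
    SCl p Q M (basePair p Q χ M).1 1 ∧ SCl p Q M (basePair p Q χ M).2 0 := by
  constructor
  · refine ⟨?_, ?_, ?_⟩
    · have : ContDiff ℝ (⊤ : ℕ∞) (fun y => χ (y / M) * Lam1 p Q y) :=
        (hχ.smooth.comp (contDiff_id.div_const M)).mul (h_sm hQ)
      exact this.contDiffOn
    · intro y hy
      have : χ (y / M) = 0 := hχ.eq_zero _ (by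
        rw [abs_of_pos (div_pos (by linarith) hM), le_div_iff₀ hM]; exact hy.le)
      show χ (y / M) * _ = 0
      rw [this]; ring
    · intro y hy hy2
      have : χ (y / M) = 1 := hχ.eq_one _ (by
        rw [abs_of_pos (div_pos hy hM), div_le_one hM]; exact hy2.le)
      show χ (y / M) * _ = _
      rw [this]
  · exact ⟨contDiffOn_const, fun _ _ => rfl, fun y _ _ => by simp [basePair]⟩

theorem iter_SCl (C : PC d p θ a b α β) (hQ : IsGroundState d p Q) {χ : ℝ → ℝ} (hχ : IsCutoff χ) {M : ℝ} (hM : 0 < M)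
    (q : ℕ) : (∃ c, SCl p Q M ((Hstar d p Q)^[q] (basePair p Q χ M)).1 c) ∧
      (∃ c, SCl p Q M ((Hstar d p Q)^[q] (basePair p Q χ M)).2 c) := by
  induction q with
  | zero => exact ⟨⟨1, (base_SCl hQ hχ hM).1⟩, ⟨0, (base_SCl hQ hχ hM).2⟩⟩
  | succ q ih =>
    rw [Function.iterate_succ_apply']
    obtain ⟨⟨c, hc⟩, ⟨c', hc'⟩⟩ := ih
    exact ⟨⟨0, hc'.Lop C hQ hM⟩, ⟨-c, hc.neg⟩⟩

theorem iter_orth (C : PC d p θ a b α β) (hQ : IsGroundState d p Q) {χ : ℝ → ℝ} (hχ : IsCutoff χ) {M : ℝ} (hM : 0 < M)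
    (q : ℕ) : rInner d ((Hstar d p Q)^[q + 1] (basePair p Q χ M)).1 (Lam1 p Q) = 0 := by
  rw [Function.iterate_succ_apply']
  obtain ⟨c', hc'⟩ := (iter_SCl C hQ hχ hM q).2
  exact hc'.orth C hQ hM

theorem Phi_apply (χ : ℝ → ℝ) (M : ℝ) (L : ℕ) (y : ℝ) : (PhiM d p Q χ M L).1 y =
    ∑ q ∈ Finset.range (L + 1), cCoef d p Q χ M q * ((Hstar d p Q)^[q] (basePair p Q χ M)).1 y := by
  unfold PhiM
  rw [Prod.fst_sum, Finset.sum_apply]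
  rfl

theorem Phi_facts (C : PC d p θ a b α β) (hQ : IsGroundState d p Q) {χ : ℝ → ℝ} (hχ : IsCutoff χ) {M : ℝ} (hM : 0 < M)
    (L : ℕ) (hF : rInner d (fun y => scaleCut χ M y * Lam1 p Q y) (Lam1 p Q) ≠ 0) :
    ContinuousOn (PhiM d p Q χ M L).1 (Ioi 0) ∧ (∀ y, 2 * M < y → (PhiM d p Q χ M L).1 y = 0) ∧
    (∃ B, 0 < B ∧ ∀ y, 0 < y → |(PhiM d p Q χ M L).1 y| ≤ B) ∧
    rInner d (PhiM d p Q χ M L).1 (Lam1 p Q) ≠ 0 := by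
  have hS := fun q => (iter_SCl C hQ hχ hM q).1
  choose c hc using hS
  have hPhi : (PhiM d p Q χ M L).1 = fun y => 
    ∑ q ∈ Finset.range (L + 1), cCoef d p Q χ M q * ((Hstar d p Q)^[q] (basePair p Q χ M)).1 y := by
    funext y; exact Phi_apply χ M L y
  rw [hPhi]
  refine ⟨?_, ?_, ?_, ?_⟩
  · exact continuousOn_finset_sum _ fun q _ => continuousOn_const.mul (hc q).sm.continuousOn
  · intro y hy
    exact Finset.sum_eq_zero fun q _ => by rw [(hc q).z y hy, mul_zero]
  · choose B hB hb using fun q => (hc q).bdd hQ hM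
    refine ⟨∑ q ∈ Finset.range (L + 1), |cCoef d p Q χ M q| * B q + 1, ?_, fun y hy => ?_⟩
    · have : 0 ≤ ∑ q ∈ Finset.range (L + 1), |cCoef d p Q χ M q| * B q :=
        Finset.sum_nonneg fun q _ => mul_nonneg (abs_nonneg _) (hB q).le
      linarith
    · refine (Finset.abs_sum_le_sum_abs _ _).trans ?_
      have : ∑ q ∈ Finset.range (L + 1), |cCoef d p Q χ M q * ((Hstar d p Q)^[q] (basePair p Q χ M)).1 y| ≤ 
        ∑ q ∈ Finset.range (L + 1), |cCoef d p Q χ M q| * B q := by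
        refine Finset.sum_le_sum fun q _ => ?_
        rw [abs_mul]
        exact mul_le_mul_of_nonneg_left (hb q y hy) (abs_nonneg _)
      linarith
  · have e : rInner d (fun y => 
      ∑ q ∈ Finset.range (L + 1), cCoef d p Q χ M q * ((Hstar d p Q)^[q] (basePair p Q χ M)).1 y) (Lam1 p Q) = 
      ∑ q ∈ Finset.range (L + 1), cCoef d p Q χ M q * rInner d ((Hstar d p Q)^[q] (basePair p Q χ M)).1 (Lam1 p Q) := by
      unfold rInner
      simp_rw [← integral_const_mul]
      rw [← integral_finset_sum _ fun q _ => ((hc q).int hQ hM).const_mul _]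
      congr 1
      funext y
      rw [Finset.sum_mul, Finset.sum_mul]
      exact Finset.sum_congr rfl fun q _ => by ring
    rw [e, Finset.sum_range_succ', Finset.sum_eq_zero (fun q _ => by rw [iter_orth C hQ hχ hM q, mul_zero]), zero_add]
    have : cCoef d p Q χ M 0 = 1 := rfl
    rw [this, one_mul]
    exact hF
end phi

section hardy

theorem hardy_up {u f W a a' : ℝ → ℝ} {x z c : ℝ} (hc : 0 < c) (hx : 0 < x) (hxz : x ≤ z)
    (hu : ∀ y ∈ Icc x z, HasDerivAt u (W y * u y - f y) y)
    (ha : ∀ y ∈ Icc x z, HasDerivAt a (a' y) y) (hap : ∀ y ∈ Icc x z, 0 < a y)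
    (hint : IntegrableOn (fun y => y * a y * f y ^ 2) (Icc x z))
    (hW : ∀ y ∈ Icc x z, c * a y ≤ y * (2 * W y * a y + a' y)) :
    ∫ y in x..z, u y ^ 2 * a y / y ≤
      2 / c * (u z ^ 2 * a z - u x ^ 2 * a x) + 4 / c ^ 2 * ∫ y in x..z, y * a y * f y ^ 2 := by
  have huc : ContinuousOn u (Icc x z) := fun y hy => (hu y hy).continuousAt.continuousWithinAt
  have hac : ContinuousOn a (Icc x z) := fun y hy => (ha y hy).continuousAt.continuousWithinAt
  have hgc : ContinuousOn (fun y => u y ^ 2 * a y / y) (Icc x z) :=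
    ((huc.pow 2).mul hac).div continuousOn_id fun y hy => (hx.trans_le hy.1).ne'
  have hgi : IntegrableOn (fun y => u y ^ 2 * a y / y) (Icc x z) := hgc.integrableOn_Icc
  have key := intervalIntegral.integral_le_sub_of_hasDeriv_right_of_le (a := x) (b := z)
    (g := fun y => u y ^ 2 * a y)
    (g' := fun y => (2 * u y * (W y * u y - f y)) * a y + u y ^ 2 * a' y)
    (φ := fun y => c / 2 * (u y ^ 2 * a y / y) - 2 / c * (y * a y * f y ^ 2)) hxz ((huc.pow 2).mul hac)
    (fun y hy => by
      have h1 := hu y (Ioo_subset_Icc_self hy)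
      have h2 := ha y (Ioo_subset_Icc_self hy)
      exact (((h1.fun_pow 2).fun_mul h2).congr_deriv (by push_cast; ring)).hasDerivWithinAt)
    (by have := (Integrable.const_mul hgi (c / 2)).sub (Integrable.const_mul hint (2 / c)); exact this)
    (fun y hy => by
      have hy := Ioo_subset_Icc_self hy
      have hy0 : 0 < y := hx.trans_le hy.1
      have h1 := hW y hy
      have h2 := hap y hy
      have e1 : c * (u y ^ 2 * a y / y) ≤ u y ^ 2 * (2 * W y * a y + a' y) := by
        have : u y ^ 2 * (2 * W y * a y + a' y) = u y ^ 2 / y * (y * (2 * W y * a y + a' y)) := by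
          field_simp
        rw [this]
        calc c * (u y ^ 2 * a y / y) = u y ^ 2 / y * (c * a y) := by ring
          _ ≤ _ := mul_le_mul_of_nonneg_left h1 (by positivity)
      have e2 : 0 ≤ a y * (2 / (c * y)) * (c / 2 * u y - y * f y) ^ 2 := by positivity
      have e3 : a y * (2 / (c * y)) * (c / 2 * u y - y * f y) ^ 2 =
        c / 2 * (u y ^ 2 * a y / y) - 2 * a y * u y * f y + 2 / c * (y * a y * f y ^ 2) := by
        field_simp; ring
      show c / 2 * (u y ^ 2 * a y / y) - 2 / c * (y * a y * f y ^ 2) ≤ 2 * u y * (W y * u y - f y) * a y + u y ^ 2 * a' y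
      nlinarith [e1, e2, e3])
  rw [intervalIntegral.integral_sub, intervalIntegral.integral_const_mul, intervalIntegral.integral_const_mul] at key
  · have e : ∫ y in x..z, u y ^ 2 * a y / y = 2 / c * (c / 2 * ∫ y in x..z, u y ^ 2 * a y / y) := by
      field_simp
    have e' : 4 / c ^ 2 * ∫ y in x..z, y * a y * f y ^ 2 = 2 / c * (2 / c * ∫ y in x..z, y * a y * f y ^ 2) := by
      field_simp; ring
    rw [e, e', ← mul_add]
    exact mul_le_mul_of_nonneg_left (by linarith [key]) (by positivity)
  · exact ((intervalIntegrable_iff_integrableOn_Icc_of_le hxz).2 hgi).const_mul _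
  · exact ((intervalIntegrable_iff_integrableOn_Icc_of_le hxz).2 hint).const_mul _

theorem hardy_dn {u f W a a' : ℝ → ℝ} {x z c : ℝ} (hc : 0 < c) (hx : 0 < x) (hxz : x ≤ z)
    (hu : ∀ y ∈ Icc x z, HasDerivAt u (W y * u y - f y) y)
    (ha : ∀ y ∈ Icc x z, HasDerivAt a (a' y) y) (hap : ∀ y ∈ Icc x z, 0 < a y)
    (hint : IntegrableOn (fun y => y * a y * f y ^ 2) (Icc x z))
    (hW : ∀ y ∈ Icc x z, y * (2 * W y * a y + a' y) ≤ -(c * a y)) :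
    ∫ y in x..z, u y ^ 2 * a y / y ≤
      2 / c * (u x ^ 2 * a x - u z ^ 2 * a z) + 4 / c ^ 2 * ∫ y in x..z, y * a y * f y ^ 2 := by
  have huc : ContinuousOn u (Icc x z) := fun y hy => (hu y hy).continuousAt.continuousWithinAt
  have hac : ContinuousOn a (Icc x z) := fun y hy => (ha y hy).continuousAt.continuousWithinAt
  have hgc : ContinuousOn (fun y => u y ^ 2 * a y / y) (Icc x z) :=
    ((huc.pow 2).mul hac).div continuousOn_id fun y hy => (hx.trans_le hy.1).ne'
  have hgi : IntegrableOn (fun y => u y ^ 2 * a y / y) (Icc x z) := hgc.integrableOn_Icc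
  have key := intervalIntegral.integral_le_sub_of_hasDeriv_right_of_le (a := x) (b := z)
    (g := fun y => -(u y ^ 2 * a y))
    (g' := fun y => -((2 * u y * (W y * u y - f y)) * a y + u y ^ 2 * a' y))
    (φ := fun y => c / 2 * (u y ^ 2 * a y / y) - 2 / c * (y * a y * f y ^ 2)) hxz ((huc.pow 2).mul hac).neg
    (fun y hy => by
      have h1 := hu y (Ioo_subset_Icc_self hy)
      have h2 := ha y (Ioo_subset_Icc_self hy)
      exact (((h1.fun_pow 2).fun_mul h2).fun_neg.congr_deriv (by push_cast; ring)).hasDerivWithinAt)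
    (by have := (Integrable.const_mul hgi (c / 2)).sub (Integrable.const_mul hint (2 / c)); exact this)
    (fun y hy => by
      have hy := Ioo_subset_Icc_self hy
      have hy0 : 0 < y := hx.trans_le hy.1
      have h1 := hW y hy
      have h2 := hap y hy
      have e1 : c * (u y ^ 2 * a y / y) ≤ -(u y ^ 2 * (2 * W y * a y + a' y)) := by
        have : -(u y ^ 2 * (2 * W y * a y + a' y)) = u y ^ 2 / y * -(y * (2 * W y * a y + a' y)) := by
          field_simp
        rw [this]
        calc c * (u y ^ 2 * a y / y) = u y ^ 2 / y * (c * a y) := by ring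
          _ ≤ _ := mul_le_mul_of_nonneg_left (by linarith) (by positivity)
      have e2 : 0 ≤ a y * (2 / (c * y)) * (c / 2 * u y + y * f y) ^ 2 := by positivity
      have e3 : a y * (2 / (c * y)) * (c / 2 * u y + y * f y) ^ 2 =
        c / 2 * (u y ^ 2 * a y / y) + 2 * a y * u y * f y + 2 / c * (y * a y * f y ^ 2) := by
        field_simp; ring
      show c / 2 * (u y ^ 2 * a y / y) - 2 / c * (y * a y * f y ^ 2) ≤ -(2 * u y * (W y * u y - f y) * a y + u y ^ 2 * a' y)
      nlinarith [e1, e2, e3])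
  rw [intervalIntegral.integral_sub, intervalIntegral.integral_const_mul, intervalIntegral.integral_const_mul] at key
  · have e : ∫ y in x..z, u y ^ 2 * a y / y = 2 / c * (c / 2 * ∫ y in x..z, u y ^ 2 * a y / y) := by
      field_simp
    have e' : 4 / c ^ 2 * ∫ y in x..z, y * a y * f y ^ 2 = 2 / c * (2 / c * ∫ y in x..z, y * a y * f y ^ 2) := by
      field_simp; ring
    rw [e, e', ← mul_add]
    exact mul_le_mul_of_nonneg_left (by linarith [key]) (by positivity)
  · exact ((intervalIntegrable_iff_integrableOn_Icc_of_le hxz).2 hgi).const_mul _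
  · exact ((intervalIntegrable_iff_integrableOn_Icc_of_le hxz).2 hint).const_mul _

/-- exhaustion -/
theorem exhaust {g : ℝ → ℝ} {S : Set ℝ} {x z : ℕ → ℝ} {B : ℝ} (hS : ⋃ n, Ioc (x n) (z n) = S)
    (hx : Antitone x) (hz : Monotone z) (hxz : ∀ n, x n ≤ z n)
    (hg : ∀ n, IntegrableOn g (Ioc (x n) (z n))) (hg0 : ∀ y ∈ S, 0 ≤ g y)
    (hB : ∀ n, ∫ y in x n..z n, g y ≤ B) : ∫⁻ y in S, ENNReal.ofReal (g y) ≤ ENNReal.ofReal B := by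
  rw [← hS, setLIntegral_iUnion_of_directed]
  · refine iSup_le fun n => ?_
    rw [← ofReal_integral_eq_lintegral_ofReal (hg n), ← intervalIntegral.integral_of_le (hxz n)]
    · exact ENNReal.ofReal_le_ofReal (hB n)
    · refine (ae_restrict_iff' measurableSet_Ioc).2 (ae_of_all _ fun y hy => ?_)
      exact hg0 y (hS ▸ mem_iUnion.2 ⟨n, hy⟩)
  · exact Monotone.directed_le fun m n hmn => Ioc_subset_Ioc (hx hmn) (hz hmn)

theorem exh_full {g : ℝ → ℝ} {B : ℝ} (hg : ContinuousOn g (Ioi 0)) (hg0 : ∀ y, 0 < y → 0 ≤ g y)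
    (hB : ∀ x z, 0 < x → x ≤ z → ∫ y in x..z, g y ≤ B) :
    ∫⁻ y in Ioi (0:ℝ), ENNReal.ofReal (g y) ≤ ENNReal.ofReal B := by
  have h1 : ∀ n : ℕ, (1:ℝ) / (n + 1) ≤ n + 1 := fun n => by
    rw [div_le_iff₀ (by positivity)]
    have : (0:ℝ) ≤ n := n.cast_nonneg
    nlinarith
  refine exhaust (x := fun n : ℕ => 1 / ((n : ℝ) + 1)) (z := fun n : ℕ => (n : ℝ) + 1) ?_ ?_ ?_ h1 ?_ hg0
    (fun n => hB _ _ (by positivity) (h1 n))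
  · ext y
    simp only [mem_iUnion, mem_Ioc, mem_Ioi]
    constructor
    · rintro ⟨n, hn, -⟩
      exact lt_trans (by positivity) hn
    · intro hy
      obtain ⟨n1, h1⟩ := exists_nat_one_div_lt hy
      obtain ⟨n2, h2⟩ := exists_nat_ge y
      refine ⟨max n1 n2, lt_of_le_of_lt ?_ h1, h2.trans ?_⟩
      · apply one_div_le_one_div_of_le (by positivity)
        have : (n1 : ℝ) ≤ (max n1 n2 : ℕ) := by exact_mod_cast le_max_left _ _
        linarith
      · have : (n2 : ℝ) ≤ (max n1 n2 : ℕ) := by exact_mod_cast le_max_right _ _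
        linarith
  · intro m n hmn
    apply one_div_le_one_div_of_le (by positivity)
    have : (m : ℝ) ≤ n := by exact_mod_cast hmn
    linarith
  · intro m n hmn
    have : (m : ℝ) ≤ n := by exact_mod_cast hmn
    show (m:ℝ) + 1 ≤ n + 1
    linarith
  · intro n
    refine ((hg.mono ?_).integrableOn_Icc).mono_set Ioc_subset_Icc_self
    intro y hy
    exact lt_of_lt_of_le (by positivity) hy.1

theorem exh_lo {g : ℝ → ℝ} {B R : ℝ} (hR : 0 < R) (hg : ContinuousOn g (Ioi 0)) (hg0 : ∀ y, 0 < y → 0 ≤ g y)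
    (hB : ∀ x, 0 < x → x ≤ R → ∫ y in x..R, g y ≤ B) :
    ∫⁻ y in Ioc (0:ℝ) R, ENNReal.ofReal (g y) ≤ ENNReal.ofReal B := by
  have h1 : ∀ n : ℕ, R / (n + 1) ≤ R := fun n => by
    rw [div_le_iff₀ (by positivity)]
    have : (0:ℝ) ≤ n := n.cast_nonneg
    nlinarith
  refine exhaust (x := fun n : ℕ => R / ((n : ℝ) + 1)) (z := fun n : ℕ => R) ?_ ?_ ?_ h1 ?_ (fun y hy => hg0 y hy.1)
    (fun n => hB _ (by positivity) (h1 n))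
  · ext y
    simp only [mem_iUnion, mem_Ioc]
    constructor
    · rintro ⟨n, hn, h⟩
      exact ⟨lt_trans (by positivity) hn, h⟩
    · rintro ⟨hy, h⟩
      obtain ⟨n1, h1⟩ := exists_nat_one_div_lt (div_pos hy hR)
      refine ⟨n1, ?_, h⟩
      rw [lt_div_iff₀ hR] at h1
      calc R / (n1 + 1) = 1 / (n1 + 1) * R := by ring
        _ < y := h1
  · intro m n hmn
    have : (m : ℝ) ≤ n := by exact_mod_cast hmn
    show R / ((n:ℝ) + 1) ≤ R / (m + 1)
    gcongr
  · exact monotone_const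
  · intro n
    refine ((hg.mono ?_).integrableOn_Icc).mono_set Ioc_subset_Icc_self
    intro y hy
    exact lt_of_lt_of_le (by positivity) hy.1

theorem exh_hi {g : ℝ → ℝ} {B R : ℝ} (hR : 0 < R) (hg : ContinuousOn g (Ioi 0)) (hg0 : ∀ y, 0 < y → 0 ≤ g y)
    (hB : ∀ z, R ≤ z → ∫ y in R..z, g y ≤ B) :
    ∫⁻ y in Ioi R, ENNReal.ofReal (g y) ≤ ENNReal.ofReal B := by
  have h1 : ∀ n : ℕ, R ≤ R + n := fun n => by
    have : (0:ℝ) ≤ n := n.cast_nonneg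
    linarith
  refine exhaust (x := fun n : ℕ => R) (z := fun n : ℕ => R + n) ?_ ?_ ?_ h1 ?_ (fun y hy => hg0 y (hR.trans hy))
    (fun n => hB _ (h1 n))
  · ext y
    simp only [mem_iUnion, mem_Ioc, mem_Ioi]
    constructor
    · rintro ⟨n, hn, h⟩
      exact hn
    · intro hy
      obtain ⟨n2, h2⟩ := exists_nat_ge y
      exact ⟨n2, hy, by linarith⟩
  · exact antitone_const
  · intro m n hmn
    have : (m : ℝ) ≤ n := by exact_mod_cast hmn
    show R + (m:ℝ) ≤ R + n
    linarith
  · intro n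
    refine ((hg.mono ?_).integrableOn_Icc).mono_set Ioc_subset_Icc_self
    intro y hy
    exact lt_of_lt_of_le hR hy.1
end hardy

section wts
variable {d : ℕ} {p θ a b α β : ℝ} {Q : ℝ → ℝ}

def wt (d : ℕ) (pw y : ℝ) : ℝ := y ^ (d - 1) / (1 + y ^ (2 * pw))
def aw (d : ℕ) (pw y : ℝ) : ℝ := y ^ (d - 2) / (1 + y ^ (2 * pw))
def aw' (d : ℕ) (pw y : ℝ) : ℝ := aw d pw y / y * (((d : ℝ) - 2) - 2 * pw * (y ^ (2 * pw) / (1 + y ^ (2 * pw))))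

def IA (d : ℕ) (p : ℝ) (Q : ℝ → ℝ) (pw : ℝ) (u : ℝ → ℝ) : ℝ≥0∞ :=
  ∫⁻ y in Ioi (0:ℝ), ENNReal.ofReal ((Aop p Q u y) ^ 2 / (1 + y ^ (2 * pw)) * y ^ (d - 1))
def IB (d : ℕ) (pw : ℝ) (u : ℝ → ℝ) : ℝ≥0∞ :=
  ∫⁻ y in Ioi (0:ℝ), ENNReal.ofReal ((u y) ^ 2 / (y ^ 2 * (1 + y ^ (2 * pw))) * y ^ (d - 1))
def ID (d : ℕ) (pw : ℝ) (u : ℝ → ℝ) : ℝ≥0∞ :=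
  ∫⁻ y in Ioi (0:ℝ), ENNReal.ofReal ((deriv u y) ^ 2 / (1 + y ^ (2 * pw)) * y ^ (d - 1))

theorem pw_pos (pw : ℝ) {y : ℝ} (hy : 0 < y) : 0 < 1 + y ^ (2 * pw) := by positivity

theorem aw_pos (pw : ℝ) {y : ℝ} (hy : 0 < y) : 0 < aw d pw y := by unfold aw; positivity

theorem wt_eq (hd : 2 ≤ d) (pw : ℝ) (y : ℝ) : y * aw d pw y = wt d pw y := by
  unfold aw wt
  have hp : y ^ (d - 1) = y * y ^ (d - 2) := by rw [← pow_succ']; congr 1; omega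
  rw [hp]; ring

theorem IB_eq (hd : 2 ≤ d) (pw : ℝ) (u : ℝ → ℝ) :
    IB d pw u = ∫⁻ y in Ioi (0:ℝ), ENNReal.ofReal (u y ^ 2 * aw d pw y / y) := by
  unfold IB
  refine setLIntegral_congr_fun measurableSet_Ioi fun y hy => ?_
  have hy0 : (0:ℝ) < y := hy
  have := pw_pos pw hy0
  have hp : y ^ (d - 1) = y * y ^ (d - 2) := by rw [← pow_succ']; congr 1; omega
  show ENNReal.ofReal _ = ENNReal.ofReal _
  congr 1
  unfold aw
  rw [hp]; field_simp

theorem IA_eq (hd : 2 ≤ d) (pw : ℝ) (u : ℝ → ℝ) :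
    IA d p Q pw u = ∫⁻ y in Ioi (0:ℝ), ENNReal.ofReal (y * aw d pw y * Aop p Q u y ^ 2) := by
  unfold IA
  refine setLIntegral_congr_fun measurableSet_Ioi fun y hy => ?_
  show ENNReal.ofReal _ = ENNReal.ofReal _
  congr 1
  rw [wt_eq hd]; unfold wt
  ring

theorem ID_eq (hd : 2 ≤ d) (pw : ℝ) (u : ℝ → ℝ) :
    ID d pw u = ∫⁻ y in Ioi (0:ℝ), ENNReal.ofReal (y * aw d pw y * deriv u y ^ 2) := by
  unfold ID
  refine setLIntegral_congr_fun measurableSet_Ioi fun y hy => ?_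
  show ENNReal.ofReal _ = ENNReal.ofReal _
  congr 1
  rw [wt_eq hd]; unfold wt
  ring

theorem aw_der (hd : 3 ≤ d) (pw : ℝ) {y : ℝ} (hy : 0 < y) : HasDerivAt (aw d pw) (aw' d pw y) y := by
  have h1 := hasDerivAt_pow (d - 2) y
  have h2 : HasDerivAt (fun y : ℝ => 1 + y ^ (2 * pw)) (2 * pw * y ^ (2 * pw - 1)) y :=
    (Real.hasDerivAt_rpow_const (Or.inl hy.ne')).const_add 1
  have h0 := pw_pos pw hy
  refine (h1.fun_div h2 h0.ne').congr_deriv ?_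
  unfold aw' aw
  have hp : y ^ (d - 2) = y * y ^ (d - 2 - 1) := by rw [← pow_succ']; congr 1; omega
  have hc : ((d - 2 : ℕ) : ℝ) = d - 2 := by rw [Nat.cast_sub (by omega)]; simp
  rw [hc, hp, Real.rpow_sub hy, Real.rpow_one]
  field_simp

theorem aw_cont (hd : 3 ≤ d) (pw : ℝ) : ContinuousOn (aw d pw) (Ioi 0) :=
  fun _ hy => (aw_der hd pw hy).continuousAt.continuousWithinAt

theorem u_der {u : ℝ → ℝ} (hu : DifferentiableOn ℝ u (Ioi 0)) {y : ℝ} (hy : 0 < y) :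
    HasDerivAt u (Wpot p Q y * u y - Aop p Q u y) y := by
  have := (hu.differentiableAt (Ioi_mem_nhds hy)).hasDerivAt
  refine this.congr_deriv ?_
  unfold Aop; ring

theorem Aop_meas {u : ℝ → ℝ} (hu : DifferentiableOn ℝ u (Ioi 0)) :
    AEStronglyMeasurable (Aop p Q u) (volume.restrict (Ioi 0)) := by
  have h1 : AEStronglyMeasurable u (volume.restrict (Ioi 0)) :=
    hu.continuousOn.aestronglyMeasurable measurableSet_Ioi
  have h2 : AEStronglyMeasurable (deriv u) (volume.restrict (Ioi 0)) :=
    (measurable_deriv u).aestronglyMeasurable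
  have h3 : AEStronglyMeasurable (Wpot p Q) (volume.restrict (Ioi 0)) :=
    (measurable_deriv (fun z => Real.log (Lam1 p Q z))).aestronglyMeasurable
  exact h2.neg.add (h3.mul h1)

theorem Aw_meas (hd : 3 ≤ d) (pw : ℝ) {u : ℝ → ℝ} (hu : DifferentiableOn ℝ u (Ioi 0)) :
    AEStronglyMeasurable (fun y => y * aw d pw y * Aop p Q u y ^ 2) (volume.restrict (Ioi 0)) := by
  have h1 : AEStronglyMeasurable (fun y => y * aw d pw y) (volume.restrict (Ioi 0)) :=
    (continuousOn_id.mul (aw_cont hd pw)).aestronglyMeasurable measurableSet_Ioi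
  exact h1.mul ((Aop_meas hu).pow 2)

theorem IA_fin (hd : 3 ≤ d) (pw : ℝ) {u : ℝ → ℝ} (hu : DifferentiableOn ℝ u (Ioi 0)) (h : IA d p Q pw u < ⊤) :
    IntegrableOn (fun y => y * aw d pw y * Aop p Q u y ^ 2) (Ioi 0) ∧
    IA d p Q pw u = ENNReal.ofReal (∫ y in Ioi (0:ℝ), y * aw d pw y * Aop p Q u y ^ 2) := by
  have h0 : 0 ≤ᵐ[volume.restrict (Ioi 0)] (fun y => y * aw d pw y * Aop p Q u y ^ 2) := by
    refine (ae_restrict_iff' measurableSet_Ioi).2 (ae_of_all _ fun y hy => ?_)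
    have hy0 : (0:ℝ) < y := hy
    have := aw_pos (d := d) pw hy0
    show 0 ≤ y * aw d pw y * Aop p Q u y ^ 2
    positivity
  have hi : IntegrableOn (fun y => y * aw d pw y * Aop p Q u y ^ 2) (Ioi 0) := by
    refine ⟨Aw_meas hd pw hu, ?_⟩
    rw [hasFiniteIntegral_iff_ofReal h0, ← IA_eq (by omega)]
    exact h
  refine ⟨hi, ?_⟩
  rw [IA_eq (by omega), ofReal_integral_eq_lintegral_ofReal hi h0]

theorem IA_le (hd : 3 ≤ d) (pw : ℝ) {u : ℝ → ℝ}
    (hi : IntegrableOn (fun y => y * aw d pw y * Aop p Q u y ^ 2) (Ioi 0)) {x z : ℝ} (hx : 0 ≤ x) (hxz : x ≤ z) :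
    ∫ y in x..z, y * aw d pw y * Aop p Q u y ^ 2 ≤ ∫ y in Ioi (0:ℝ), y * aw d pw y * Aop p Q u y ^ 2 := by
  rw [intervalIntegral.integral_of_le hxz]
  refine setIntegral_mono_set hi ?_ (Eventually.of_forall fun y hy => lt_of_le_of_lt hx hy.1)
  refine (ae_restrict_iff' measurableSet_Ioi).2 (ae_of_all _ fun y hy => ?_)
  have hy0 : (0:ℝ) < y := hy
  have := aw_pos (d := d) pw hy0
  show 0 ≤ y * aw d pw y * Aop p Q u y ^ 2
  positivity

/-- from control of `IB` to full coercivity -/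
theorem fin_coer (hd : 3 ≤ d) (pw : ℝ) {K K1 : ℝ} (hK : 0 < K) (hW : ∀ y, 0 < y → |y * Wpot p Q y| ≤ K)
    (hK1 : 0 ≤ K1) : ∃ c : ℝ, 0 < c ∧ ∀ u : ℝ → ℝ, DifferentiableOn ℝ u (Ioi 0) →
      (IA d p Q pw u < ⊤ → IB d pw u ≤ ENNReal.ofReal K1 * IA d p Q pw u) →
      ENNReal.ofReal c * (ID d pw u + IB d pw u) ≤ IA d p Q pw u := by
  set N : ℝ := 2 * K ^ 2 * K1 + 2 + K1 with hN
  have hN0 : 0 < N := by positivity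
  refine ⟨1 / N, by positivity, fun u hu hB => ?_⟩
  by_cases ht : IA d p Q pw u = ⊤
  · rw [ht]; exact le_top
  have hB := hB (lt_top_iff_ne_top.2 ht)
  have hD : ID d pw u ≤ ENNReal.ofReal (2 * K ^ 2) * IB d pw u + ENNReal.ofReal 2 * IA d p Q pw u := by
    rw [ID_eq (by omega), IB_eq (by omega), IA_eq (by omega), ← lintegral_const_mul' _ _ ENNReal.ofReal_ne_top,
      ← lintegral_const_mul' _ _ ENNReal.ofReal_ne_top, ← lintegral_add_right']
    · refine setLIntegral_mono' measurableSet_Ioi fun y hy => ?_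
      have hy0 : (0:ℝ) < y := hy
      have ha := aw_pos (d := d) pw hy0
      rw [← ENNReal.ofReal_mul (by positivity), ← ENNReal.ofReal_mul (by positivity), ← ENNReal.ofReal_add (by positivity) (by positivity)]
      apply ENNReal.ofReal_le_ofReal
      have h1 : (y * Wpot p Q y) ^ 2 ≤ K ^ 2 := by rw [← sq_abs]; gcongr; exact hW y hy0
      have h2 : deriv u y = Wpot p Q y * u y - Aop p Q u y := by unfold Aop; ring
      rw [h2]
      have h3 : (Wpot p Q y * u y - Aop p Q u y) ^ 2 ≤ 2 * (Wpot p Q y ^ 2 * u y ^ 2) + 2 * Aop p Q u y ^ 2 := by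
        nlinarith [sq_nonneg (Wpot p Q y * u y + Aop p Q u y)]
      have h4 : y * aw d pw y * (2 * (Wpot p Q y ^ 2 * u y ^ 2)) ≤ 2 * K ^ 2 * (u y ^ 2 * aw d pw y / y) := by
        have : y * aw d pw y * (2 * (Wpot p Q y ^ 2 * u y ^ 2)) = 2 * (y * Wpot p Q y) ^ 2 * (u y ^ 2 * aw d pw y / y) := by
          field_simp
        rw [this]
        gcongr
      calc y * aw d pw y * (Wpot p Q y * u y - Aop p Q u y) ^ 2
          ≤ y * aw d pw y * (2 * (Wpot p Q y ^ 2 * u y ^ 2) + 2 * Aop p Q u y ^ 2) := by gcongr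
        _ = y * aw d pw y * (2 * (Wpot p Q y ^ 2 * u y ^ 2)) + 2 * (y * aw d pw y * Aop p Q u y ^ 2) := by ring
        _ ≤ _ := by linarith
    · exact ((Aw_meas hd pw hu).aemeasurable.ennreal_ofReal).const_mul _
  have hT : ID d pw u + IB d pw u ≤ ENNReal.ofReal N * IA d p Q pw u := by
    calc ID d pw u + IB d pw u ≤ ENNReal.ofReal (2 * K ^ 2) * (ENNReal.ofReal K1 * IA d p Q pw u) + ENNReal.ofReal 2 * IA d p Q pw u
          + ENNReal.ofReal K1 * IA d p Q pw u := by
          refine add_le_add (hD.trans ?_) hB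
          gcongr
      _ = ENNReal.ofReal N * IA d p Q pw u := by
          rw [← mul_assoc, ← ENNReal.ofReal_mul (by positivity), ← add_mul, ← add_mul, ← ENNReal.ofReal_add (by positivity) (by positivity),
            ← ENNReal.ofReal_add (by positivity) (by positivity)]
  calc ENNReal.ofReal (1 / N) * (ID d pw u + IB d pw u) ≤ ENNReal.ofReal (1 / N) * (ENNReal.ofReal N * IA d p Q pw u) := by gcongr
    _ = IA d p Q pw u := by
      rw [← mul_assoc, ← ENNReal.ofReal_mul (by positivity)]
      rw [one_div, inv_mul_cancel₀ hN0.ne', ENNReal.ofReal_one, one_mul]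

theorem case_i (hd : 3 ≤ d) {pw c : ℝ} (hpw : 0 ≤ pw) (hc : 0 < c)
    (hW : ∀ y, 0 < y → c * aw d pw y ≤ y * (2 * Wpot p Q y * aw d pw y + aw' d pw y)) {u : ℝ → ℝ}
    (hu : DifferentiableOn ℝ u (Ioi 0)) (hA : IA d p Q pw u < ⊤)
    (hk : (∫⁻ y in Ioi (1:ℝ), ENNReal.ofReal ((u y) ^ 2 / y ^ (2 * pw + 2) * y ^ (d - 1))) < ⊤) :
    IB d pw u ≤ ENNReal.ofReal (4 / c ^ 2) * IA d p Q pw u := by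
  obtain ⟨hi, hIA⟩ := IA_fin hd pw hu hA
  rw [hIA, ← ENNReal.ofReal_mul (by positivity), IB_eq (by omega)]
  set J := ∫ y in Ioi (0:ℝ), y * aw d pw y * Aop p Q u y ^ 2 with hJ
  have hgc : ContinuousOn (fun y => u y ^ 2 * aw d pw y / y) (Ioi 0) :=
    ((hu.continuousOn.pow 2).mul (aw_cont hd pw)).div continuousOn_id fun y hy => ne_of_gt hy
  have hg0 : ∀ y, 0 < y → 0 ≤ u y ^ 2 * aw d pw y / y := fun y hy => by
    have := aw_pos (d := d) pw hy
    positivity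
  -- integrability at infinity
  have hgi : IntegrableOn (fun y => u y ^ 2 * aw d pw y / y) (Ioi 1) := by
    refine ⟨(hgc.mono (Ioi_subset_Ioi zero_le_one)).aestronglyMeasurable measurableSet_Ioi, ?_⟩
    rw [hasFiniteIntegral_iff_ofReal]
    · refine lt_of_le_of_lt (setLIntegral_mono' measurableSet_Ioi fun y hy => ?_) hk
      have hy0 : (0:ℝ) < y := zero_lt_one.trans hy
      apply ENNReal.ofReal_le_ofReal
      have hp : y ^ (d - 1) = y * y ^ (d - 2) := by rw [← pow_succ']; congr 1; omega
      have hr : y ^ (2 * pw + 2) = y ^ (2 * pw) * y ^ 2 := by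
        rw [Real.rpow_add hy0]; congr 1; exact Real.rpow_natCast y 2
      rw [hp, hr]
      unfold aw
      have h1 : 0 < y ^ (2 * pw) := by positivity
      have e : u y ^ 2 / (y ^ (2 * pw) * y ^ 2) * (y * y ^ (d - 2)) = u y ^ 2 * (y ^ (d - 2) / y ^ (2 * pw)) / y := by
        field_simp
      rw [e]
      gcongr
      linarith
    · refine (ae_restrict_iff' measurableSet_Ioi).2 (ae_of_all _ fun y hy => ?_)
      exact hg0 y (zero_lt_one.trans hy)
  have hfreq : ∀ ε > 0, ∀ Z : ℝ, 1 ≤ Z → ∃ z ≥ Z, u z ^ 2 * aw d pw z < ε := by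
    intro ε hε Z hZ
    by_contra hcon
    push Not at hcon
    apply not_integrableOn_Ioi_inv (a := Z)
    have h2 : IntegrableOn (fun y => ε⁻¹ * (u y ^ 2 * aw d pw y / y)) (Ioi Z) :=
      Integrable.const_mul (hgi.mono_set (Ioi_subset_Ioi hZ)) _
    refine Integrable.mono' h2 measurable_inv.aestronglyMeasurable ?_
    refine (ae_restrict_iff' measurableSet_Ioi).2 (ae_of_all _ fun y hy => ?_)
    have hy0 : (0:ℝ) < y := (zero_lt_one.trans_le hZ).trans hy
    rw [Real.norm_of_nonneg (by positivity)]
    have := hcon y (le_of_lt hy)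
    rw [inv_mul_eq_div, le_div_iff₀ hε, inv_mul_eq_div]
    gcongr
  refine exh_full hgc hg0 fun x z0 hx hxz0 => ?_
  refine le_of_forall_pos_le_add fun ε hε => ?_
  obtain ⟨z, hz, hzε⟩ := hfreq (ε * c / 2) (by positivity) (max 1 z0) (le_max_left _ _)
  have hz0 : z0 ≤ z := (le_max_right _ _).trans hz
  have hxz := hxz0.trans hz0
  have hpos : ∀ y ∈ Icc x z, 0 < y := fun y hy => hx.trans_le hy.1
  have key := hardy_up hc hx hxz (fun y hy => u_der (p := p) (Q := Q) hu (hpos y hy)) (fun y hy => aw_der hd pw (hpos y hy))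
    (fun y hy => aw_pos pw (hpos y hy)) (hi.mono_set fun y hy => hpos y hy) (fun y hy => hW y (hpos y hy))
  have hmono : ∫ y in x..z0, u y ^ 2 * aw d pw y / y ≤ ∫ y in x..z, u y ^ 2 * aw d pw y / y := by
    apply intervalIntegral.integral_mono_interval le_rfl hxz0 hz0
    · refine (ae_restrict_iff' measurableSet_Ioc).2 (ae_of_all _ fun y hy => ?_)
      exact hg0 y (hx.trans hy.1)
    · refine ContinuousOn.intervalIntegrable ?_
      rw [uIcc_of_le hxz]
      exact hgc.mono fun y hy => hpos y hy
  have hb : 2 / c * (u z ^ 2 * aw d pw z - u x ^ 2 * aw d pw x) ≤ ε := by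
    have h1 : 0 ≤ u x ^ 2 * aw d pw x := by
      have := aw_pos (d := d) pw hx
      positivity
    calc _ ≤ 2 / c * (ε * c / 2) := by gcongr; linarith
      _ = ε := by field_simp
  have hj := IA_le hd pw hi hx.le hxz
  have : 4 / c ^ 2 * ∫ y in x..z, y * aw d pw y * Aop p Q u y ^ 2 ≤ 4 / c ^ 2 * J := by gcongr
  linarith
end wts

section ctwo
variable {d : ℕ} {p θ a b α β : ℝ} {Q : ℝ → ℝ}

theorem hW_h (hQ : IsGroundState d p Q) (hpos : ∀ y : ℝ, 0 ≤ y → 0 < Lam1 p Q y) {y : ℝ} (hy : 0 < y) :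
    HasDerivAt (Lam1 p Q) (Wpot p Q y * Lam1 p Q y) y := by
  refine (h_der hQ y).congr_deriv ?_
  rw [W_eq hQ hpos hy]
  field_simp [(hpos y hy.le).ne']

theorem tilde_bound (hd : 3 ≤ d) (hQ : IsGroundState d p Q) (hpos : ∀ y : ℝ, 0 ≤ y → 0 < Lam1 p Q y)
    {pw c s R : ℝ} (hpw : 0 < pw) (hc : 0 < c) (hs : 0 < s) (hR : 0 < R)
    (hlo : ∀ y, 0 < y → s ≤ 2 * (y * Wpot p Q y) + ((d : ℝ) - 2))
    (hhi : ∀ y, R ≤ y → y * (2 * Wpot p Q y * aw d pw y + aw' d pw y) ≤ -(c * aw d pw y)) {u : ℝ → ℝ}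
    (hu : DifferentiableOn ℝ u (Ioi 0)) (hA : IA d p Q pw u < ⊤) :
    IB d pw (fun y => u y - u R / Lam1 p Q R * Lam1 p Q y) ≤
      ENNReal.ofReal (4 / s ^ 2 * (1 + R ^ (2 * pw)) + 4 / c ^ 2) * IA d p Q pw u := by
  obtain ⟨hi, hIA⟩ := IA_fin hd pw hu hA
  have hRp : 0 < R ^ (2 * pw) := by positivity
  rw [hIA, ← ENNReal.ofReal_mul (by positivity), IB_eq (by omega)]
  set J := ∫ y in Ioi (0:ℝ), y * aw d pw y * Aop p Q u y ^ 2 with hJ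
  have hJ0 : 0 ≤ J := by
    refine setIntegral_nonneg measurableSet_Ioi fun y hy => ?_
    have hy0 : (0:ℝ) < y := hy
    have := aw_pos (d := d) pw hy0
    positivity
  set ut : ℝ → ℝ := fun y => u y - u R / Lam1 p Q R * Lam1 p Q y with hut
  have hutR : ut R = 0 := by
    simp only [hut]
    field_simp [(hpos R hR.le).ne']
    ring
  have hutd : ∀ y, 0 < y → HasDerivAt ut (Wpot p Q y * ut y - Aop p Q u y) y := fun y hy =>
    ((u_der (p := p) (Q := Q) hu hy).fun_sub ((hW_h hQ hpos hy).const_mul _)).congr_deriv (by simp only [hut]; ring)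
  have hutc : ContinuousOn ut (Ioi 0) := fun y hy => (hutd y hy).continuousAt.continuousWithinAt
  have hgc : ContinuousOn (fun y => ut y ^ 2 * aw d pw y / y) (Ioi 0) :=
    ((hutc.pow 2).mul (aw_cont hd pw)).div continuousOn_id fun y hy => ne_of_gt hy
  have hg0 : ∀ y, 0 < y → 0 ≤ ut y ^ 2 * aw d pw y / y := fun y hy => by
    have := aw_pos (d := d) pw hy
    positivity
  have hup : ∫⁻ y in Ioi R, ENNReal.ofReal (ut y ^ 2 * aw d pw y / y) ≤ ENNReal.ofReal (4 / c ^ 2 * J) := by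
    refine exh_hi hR hgc hg0 fun z hz => ?_
    have hp0 : ∀ y ∈ Icc R z, 0 < y := fun y hy => hR.trans_le hy.1
    have key := hardy_dn hc hR hz (fun y hy => hutd y (hp0 y hy)) (fun y hy => aw_der hd pw (hp0 y hy))
      (fun y hy => aw_pos pw (hp0 y hy)) (hi.mono_set fun y hy => hp0 y hy) (fun y hy => hhi y hy.1)
    have hj := IA_le hd pw hi hR.le hz
    have h1 : 4 / c ^ 2 * ∫ y in R..z, y * aw d pw y * Aop p Q u y ^ 2 ≤ 4 / c ^ 2 * J := by gcongr
    have h2 : 0 ≤ 2 / c * (ut z ^ 2 * aw d pw z) := by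
      have := aw_pos (d := d) pw (hR.trans_le hz)
      positivity
    rw [hutR] at key
    linarith [key]
  have hlow : ∫⁻ y in Ioc 0 R, ENNReal.ofReal (ut y ^ 2 * aw d pw y / y) ≤
      ENNReal.ofReal (4 / s ^ 2 * (1 + R ^ (2 * pw)) * J) := by
    refine exh_lo hR hgc hg0 fun x hx hxR => ?_
    have hp0 : ∀ y ∈ Icc x R, 0 < y := fun y hy => hx.trans_le hy.1
    have hsub : Icc x R ⊆ Ioi 0 := fun y hy => hp0 y hy
    have hfe : ∀ y ∈ Icc x R, (1 + y ^ (2 * pw)) * (y * aw d pw y * Aop p Q u y ^ 2) = y * y ^ (d - 2) * Aop p Q u y ^ 2 := by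
      intro y hy
      have := pw_pos pw (hp0 y hy)
      unfold aw
      field_simp
    have hcw : Continuous (fun y : ℝ => 1 + y ^ (2 * pw)) :=
      continuous_const.add (Real.continuous_rpow_const (by linarith))
    have hint : IntegrableOn (fun y => y * y ^ (d - 2) * Aop p Q u y ^ 2) (Icc x R) :=
      (IntegrableOn.continuousOn_mul hcw.continuousOn (hi.mono_set hsub) isCompact_Icc).congr_fun hfe measurableSet_Icc
    have key := hardy_up (a := fun y => y ^ (d - 2)) (a' := fun y => ((d - 2 : ℕ) : ℝ) * y ^ (d - 2 - 1)) (W := Wpot p Q) hs hx hxR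
      (fun y hy => hutd y (hp0 y hy)) (fun y hy => hasDerivAt_pow (d - 2) y)
      (fun y hy => pow_pos (hp0 y hy) _) hint (fun y hy => by
        have hc' : ((d - 2 : ℕ) : ℝ) = d - 2 := by rw [Nat.cast_sub (by omega)]; simp
        have hpp : y ^ (d - 2) = y * y ^ (d - 2 - 1) := by rw [← pow_succ']; congr 1; omega
        have h1 := hlo y (hp0 y hy)
        have h2 : 0 < y ^ (d - 2) := pow_pos (hp0 y hy) _
        show s * y ^ (d - 2) ≤ y * (2 * Wpot p Q y * y ^ (d - 2) + ((d - 2 : ℕ) : ℝ) * y ^ (d - 2 - 1))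
        have e : y * (2 * Wpot p Q y * y ^ (d - 2) + ((d - 2 : ℕ) : ℝ) * y ^ (d - 2 - 1)) =
          (2 * (y * Wpot p Q y) + ((d : ℝ) - 2)) * y ^ (d - 2) := by
          rw [hc', hpp]; ring
        rw [e]
        gcongr)
    have hmono : ∫ y in x..R, ut y ^ 2 * aw d pw y / y ≤ ∫ y in x..R, ut y ^ 2 * y ^ (d - 2) / y := by
      refine intervalIntegral.integral_mono_on hxR ?_ ?_ fun y hy => ?_
      · refine ContinuousOn.intervalIntegrable ?_
        rw [uIcc_of_le hxR]
        exact hgc.mono hsub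
      · refine ContinuousOn.intervalIntegrable ?_
        rw [uIcc_of_le hxR]
        exact (((hutc.pow 2).mul (continuous_pow _).continuousOn).div continuousOn_id fun y hy => ne_of_gt hy).mono hsub
      · have hy0 := hp0 y hy
        have : aw d pw y ≤ y ^ (d - 2) := by
          unfold aw
          apply div_le_self (by positivity)
          have : 0 < y ^ (2 * pw) := by positivity
          linarith
        gcongr
    have hj := IA_le hd pw hi hx.le hxR
    have hmono2 : ∫ y in x..R, y * y ^ (d - 2) * Aop p Q u y ^ 2 ≤ (1 + R ^ (2 * pw)) * J := by
      calc ∫ y in x..R, y * y ^ (d - 2) * Aop p Q u y ^ 2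
          ≤ ∫ y in x..R, (1 + R ^ (2 * pw)) * (y * aw d pw y * Aop p Q u y ^ 2) := by
            refine intervalIntegral.integral_mono_on hxR ((intervalIntegrable_iff_integrableOn_Icc_of_le hxR).2 hint)
              (((intervalIntegrable_iff_integrableOn_Icc_of_le hxR).2 (hi.mono_set hsub)).const_mul _) fun y hy => ?_
            have hy0 := hp0 y hy
            rw [← hfe y hy]
            have := aw_pos (d := d) pw hy0
            have h2 : y ^ (2 * pw) ≤ R ^ (2 * pw) := Real.rpow_le_rpow hy0.le hy.2 (by linarith)
            gcongr
        _ = (1 + R ^ (2 * pw)) * ∫ y in x..R, (y * aw d pw y * Aop p Q u y ^ 2) := by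
            rw [intervalIntegral.integral_const_mul]
        _ ≤ _ := by gcongr
    have h1 : 4 / s ^ 2 * ∫ y in x..R, y * y ^ (d - 2) * Aop p Q u y ^ 2 ≤ 4 / s ^ 2 * ((1 + R ^ (2 * pw)) * J) := by gcongr
    have h2 : 0 ≤ 2 / s * (ut x ^ 2 * x ^ (d - 2)) := by positivity
    rw [hutR] at key
    linarith [key]
  rw [← Ioc_union_Ioi_eq_Ioi hR.le]
  refine (lintegral_union_le _ _ _).trans ?_
  rw [add_mul, ENNReal.ofReal_add (by positivity) (by positivity)]
  exact add_le_add hlow hup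

/-- integrability from boundedness and compact support -/
theorem int_bdd {g k : ℝ → ℝ} {B R : ℝ} (hg : ContinuousOn g (Ioi 0)) (hk : Continuous k)
    (hb : ∀ y, 0 < y → |g y| ≤ B) (hR : 0 ≤ R) (hz : ∀ y, R < y → g y = 0) :
    IntegrableOn (fun y => g y * k y) (Ioi 0) := by
  have hm : AEStronglyMeasurable (fun y => g y * k y) (volume.restrict (Ioi 0)) :=
    (hg.mul hk.continuousOn).aestronglyMeasurable measurableSet_Ioi
  rw [← Ioc_union_Ioi_eq_Ioi hR]
  refine IntegrableOn.union ?_ ?_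
  · have hk : IntegrableOn (fun y => B * |k y|) (Ioc 0 R) :=
      ((by fun_prop : Continuous (fun y => B * |k y|)).integrableOn_Icc).mono_set Ioc_subset_Icc_self
    refine Integrable.mono' hk (hm.mono_measure (Measure.restrict_mono Ioc_subset_Ioi_self le_rfl)) ?_
    refine (ae_restrict_iff' measurableSet_Ioc).2 (ae_of_all _ fun y hy => ?_)
    rw [Real.norm_eq_abs, abs_mul]
    exact mul_le_mul_of_nonneg_right (hb y hy.1) (abs_nonneg _)
  · refine (integrableOn_zero (s := Ioi R) (μ := volume) (ε' := ℝ)).congr_fun (fun y hy => ?_) measurableSet_Ioi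
    simp only [hz y hy]; simp

theorem h_IB (hd : 3 ≤ d) (hQ : IsGroundState d p Q) (hpos : ∀ y : ℝ, 0 ≤ y → 0 < Lam1 p Q y)
    {pw c R : ℝ} (hpw : 0 < pw) (hc : 0 < c) (hR : 0 < R)
    (hhi : ∀ y, R ≤ y → y * (2 * Wpot p Q y * aw d pw y + aw' d pw y) ≤ -(c * aw d pw y)) :
    IB d pw (Lam1 p Q) < ⊤ := by
  rw [IB_eq (by omega)]
  have hhc := h_cont hQ
  have hgc : ContinuousOn (fun y => Lam1 p Q y ^ 2 * aw d pw y / y) (Ioi 0) :=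
    ((hhc.continuousOn.pow 2).mul (aw_cont hd pw)).div continuousOn_id fun y hy => ne_of_gt hy
  have hg0 : ∀ y, 0 < y → 0 ≤ Lam1 p Q y ^ 2 * aw d pw y / y := fun y hy => by
    have := aw_pos (d := d) pw hy
    positivity
  rw [← Ioc_union_Ioi_eq_Ioi hR.le]
  refine lt_of_le_of_lt (lintegral_union_le _ _ _) (ENNReal.add_lt_top.2 ⟨?_, ?_⟩)
  · have hk : IntegrableOn (fun y => Lam1 p Q y ^ 2 * y ^ (d - 2 - 1)) (Ioc 0 R) :=
      ((by fun_prop : Continuous (fun y => Lam1 p Q y ^ 2 * y ^ (d - 2 - 1))).integrableOn_Icc).mono_set Ioc_subset_Icc_self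
    refine lt_of_le_of_lt (setLIntegral_mono' measurableSet_Ioc fun y hy => ?_) (Integrable.lintegral_lt_top hk)
    have hy0 : 0 < y := hy.1
    apply ENNReal.ofReal_le_ofReal
    have : aw d pw y ≤ y * y ^ (d - 2 - 1) := by
      have hpp : y ^ (d - 2) = y * y ^ (d - 2 - 1) := by rw [← pow_succ']; congr 1; omega
      unfold aw
      rw [← hpp]
      apply div_le_self (by positivity)
      have : 0 < y ^ (2 * pw) := by positivity
      linarith
    rw [div_le_iff₀ hy0]
    calc _ ≤ Lam1 p Q y ^ 2 * (y * y ^ (d - 2 - 1)) := by gcongr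
      _ = _ := by ring
  · refine lt_of_le_of_lt (exh_hi (B := 2 / c * (Lam1 p Q R ^ 2 * aw d pw R)) hR hgc hg0 fun z hz => ?_) ENNReal.ofReal_lt_top
    have hp0 : ∀ y ∈ Icc R z, 0 < y := fun y hy => hR.trans_le hy.1
    have key := hardy_dn (f := fun _ => 0) (u := Lam1 p Q) (W := Wpot p Q) hc hR hz
      (fun y hy => (hW_h hQ hpos (hp0 y hy)).congr_deriv (by ring)) (fun y hy => aw_der hd pw (hp0 y hy))
      (fun y hy => aw_pos pw (hp0 y hy)) (by simp) (fun y hy => hhi y hy.1)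
    have h2 : 0 ≤ 2 / c * (Lam1 p Q z ^ 2 * aw d pw z) := by
      have := aw_pos (d := d) pw (hR.trans_le hz)
      positivity
    simp only [ne_eq, OfNat.ofNat_ne_zero, not_false_eq_true, zero_pow, mul_zero, intervalIntegral.integral_zero, add_zero] at key
    linarith

theorem case_ii (hd : 3 ≤ d) (hQ : IsGroundState d p Q) (hpos : ∀ y : ℝ, 0 ≤ y → 0 < Lam1 p Q y)
    {pw c s R : ℝ} (hpw : 0 < pw) (hc : 0 < c) (hs : 0 < s) (hR : 0 < R)
    (hlo : ∀ y, 0 < y → s ≤ 2 * (y * Wpot p Q y) + ((d : ℝ) - 2))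
    (hhi : ∀ y, R ≤ y → y * (2 * Wpot p Q y * aw d pw y + aw' d pw y) ≤ -(c * aw d pw y))
    {Φ : ℝ → ℝ} {M B : ℝ} (hM : 0 < M) (hΦc : ContinuousOn Φ (Ioi 0)) (hΦz : ∀ y, 2 * M < y → Φ y = 0)
    (hΦb : ∀ y, 0 < y → |Φ y| ≤ B) (hF : rInner d Φ (Lam1 p Q) ≠ 0) :
    ∃ K1 : ℝ, 0 ≤ K1 ∧ ∀ u : ℝ → ℝ, DifferentiableOn ℝ u (Ioi 0) → rInner d u Φ = 0 → IA d p Q pw u < ⊤ →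
      IB d pw u ≤ ENNReal.ofReal K1 * IA d p Q pw u := by
  have hhc := h_cont hQ
  set h := Lam1 p Q with hh
  set F := rInner d Φ h with hFdef
  set K2 : ℝ := 4 / s ^ 2 * (1 + R ^ (2 * pw)) + 4 / c ^ 2 with hK2
  have hRp : 0 < R ^ (2 * pw) := by positivity
  have hK20 : 0 ≤ K2 := by positivity
  have hint_of : ∀ f : ℝ → ℝ, ContinuousOn f (Ioi 0) → IB d pw f < ⊤ →
      IntegrableOn (fun y => f y ^ 2 * aw d pw y / y) (Ioi 0) ∧
      IB d pw f = ENNReal.ofReal (∫ y in Ioi (0:ℝ), f y ^ 2 * aw d pw y / y) ∧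
      0 ≤ ∫ y in Ioi (0:ℝ), f y ^ 2 * aw d pw y / y := by
    intro f hf hfin
    have hg0 : ∀ y ∈ Ioi (0:ℝ), 0 ≤ f y ^ 2 * aw d pw y / y := fun y hy => by
      have := aw_pos (d := d) pw hy
      have hy0 : (0:ℝ) < y := hy
      positivity
    have h0 : 0 ≤ᵐ[volume.restrict (Ioi 0)] (fun y => f y ^ 2 * aw d pw y / y) :=
      (ae_restrict_iff' measurableSet_Ioi).2 (ae_of_all _ hg0)
    have hi : IntegrableOn (fun y => f y ^ 2 * aw d pw y / y) (Ioi 0) := by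
      refine ⟨(((hf.pow 2).mul (aw_cont hd pw)).div continuousOn_id fun y hy => ne_of_gt hy).aestronglyMeasurable
        measurableSet_Ioi, ?_⟩
      rw [hasFiniteIntegral_iff_ofReal h0, ← IB_eq (by omega)]
      exact hfin
    refine ⟨hi, ?_, setIntegral_nonneg measurableSet_Ioi hg0⟩
    rw [IB_eq (by omega), ofReal_integral_eq_lintegral_ofReal hi h0]
  obtain ⟨hTi, hTe, hT0⟩ := hint_of h hhc.continuousOn (h_IB hd hQ hpos hpw hc hR hhi)
  set T := ∫ y in Ioi (0:ℝ), h y ^ 2 * aw d pw y / y with hT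
  have hcw : Continuous (fun y : ℝ => 1 + y ^ (2 * pw)) :=
    continuous_const.add (Real.continuous_rpow_const (by linarith))
  have hPi : IntegrableOn (fun y => Φ y ^ 2 * (y ^ 2 * (1 + y ^ (2 * pw)) * y ^ (d - 1))) (Ioi 0) :=
    int_bdd (B := B ^ 2) (R := 2 * M) (hΦc.pow 2) (((continuous_pow 2).mul hcw).mul (continuous_pow _))
      (fun y hy => by rw [abs_pow]; gcongr; exact hΦb y hy) (by linarith) (fun y hy => by rw [hΦz y hy]; simp)
  set P := ∫ y in Ioi (0:ℝ), Φ y ^ 2 * (y ^ 2 * (1 + y ^ (2 * pw)) * y ^ (d - 1)) with hP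
  have hP0 : 0 ≤ P := by
    refine setIntegral_nonneg measurableSet_Ioi fun y hy => ?_
    have hy0 : (0:ℝ) < y := hy
    positivity
  have hFi : IntegrableOn (fun y => Φ y * (h y * y ^ (d - 1))) (Ioi 0) :=
    int_bdd (B := B) (R := 2 * M) hΦc (hhc.mul (continuous_pow _)) hΦb (by linarith) hΦz
  refine ⟨2 * K2 + 2 * (K2 * P / F ^ 2) * T, by positivity, fun u hu horth hA => ?_⟩
  obtain ⟨hi, hIA⟩ := IA_fin hd pw hu hA
  have htb := tilde_bound hd hQ hpos hpw hc hs hR hlo hhi hu hA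
  set J := ∫ y in Ioi (0:ℝ), y * aw d pw y * Aop p Q u y ^ 2 with hJ
  have hJ0 : 0 ≤ J := by
    refine setIntegral_nonneg measurableSet_Ioi fun y hy => ?_
    have hy0 : (0:ℝ) < y := hy
    have := aw_pos (d := d) pw hy0
    positivity
  set v := u R / h R with hv
  set ut : ℝ → ℝ := fun y => u y - v * h y with hut
  have hutc : ContinuousOn ut (Ioi 0) := hu.continuousOn.sub (hhc.const_mul v).continuousOn
  rw [hIA, ← ENNReal.ofReal_mul hK20] at htb
  obtain ⟨hSi, hSe, hS0⟩ := hint_of ut hutc (htb.trans_lt ENNReal.ofReal_lt_top)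
  set S := ∫ y in Ioi (0:ℝ), ut y ^ 2 * aw d pw y / y with hS
  rw [hSe, ENNReal.ofReal_le_ofReal_iff (by positivity)] at htb
  -- pairing
  have hpt : ∀ y : ℝ, 0 < y → ∀ l : ℝ, 0 ≤ l ^ 2 * (ut y ^ 2 * aw d pw y / y) + 2 * l * (ut y * Φ y * y ^ (d - 1))
      + Φ y ^ 2 * (y ^ 2 * (1 + y ^ (2 * pw)) * y ^ (d - 1)) := by
    intro y hy l
    have h1 := pw_pos pw hy
    have hpp : y ^ (d - 1) = y * y ^ (d - 2) := by rw [← pow_succ']; congr 1; omega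
    have e : l ^ 2 * (ut y ^ 2 * aw d pw y / y) + 2 * l * (ut y * Φ y * y ^ (d - 1))
      + Φ y ^ 2 * (y ^ 2 * (1 + y ^ (2 * pw)) * y ^ (d - 1)) =
      (y ^ (d - 2) / ((1 + y ^ (2 * pw)) * y)) * (l * ut y + y ^ 2 * (1 + y ^ (2 * pw)) * Φ y) ^ 2 := by
      unfold aw
      rw [hpp]
      field_simp
      ring
    rw [e]; positivity
  have hXi : IntegrableOn (fun y => ut y * Φ y * y ^ (d - 1)) (Ioi 0) := by
    have hdom : IntegrableOn (fun y => (1/2) * (ut y ^ 2 * aw d pw y / y) +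
      (1/2) * (Φ y ^ 2 * (y ^ 2 * (1 + y ^ (2 * pw)) * y ^ (d - 1)))) (Ioi 0) :=
      (Integrable.const_mul hSi _).add (Integrable.const_mul hPi _)
    refine Integrable.mono' hdom (((hutc.mul hΦc).mul (continuous_pow _).continuousOn).aestronglyMeasurable measurableSet_Ioi) ?_
    refine (ae_restrict_iff' measurableSet_Ioi).2 (ae_of_all _ fun y hy => ?_)
    have p1 := hpt y hy 1
    have p2 := hpt y hy (-1)
    rw [Real.norm_eq_abs, abs_le]
    constructor <;> linarith
  set X := ∫ y in Ioi (0:ℝ), ut y * Φ y * y ^ (d - 1) with hX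
  have hXv : X = -(v * F) := by
    have e : rInner d u Φ = X + v * F := by
      rw [hFdef, hX]
      unfold rInner
      have hFi' : IntegrableOn (fun y => Φ y * h y * y ^ (d - 1)) (Ioi 0) := by
        refine hFi.congr_fun (fun y _ => ?_) measurableSet_Ioi
        show Φ y * (h y * y ^ (d - 1)) = _
        ring
      rw [← integral_const_mul, ← integral_add hXi (Integrable.const_mul hFi' v)]
      congr 1
      funext y
      simp only [hut]; ring
    linarith
  have hdis : discrim S (2 * X) P ≤ 0 := by
    apply discrim_le_zero
    intro l
    have e : S * (l * l) + 2 * X * l + P = ∫ y in Ioi (0:ℝ), (l ^ 2 * (ut y ^ 2 * aw d pw y / y) + 2 * l * (ut y * Φ y * y ^ (d - 1))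
      + Φ y ^ 2 * (y ^ 2 * (1 + y ^ (2 * pw)) * y ^ (d - 1))) := by
      have hab : Integrable (fun y => l ^ 2 * (ut y ^ 2 * aw d pw y / y) + 2 * l * (ut y * Φ y * y ^ (d - 1)))
          (volume.restrict (Ioi 0)) := (Integrable.const_mul hSi _).add (Integrable.const_mul hXi _)
      rw [integral_add hab hPi,
        integral_add (Integrable.const_mul hSi _) (Integrable.const_mul hXi _), integral_const_mul, integral_const_mul]
      ring
    rw [e]
    exact setIntegral_nonneg measurableSet_Ioi fun y hy => hpt y hy l
  have hv2 : v ^ 2 ≤ K2 * P / F ^ 2 * J := by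
    unfold discrim at hdis
    rw [hXv] at hdis
    have hF2 : 0 < F ^ 2 := by positivity
    have h1 : v ^ 2 * F ^ 2 ≤ S * P := by nlinarith
    have h2 : S * P ≤ K2 * J * P := mul_le_mul_of_nonneg_right htb hP0
    rw [div_mul_eq_mul_div, le_div_iff₀ hF2]
    nlinarith
  -- conclusion
  rw [hIA, ← ENNReal.ofReal_mul (by positivity)]
  have hfin : IB d pw u ≤ ENNReal.ofReal 2 * IB d pw ut + ENNReal.ofReal (2 * v ^ 2) * IB d pw h := by
    rw [IB_eq (by omega), IB_eq (by omega), IB_eq (by omega), ← lintegral_const_mul' _ _ ENNReal.ofReal_ne_top,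
      ← lintegral_const_mul' _ _ ENNReal.ofReal_ne_top, ← lintegral_add_right']
    · refine setLIntegral_mono' measurableSet_Ioi fun y hy => ?_
      have hy0 : (0:ℝ) < y := hy
      have ha := aw_pos (d := d) pw hy0
      rw [← ENNReal.ofReal_mul (by positivity), ← ENNReal.ofReal_mul (by positivity), ← ENNReal.ofReal_add (by positivity) (by positivity)]
      apply ENNReal.ofReal_le_ofReal
      have h1 : u y ^ 2 ≤ 2 * ut y ^ 2 + 2 * v ^ 2 * h y ^ 2 := by
        have : u y = ut y + v * h y := by simp only [hut]; ring
        rw [this]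
        nlinarith [sq_nonneg (ut y - v * h y)]
      calc u y ^ 2 * aw d pw y / y ≤ (2 * ut y ^ 2 + 2 * v ^ 2 * h y ^ 2) * aw d pw y / y := by gcongr
        _ = _ := by ring
    · exact (hTi.aestronglyMeasurable.aemeasurable.ennreal_ofReal).const_mul _
  refine hfin.trans ?_
  rw [hSe, hTe, ← ENNReal.ofReal_mul (by positivity), ← ENNReal.ofReal_mul (by positivity), ← ENNReal.ofReal_add (by positivity) (by positivity)]
  apply ENNReal.ofReal_le_ofReal
  have := mul_le_mul_of_nonneg_right hv2 hT0
  linarith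
end ctwo

/-- **Weighted coercivity for `A`** (Lemma D.2):
(i) for `0 ≤ p_w < k₀ + δ₀ - 1` there is `c > 0` such that every radial `u ∈ H¹_loc` with
`∫_{y≥1} u²/y^{2p_w+2} < ∞` satisfies
`∫ |Au|²/(1+y^{2p_w}) ≥ c [∫ |∂_y u|²/(1+y^{2p_w}) + ∫ u²/(y²(1+y^{2p_w}))]`;
(ii) for `p_w > k₀ + δ₀ - 1` and `M` large enough, the same holds for every radial
`u ∈ H¹_loc` with `⟨u, Φ_M⟩ = 0` (integrals against `y^{d-1}dy`, possibly infinite). -/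
theorem weighted_coercivity_A (d : ℕ) (hd : 11 ≤ d) (p : ℝ) (hp1 : 1 < p)
    (hp : pJL d < p) (hγ : ∀ n : ℕ, (d : ℝ) / 2 - gam d p ≠ (n : ℝ))
    (Q : ℝ → ℝ) (hQ : IsGroundState d p Q) (hpos : ∀ y : ℝ, 0 ≤ y → 0 < Lam1 p Q y)
    (L : ℕ) (hL : Odd L) (χ : ℝ → ℝ) (hχ : IsCutoff χ) :
    -- (i) case p_w small
    (∀ pw : ℝ, 0 ≤ pw → pw < (kzero d p : ℝ) + deltazero d p - 1 →
      ∃ c : ℝ, 0 < c ∧ ∀ u : ℝ → ℝ, DifferentiableOn ℝ u (Ioi 0) →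
        (∫⁻ y in Ioi (1:ℝ),
            ENNReal.ofReal ((u y) ^ 2 / y ^ (2 * pw + 2) * y ^ (d - 1))) < ⊤ →
        ENNReal.ofReal c *
            ((∫⁻ y in Ioi (0:ℝ),
                ENNReal.ofReal ((deriv u y) ^ 2 / (1 + y ^ (2 * pw)) * y ^ (d - 1))) +
              (∫⁻ y in Ioi (0:ℝ),
                ENNReal.ofReal ((u y) ^ 2 / (y ^ 2 * (1 + y ^ (2 * pw))) * y ^ (d - 1)))) ≤
          ∫⁻ y in Ioi (0:ℝ),
            ENNReal.ofReal ((Aop p Q u y) ^ 2 / (1 + y ^ (2 * pw)) * y ^ (d - 1))) ∧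
    -- (ii) case p_w large
    (∀ pw : ℝ, (kzero d p : ℝ) + deltazero d p - 1 < pw →
      ∃ M₀ : ℝ, 0 < M₀ ∧ ∀ M : ℝ, M₀ ≤ M → ∃ c : ℝ, 0 < c ∧
        ∀ u : ℝ → ℝ, DifferentiableOn ℝ u (Ioi 0) →
          rInner d u (PhiM d p Q χ M L).1 = 0 →
          ENNReal.ofReal c *
              ((∫⁻ y in Ioi (0:ℝ),
                  ENNReal.ofReal ((deriv u y) ^ 2 / (1 + y ^ (2 * pw)) * y ^ (d - 1))) +
                (∫⁻ y in Ioi (0:ℝ),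
                  ENNReal.ofReal ((u y) ^ 2 / (y ^ 2 * (1 + y ^ (2 * pw))) * y ^ (d - 1)))) ≤
            ∫⁻ y in Ioi (0:ℝ),
              ENNReal.ofReal ((Aop p Q u y) ^ 2 / (1 + y ^ (2 * pw)) * y ^ (d - 1))) := by
  obtain ⟨θ, a, b, α, β, C⟩ := PC.mk' d hd p hp1 hp
  obtain ⟨hW1, hW2, K, hK, hW3⟩ := W_facts C hQ hpos
  have hd3 : 3 ≤ d := by omega
  have hkd : (kzero d p : ℝ) + deltazero d p = (d : ℝ) / 2 - (α + θ) := by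
    unfold deltazero; rw [C.hgam]; ring
  have hs : 0 < (d : ℝ) - 2 - 2 * (α + θ) := by
    have h1 := C.hαβ
    have h2 := C.hsum
    have h3 := C.hb
    linarith
  have hfac : ∀ pw y : ℝ, 0 < y → y * (2 * Wpot p Q y * aw d pw y + aw' d pw y) =
      (2 * (y * Wpot p Q y) + ((d : ℝ) - 2) - 2 * pw * (y ^ (2 * pw) / (1 + y ^ (2 * pw)))) * aw d pw y := by
    intro pw y hy
    unfold aw'
    field_simp
    ring
  have ht1 : ∀ pw y : ℝ, 0 < y → y ^ (2 * pw) / (1 + y ^ (2 * pw)) ≤ 1 := by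
    intro pw y hy
    rw [div_le_one (pw_pos pw hy)]
    linarith
  refine ⟨fun pw hpw0 hpw => ?_, fun pw hpw => ?_⟩
  · rw [hkd] at hpw
    have hc : 0 < (d : ℝ) - 2 - 2 * (α + θ) - 2 * pw := by linarith
    obtain ⟨c, hc0, hc1⟩ := fin_coer (p := p) (Q := Q) (K1 := 4 / ((d : ℝ) - 2 - 2 * (α + θ) - 2 * pw) ^ 2) hd3 pw hK hW3
      (by positivity)
    refine ⟨c, hc0, fun u hu hfin => ?_⟩
    refine hc1 u hu fun hA => case_i hd3 hpw0 hc (fun y hy => ?_) hu hA hfin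
    rw [hfac pw y hy]
    have h1 := hW1 y hy
    have h2 := ht1 pw y hy
    have h3 : 2 * pw * (y ^ (2 * pw) / (1 + y ^ (2 * pw))) ≤ 2 * pw * 1 := by gcongr
    exact mul_le_mul_of_nonneg_right (by linarith) (aw_pos pw hy).le
  · rw [hkd] at hpw
    have hpw0 : 0 < pw := by linarith
    obtain ⟨M₀, hM₀, hMF⟩ := F_evnz C hQ hpos hχ
    have hlim : Tendsto (fun y : ℝ => 2 * (y * Wpot p Q y) + ((d : ℝ) - 2) - 2 * pw * (y ^ (2 * pw) / (1 + y ^ (2 * pw))))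
        atTop (𝓝 (2 * (-(α + θ)) + ((d : ℝ) - 2) - 2 * pw * (1 - 0))) := by
      refine ((hW2.const_mul 2).add_const _).sub (Tendsto.const_mul _ ?_)
      have h1 : Tendsto (fun y : ℝ => (1 + y ^ (2 * pw))⁻¹) atTop (𝓝 0) :=
        (tendsto_atTop_add_const_left _ 1 (tendsto_rpow_atTop (by linarith : 0 < 2 * pw))).inv_tendsto_atTop
      refine (h1.const_sub 1).congr' ?_
      filter_upwards [eventually_gt_atTop 0] with y hy
      have := pw_pos pw hy
      field_simp
      ring
    have hc : 0 < pw - ((d : ℝ) / 2 - (α + θ) - 1) := by linarith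
    have hev := hlim.eventually (gt_mem_nhds (show 2 * (-(α + θ)) + ((d : ℝ) - 2) - 2 * pw * (1 - 0) <
      -(pw - ((d : ℝ) / 2 - (α + θ) - 1)) by linarith))
    obtain ⟨R₀, hR₀⟩ := eventually_atTop.1 hev
    refine ⟨M₀, hM₀, fun M hM => ?_⟩
    have hM0 : 0 < M := hM₀.trans_le hM
    obtain ⟨f1, f2, ⟨B, hB0, f3⟩, f4⟩ := Phi_facts C hQ hχ hM0 L (hMF M hM)
    obtain ⟨K1, hK1, hcii⟩ := case_ii (R := max R₀ 1) hd3 hQ hpos hpw0 hc hs (lt_of_lt_of_le one_pos (le_max_right _ _))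
      (fun y hy => by have := hW1 y hy; linarith)
      (fun y hy => by
        have hy0 : 0 < y := lt_of_lt_of_le one_pos ((le_max_right _ _).trans hy)
        rw [hfac pw y hy0, ← neg_mul]
        exact mul_le_mul_of_nonneg_right (hR₀ y ((le_max_left _ _).trans hy)).le (aw_pos pw hy0).le)
      hM0 f1 f2 f3 f4
    obtain ⟨c, hc0, hc1⟩ := fin_coer (p := p) (Q := Q) (d := d) hd3 pw hK hW3 hK1
    exact ⟨c, hc0, fun u hu horth => hc1 u hu (hcii u hu horth)⟩

end WaveBlowup
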